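/- Let d = 1, λ > 0, and α = α(1) = (1+√17)/2. Let u₀ ∈ Σ and suppose the corresponding solution u of the nonlinear Schrödinger equation is positively global, satisfies ‖u‖_{L^{a,∞}((0,∞),L^{α+2})} < ∞ with a = 2α(α+2)/(4-α(d-2))|_{d=1}, and does not scatter at +∞ (i.e., e^{-itΔ}u(t) has no strong limit in Σ as t → +∞). Then there exist constants C > 0 such that: (i) ‖(x + 2it∇)u(t)‖_{L²} ≥ C t^{3/4 - 1/α} for all t ∈ [0,∞); and (ii) ‖u(t)‖_{L^{α+2}} ≥ C t^{-α/(2(α+2))} (log t)^{1/(α+2)} for all t ∈ [1,∞). (These two bounds are contradictory with the weak-L^a hypothesis, which yields the scattering theorem at α = α(1).) -/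

import Mathlib

/- Common setting: the nonlinear Schrödinger equation `i ∂ₜ u + Δu + λ|u|^α u = 0`
on `ℝ × ℝ^d`, formalized through its Duhamel (integral) formulation, with the free
Schrödinger group `e^{itΔ}` defined via its explicit kernel. -/

noncomputable section
open MeasureTheory Real Filter Topology Set
open scoped ENNReal NNReal

abbrev Rd (d : ℕ) := EuclideanSpace ℝ (Fin d)

/-- The free Schrödinger propagator `e^{itΔ}` on `ℝ^d`, defined through its explicit
kernel `(4πit)^{-d/2} e^{i|x-y|²/(4t)}` for `t ≠ 0`, and the identity for `t = 0`. -/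
def sgroup (d : ℕ) (t : ℝ) (φ : Rd d → ℂ) : Rd d → ℂ :=
  if t = 0 then φ else fun x =>
    (((4 * π * t : ℝ) : ℂ) * Complex.I) ^ (-(d : ℂ) / 2) *
      ∫ y : Rd d, Complex.exp (Complex.I * ((‖x - y‖ ^ 2 : ℝ) : ℂ) / ((4 * t : ℝ) : ℂ)) * φ y

/-- `L^p` norm (as an extended real) of a function on `ℝ^d`. -/
def LpN (d : ℕ) (p : ℝ) (f : Rd d → ℂ) : ℝ≥0∞ :=
  eLpNorm f (ENNReal.ofReal p) volume

/-- `L^p` norm of the (first-order) derivative. -/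
def gradLpN (d : ℕ) (p : ℝ) (f : Rd d → ℂ) : ℝ≥0∞ :=
  eLpNorm (fun x => fderiv ℝ f x) (ENNReal.ofReal p) volume

/-- `H¹` norm. -/
def H1N (d : ℕ) (f : Rd d → ℂ) : ℝ≥0∞ := LpN d 2 f + gradLpN d 2 f

/-- `H²` norm. -/
def H2N (d : ℕ) (f : Rd d → ℂ) : ℝ≥0∞ :=
  H1N d f + eLpNorm (fun x => fderiv ℝ (fun y => fderiv ℝ f y) x) 2 volume

/-- `W^{1,p}` norm. -/
def W1pN (d : ℕ) (p : ℝ) (f : Rd d → ℂ) : ℝ≥0∞ := LpN d p f + gradLpN d p f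

/-- The weighted norm `‖ |x| f ‖_{L²}`. -/
def weightN (d : ℕ) (f : Rd d → ℂ) : ℝ≥0∞ :=
  eLpNorm (fun x : Rd d => ‖x‖ * ‖f x‖) 2 volume

/-- Norm of `Σ = H¹ ∩ L²(|x|²dx)`. -/
def SigmaN (d : ℕ) (f : Rd d → ℂ) : ℝ≥0∞ := H1N d f + weightN d f

/-- Norm of `H² ∩ F(H²)` (recall `u ∈ F(H²)` iff `u ∈ L²` and `|x|²u ∈ L²`). -/
def H2FH2N (d : ℕ) (f : Rd d → ℂ) : ℝ≥0∞ :=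
  H2N d f + eLpNorm (fun x : Rd d => ‖x‖ ^ 2 * ‖f x‖) 2 volume

/-- Membership in `Σ`. -/
def MemSigma (d : ℕ) (f : Rd d → ℂ) : Prop :=
  AEStronglyMeasurable f volume ∧ SigmaN d f < ⊤

/-- Membership in `H² ∩ F(H²)`. -/
def MemH2FH2 (d : ℕ) (f : Rd d → ℂ) : Prop :=
  AEStronglyMeasurable f volume ∧ H2FH2N d f < ⊤

/-- `u` is a solution of the NLS `i∂ₜu + Δu + λ|u|^α u = 0`, `u(0) = u₀`, on the time
set `I`, in the Duhamel (integral equation) sense. -/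
def IsSolution (d : ℕ) (lam α : ℝ) (u₀ : Rd d → ℂ) (u : ℝ → Rd d → ℂ) (I : Set ℝ) : Prop :=
  u 0 = u₀ ∧ ∀ t ∈ I, ∀ x, u t x =
    sgroup d t u₀ x + Complex.I * (lam : ℂ) *
      ∫ τ in (0:ℝ)..t, sgroup d (t - τ) (fun y => ((‖u τ y‖ ^ α : ℝ) : ℂ) * u τ y) x

/-- `v` is a solution (Duhamel sense) of the nonautonomous equation
`i∂ₛv + Δv + λ(1-s)^{(αd-4)/2}|v|^α v = 0`, `v(s₀) = ψ`, on the time set `I`. -/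
def IsNonautoSolution (d : ℕ) (lam α : ℝ) (s₀ : ℝ) (ψ : Rd d → ℂ) (v : ℝ → Rd d → ℂ)
    (I : Set ℝ) : Prop :=
  v s₀ = ψ ∧ ∀ s ∈ I, ∀ y, v s y =
    sgroup d (s - s₀) ψ y + Complex.I * (lam : ℂ) *
      ∫ τ in s₀..s, sgroup d (s - τ)
        (fun z => (((1 - τ) ^ ((α * d - 4) / 2) * ‖v τ z‖ ^ α : ℝ) : ℂ) * v τ z) y

/-- Continuity with values in `Σ` on the time set `I`. -/
def SigmaContOn (d : ℕ) (u : ℝ → Rd d → ℂ) (I : Set ℝ) : Prop :=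
  ∀ t ∈ I, Tendsto (fun s => SigmaN d (fun x => u s x - u t x)) (nhdsWithin t I) (nhds 0)

/-- `e^{-itΔ}u(t)` converges strongly in `Σ` as `t → +∞`. -/
def ScattersAtPlus (d : ℕ) (u : ℝ → Rd d → ℂ) : Prop :=
  ∃ uplus : Rd d → ℂ, MemSigma d uplus ∧
    Tendsto (fun t => SigmaN d (fun x => sgroup d (-t) (u t) x - uplus x)) atTop (nhds 0)

/-- `e^{-itΔ}u(t)` converges strongly in `Σ` as `t → -∞`. -/
def ScattersAtMinus (d : ℕ) (u : ℝ → Rd d → ℂ) : Prop :=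
  ∃ uminus : Rd d → ℂ, MemSigma d uminus ∧
    Tendsto (fun t => SigmaN d (fun x => sgroup d (-t) (u t) x - uminus x)) atBot (nhds 0)

/-- `e^{-itΔ}u(t)` converges strongly in `L²` as `t → +∞`. -/
def ScattersL2AtPlus (d : ℕ) (u : ℝ → Rd d → ℂ) : Prop :=
  ∃ uplus : Rd d → ℂ,
    Tendsto (fun t => LpN d 2 (fun x => sgroup d (-t) (u t) x - uplus x)) atTop (nhds 0)

/-- `e^{-itΔ}u(t)` converges strongly in `L²` as `t → -∞`. -/
def ScattersL2AtMinus (d : ℕ) (u : ℝ → Rd d → ℂ) : Prop :=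
  ∃ uminus : Rd d → ℂ,
    Tendsto (fun t => LpN d 2 (fun x => sgroup d (-t) (u t) x - uminus x)) atBot (nhds 0)

/-- Weak `L^a` (Lorentz `L^{a,∞}`) quasinorm in time of a time-dependent quantity `g`
on the time set `I`. -/
def weakLNorm (a : ℝ) (I : Set ℝ) (g : ℝ → ℝ≥0∞) : ℝ≥0∞ :=
  ⨆ c : NNReal, (c : ℝ≥0∞) * (volume {t ∈ I | (c : ℝ≥0∞) ≤ g t}) ^ (1 / a)

/-- Lorentz `L^{q,2}` quasinorm in time of a time-dependent quantity `g` on the time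
set `I`: `q^{1/2} ‖ c · μ{g ≥ c}^{1/q} ‖_{L²((0,∞),dc/c)}`. -/
def lorentz2Norm (q : ℝ) (I : Set ℝ) (g : ℝ → ℝ≥0∞) : ℝ≥0∞ :=
  ENNReal.ofReal q ^ ((1:ℝ)/2) *
    (∫⁻ c in Ioi (0:ℝ),
      (ENNReal.ofReal c * volume {t ∈ I | ENNReal.ofReal c ≤ g t} ^ (1/q)) ^ (2:ℝ)
        / ENNReal.ofReal c) ^ ((1:ℝ)/2)

/-- The Galilean operator `P_t = x + 2it∇` (componentwise). -/
def Pop (d : ℕ) (t : ℝ) (f : Rd d → ℂ) : Rd d → Fin d → ℂ :=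
  fun x j => ((x j : ℝ) : ℂ) * f x +
    2 * Complex.I * (t : ℂ) * fderiv ℝ f x (EuclideanSpace.single j 1)

/-- `L^p` norm of `P_t f = (x + 2it∇)f`. -/
def PopLpN (d : ℕ) (p t : ℝ) (f : Rd d → ℂ) : ℝ≥0∞ :=
  eLpNorm (fun x => Real.sqrt (∑ j, ‖Pop d t f x j‖ ^ 2)) (ENNReal.ofReal p) volume

/-- The Laplacian, defined through iterated directional derivatives. -/
def lapl (d : ℕ) (f : Rd d → ℂ) : Rd d → ℂ :=
  fun x => ∑ j, fderiv ℝ (fun y => fderiv ℝ f y (EuclideanSpace.single j 1)) x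
    (EuclideanSpace.single j 1)

/-- `Q` is a ground state of `-ΔQ + Q = |Q|^α Q`: a nontrivial positive solution in `Σ`. -/
def IsGroundState (d : ℕ) (α : ℝ) (Q : Rd d → ℂ) : Prop :=
  MemSigma d Q ∧ Q ≠ 0 ∧ (∀ x, 0 ≤ (Q x).re ∧ (Q x).im = 0) ∧
    ∀ x, -lapl d Q x + Q x = ((‖Q x‖ ^ α : ℝ) : ℂ) * Q x

/-- Mass `M[f] = ∫ |f|²`. -/
def massI (d : ℕ) (f : Rd d → ℂ) : ℝ := ∫ x : Rd d, ‖f x‖ ^ 2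

/-- Energy `E[f] = ½∫|∇f|² - λ/(α+2) ∫ |f|^{α+2}`. -/
def energyI (d : ℕ) (lam α : ℝ) (f : Rd d → ℂ) : ℝ :=
  (1/2) * (∫ x : Rd d, ‖fderiv ℝ f x‖ ^ 2) - lam / (α + 2) * ∫ x : Rd d, ‖f x‖ ^ (α + 2)

/-- The `L²` norm, as a real number. -/
def l2norm (d : ℕ) (f : Rd d → ℂ) : ℝ := (∫ x : Rd d, ‖f x‖ ^ 2) ^ ((1:ℝ)/2)

/-- The `L²` norm of the gradient, as a real number. -/
def gradL2norm (d : ℕ) (f : Rd d → ℂ) : ℝ := (∫ x : Rd d, ‖fderiv ℝ f x‖ ^ 2) ^ ((1:ℝ)/2)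

/-- A pair `(q,r)` is admissible: `2/q = d(1/2 - 1/r)`, `2 ≤ r` (with `r ≤ 2d/(d-2)`
when `d ≥ 3`). -/
def IsAdmissible (d : ℕ) (q r : ℝ) : Prop :=
  2 / q = d * (1/2 - 1/r) ∧ 2 ≤ q ∧ 2 ≤ r ∧ (3 ≤ d → r ≤ 2 * d / (d - 2))

/-- `α_d = (-d + √(d²+16d))/(2d)`, the positive root of `dx² + dx - 4`. -/
def alphaRoot (d : ℕ) : ℝ := (-(d:ℝ) + Real.sqrt ((d:ℝ)^2 + 16*d)) / (2*d)

/-- `α(d) = (2 - d + √(d²+12d+4))/(2d)`, the positive root of `dx² + (d-2)x - 4`. -/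
def alphaStar (d : ℕ) : ℝ := (2 - (d:ℝ) + Real.sqrt ((d:ℝ)^2 + 12*d + 4)) / (2*d)

/-- A bound parametrized by the exponent `θ` of Lemma 4.1: `θ = (d+2)/4 - 1/α` if `d ≥ 3`,
`θ` any positive number less than `1 - 1/α` if `d = 2`, and `θ = 1 - 2/α` if `d = 1`. -/
def thetaBound (d : ℕ) (α : ℝ) (P : ℝ → Prop) : Prop :=
  (3 ≤ d → P (((d:ℝ)+2)/4 - 1/α)) ∧
  (d = 2 → ∀ θ : ℝ, 0 < θ → θ < 1 - 1/α → P θ) ∧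
  (d = 1 → P (1 - 2/α))

/-- The set `R₊` of initial data in `Σ` whose solution is positively global and has a
scattering state at `+∞` in `Σ`. -/
def Rplus (d : ℕ) (lam α : ℝ) : Set (Rd d → ℂ) :=
  {φ | MemSigma d φ ∧ ∃ u, IsSolution d lam α φ u (Ici 0) ∧ SigmaContOn d u (Ici 0) ∧
    ScattersAtPlus d u}

/-- The set `R₋` of initial data in `Σ` whose solution is negatively global and has a
scattering state at `-∞` in `Σ`. -/
def Rminus (d : ℕ) (lam α : ℝ) : Set (Rd d → ℂ) :=
  {φ | MemSigma d φ ∧ ∃ u, IsSolution d lam α φ u (Iic 0) ∧ SigmaContOn d u (Iic 0) ∧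
    ScattersAtMinus d u}

/-- Rapid decay at `+∞` (at the critical power `α = α(d)`): finite weak-`L^a` norm in
time of `‖u(t)‖_{L^{α+2}}` on `(0,∞)`, where `a = 2α(α+2)/(4-α(d-2))`. -/
def RapidDecayPlus (d : ℕ) (α : ℝ) (u : ℝ → Rd d → ℂ) : Prop :=
  weakLNorm (2*α*(α+2)/(4 - α*((d:ℝ)-2))) (Ioi 0) (fun t => LpN d (α+2) (u t)) < ⊤

/-- Rapid decay at `-∞`. -/
def RapidDecayMinus (d : ℕ) (α : ℝ) (u : ℝ → Rd d → ℂ) : Prop :=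
  weakLNorm (2*α*(α+2)/(4 - α*((d:ℝ)-2))) (Iio 0) (fun t => LpN d (α+2) (u t)) < ⊤

end

noncomputable section
open MeasureTheory Real Filter Topology Set
open scoped ENNReal NNReal

namespace NLS

/-- tangent line inequality for powers -/
lemma rpow_tangent {p a b : ℝ} (hp : 1 ≤ p) (ha : 0 ≤ a) (hb : 0 ≤ b) :
    a ^ p + p * a ^ (p - 1) * (b - a) ≤ b ^ p := by
  rcases eq_or_lt_of_le ha with h0 | h0
  · subst h0
    have h1 : (0:ℝ) ^ p = 0 := Real.zero_rpow (by linarith)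
    rw [h1]
    rcases eq_or_lt_of_le hp with h2 | h2
    · subst h2; simp
    · rw [Real.zero_rpow (by linarith)]; simp; positivity
  · have hs : -1 ≤ b / a - 1 := by
      have : 0 ≤ b / a := by positivity
      linarith
    have := one_add_mul_self_le_rpow_one_add hs hp
    have h2 : (1 + (b / a - 1)) = b / a := by ring
    rw [h2, Real.div_rpow hb ha] at this
    have h3 : a ^ (p - 1) = a ^ p / a := Real.rpow_sub_one h0.ne' p
    have h4 : 0 < a ^ p := Real.rpow_pos_of_pos h0 p
    rw [le_div_iff₀ h4] at this
    rw [h3]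
    calc a ^ p + p * (a ^ p / a) * (b - a) = (1 + p * (b / a - 1)) * a ^ p := by
          field_simp
      _ ≤ b ^ p := this

/-- truncated nonlinearity -/
def Fm (α m : ℝ) (z : ℂ) : ℂ := (((min ‖z‖ m) ^ α : ℝ) : ℂ) * z

/-- nonlinearity -/
def Fn (α : ℝ) (z : ℂ) : ℂ := ((‖z‖ ^ α : ℝ) : ℂ) * z

lemma Fm_eq {α m : ℝ} {z : ℂ} (h : ‖z‖ ≤ m) : Fm α m z = Fn α z := by
  simp [Fm, Fn, min_eq_left h]

lemma norm_Fn {α : ℝ} (hα : 0 ≤ α) (z : ℂ) : ‖Fn α z‖ = ‖z‖ ^ (α + 1) := by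
  rw [Fn, norm_mul, Complex.norm_real, Real.norm_eq_abs, abs_of_nonneg (by positivity)]
  rcases eq_or_ne ‖z‖ 0 with h | h
  · rw [h, Real.zero_rpow (by linarith : α + 1 ≠ 0)]; simp
  · rw [Real.rpow_add_one h]

lemma norm_Fm_le {α m : ℝ} (hα : 0 ≤ α) (hm : 0 ≤ m) (z : ℂ) : ‖Fm α m z‖ ≤ m ^ α * ‖z‖ := by
  rw [Fm, norm_mul, Complex.norm_real, Real.norm_eq_abs, abs_of_nonneg (by positivity)]
  gcongr
  exact min_le_right _ _

lemma Fm_lip_aux {α m : ℝ} (hα : 1 ≤ α) (hm : 0 ≤ m) (z w : ℂ) (hwz : ‖w‖ ≤ ‖z‖) :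
    ‖Fm α m z - Fm α m w‖ ≤ (α + 1) * m ^ α * ‖z - w‖ := by
  have h1 : Fm α m z - Fm α m w = (((min ‖z‖ m) ^ α : ℝ) : ℂ) * (z - w)
      + ((((min ‖z‖ m) ^ α - (min ‖w‖ m) ^ α : ℝ)) : ℂ) * w := by
    simp only [Fm]; push_cast; ring
  have hA : 0 ≤ (min ‖z‖ m) ^ α := by positivity
  have hA2 : (min ‖z‖ m) ^ α ≤ m ^ α := by gcongr; exact min_le_right _ _
  have hmono : (min ‖w‖ m) ^ α ≤ (min ‖z‖ m) ^ α := by gcongr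
  have h2 : ((min ‖z‖ m) ^ α - (min ‖w‖ m) ^ α) * ‖w‖ ≤ α * m ^ α * ‖z - w‖ := by
    rcases le_total m ‖w‖ with h | h
    · rw [min_eq_right h, min_eq_right (h.trans hwz)]; simp; positivity
    · rw [min_eq_left h]
      set a := min ‖z‖ m with ha
      have ha0 : 0 ≤ a := by positivity
      have hba : ‖w‖ ≤ a := le_min hwz h
      have ht := rpow_tangent hα ha0 (norm_nonneg w)
      have h3 : a ^ α - ‖w‖ ^ α ≤ α * a ^ (α - 1) * (a - ‖w‖) := by linarith
      have h4 : a ^ (α - 1) * a ≤ m ^ α := by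
        rcases eq_or_lt_of_le ha0 with h0 | h0
        · rw [← h0]; simp; positivity
        · rw [← Real.rpow_add_one h0.ne']; simpa using hA2
      have h5 : a - ‖w‖ ≤ ‖z - w‖ := by
        have : a ≤ ‖z‖ := min_le_left _ _
        have := norm_sub_norm_le z w
        linarith
      have h6 : 0 ≤ a ^ (α - 1) := by positivity
      calc (a ^ α - ‖w‖ ^ α) * ‖w‖ ≤ (α * a ^ (α - 1) * (a - ‖w‖)) * a := by
            apply mul_le_mul h3 hba (norm_nonneg _)
            have : 0 ≤ a - ‖w‖ := by linarith
            positivity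
        _ = α * (a ^ (α - 1) * a) * (a - ‖w‖) := by ring
        _ ≤ α * m ^ α * ‖z - w‖ := by
            apply mul_le_mul _ h5 (by linarith) (by positivity)
            gcongr
  rw [h1]
  refine (norm_add_le _ _).trans ?_
  rw [norm_mul, norm_mul, Complex.norm_real, Complex.norm_real, Real.norm_eq_abs,
    Real.norm_eq_abs, abs_of_nonneg hA, abs_of_nonneg (by linarith)]
  have : (min ‖z‖ m) ^ α * ‖z - w‖ ≤ m ^ α * ‖z - w‖ := by gcongr
  linarith

lemma Fm_lip {α m : ℝ} (hα : 1 ≤ α) (hm : 0 ≤ m) (z w : ℂ) :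
    ‖Fm α m z - Fm α m w‖ ≤ (α + 1) * m ^ α * ‖z - w‖ := by
  rcases le_total ‖w‖ ‖z‖ with h | h
  · exact Fm_lip_aux hα hm z w h
  · rw [norm_sub_rev, norm_sub_rev z]; exact Fm_lip_aux hα hm w z h

lemma Fm_lipschitz {α m : ℝ} (hα : 1 ≤ α) (hm : 0 ≤ m) :
    LipschitzWith (Real.toNNReal ((α + 1) * m ^ α)) (Fm α m) := by
  apply LipschitzWith.of_dist_le_mul
  intro z w
  rw [dist_eq_norm, dist_eq_norm, Real.coe_toNNReal _ (by positivity)]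
  exact Fm_lip hα hm z w

lemma Fm_zero (α m : ℝ) : Fm α m 0 = 0 := by simp [Fm]

lemma Fm_unit {α m : ℝ} {e : ℂ} (he : ‖e‖ = 1) (z : ℂ) : Fm α m (e * z) = e * Fm α m z := by
  simp only [Fm, norm_mul, he, one_mul]; ring

lemma continuous_Fn {α : ℝ} (hα : 0 ≤ α) : Continuous (Fn α) := by
  unfold Fn
  have : Continuous fun z : ℂ => ‖z‖ ^ α := continuous_norm.rpow_const (fun _ => Or.inr hα)
  exact (Complex.continuous_ofReal.comp this).mul continuous_id

lemma Fn_lip {α m : ℝ} (hα : 1 ≤ α) {z w : ℂ} (hz : ‖z‖ ≤ m) (hw : ‖w‖ ≤ m) :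
    ‖Fn α z - Fn α w‖ ≤ (α + 1) * m ^ α * ‖z - w‖ := by
  rw [← Fm_eq hz, ← Fm_eq hw]
  exact Fm_lip hα ((norm_nonneg _).trans hz) z w

lemma conv_ineq {α : ℝ} (hα : 0 ≤ α) (z w : ℂ) :
    ‖z‖ ^ (α + 2) + (α + 2) * (star (Fn α z) * (w - z)).re ≤ ‖w‖ ^ (α + 2) := by
  have h1 := rpow_tangent (p := α + 2) (by linarith) (norm_nonneg z) (norm_nonneg w)
  refine le_trans ?_ h1
  have h2 : ‖z‖ ^ (α + 2 - 1) = ‖z‖ ^ α * ‖z‖ := by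
    rcases eq_or_ne ‖z‖ 0 with h | h
    · rw [h, Real.zero_rpow (by linarith)]; simp
    · rw [← Real.rpow_add_one h]; ring_nf
  rw [h2]
  have h3 : (star (Fn α z) * (w - z)).re = ‖z‖ ^ α * ((star z * w).re - ‖z‖ ^ 2) := by
    have : star (Fn α z) * (w - z) = ((‖z‖ ^ α : ℝ) : ℂ) * (star z * w - star z * z) := by
      simp only [Fn, star_mul, RCLike.star_def, Complex.conj_ofReal]; ring
    rw [this, Complex.re_ofReal_mul, Complex.sub_re]
    have h : star z * z = ((‖z‖ ^ 2 : ℝ) : ℂ) := by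
      rw [RCLike.star_def, mul_comm, Complex.mul_conj, Complex.normSq_eq_norm_sq]
    rw [h, Complex.ofReal_re]
  rw [h3]
  have h4 : (star z * w).re ≤ ‖z‖ * ‖w‖ := by
    refine (Complex.re_le_norm _).trans ?_
    rw [norm_mul, norm_star]
  have h5 : 0 ≤ ‖z‖ ^ α := by positivity
  have h6 : (α + 2) * (‖z‖ ^ α * ((star z * w).re - ‖z‖ ^ 2))
      ≤ (α + 2) * (‖z‖ ^ α * (‖z‖ * ‖w‖ - ‖z‖ ^ 2)) := by gcongr
  nlinarith [h6]

end NLS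
end

noncomputable section
open MeasureTheory Real Filter Topology Set
open scoped ENNReal NNReal FourierTransform SchwartzMap ContDiff
set_option linter.unusedVariables false

namespace NLS

/-- the Hilbert space -/
abbrev HH := Lp ℂ 2 (volume : Measure ℝ)

lemma fourier_flip {f g : ℝ → ℂ} (hf : Integrable f) (hg : Integrable g) :
    ∫ ξ, 𝓕 f ξ * g ξ = ∫ x, f x * 𝓕 g x := by
  have := VectorFourier.integral_fourierIntegral_smul_eq_flip (L := innerₗ ℝ)
    (μ := volume) (ν := volume) Real.continuous_fourierChar continuous_inner hf hg
  simpa [smul_eq_mul, flip_innerₗ] using! this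

lemma cont_fourier {f : ℝ → ℂ} (hf : Integrable f) : Continuous (𝓕 f) :=
  VectorFourier.fourierIntegral_continuous Real.continuous_fourierChar
    (L := innerₗ ℝ) continuous_inner hf

lemma fourier_ae {f : ℝ → ℂ} (h1 : Integrable f) (h2 : MemLp f 2) :
    (𝓕 (h2.toLp f) : HH) =ᵐ[volume] 𝓕 f := by
  have hc : Continuous (𝓕 f) := cont_fourier h1
  apply ae_eq_of_integral_contDiff_smul_eq (μ := volume)
  · exact (Lp.memLp (𝓕 (h2.toLp f) : HH)).locallyIntegrable (by norm_num)
  · exact hc.locallyIntegrable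
  intro g hg hg'
  set gs : 𝓢(ℝ, ℂ) := (hg'.comp_left (g := fun x : ℝ => (x : ℂ)) (by simp)).toSchwartzMap
    (Complex.ofRealCLM.contDiff.comp hg) with hgs
  have hgsx : ∀ x, gs x = (g x : ℂ) := fun x => rfl
  have h := congrArg (fun T => T gs) (Lp.fourier_toTemperedDistribution_eq (h2.toLp f : HH))
  simp only [TemperedDistribution.fourier_apply, Lp.toTemperedDistribution_apply] at h
  have e1 : ∫ x, g x • (𝓕 (h2.toLp f) : HH) x = ∫ x, gs x • (𝓕 (h2.toLp f) : HH) x := by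
    congr 1
  rw [e1, ← h]
  have e2 : ∫ x, (𝓕 gs) x • (h2.toLp f : HH) x = ∫ x, 𝓕 (gs : ℝ → ℂ) x * f x := by
    apply integral_congr_ae
    filter_upwards [h2.coeFn_toLp] with x hx
    rw [hx, SchwartzMap.fourier_coe]; rfl
  rw [e2, fourier_flip gs.integrable h1]
  rfl

lemma fourier_toLp {f : ℝ → ℂ} (h1 : Integrable f) (h2 : MemLp f 2) :
    MemLp (𝓕 f) 2 ∧ ∀ h : MemLp (𝓕 f) 2, h.toLp (𝓕 f) = (𝓕 (h2.toLp f) : HH) := by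
  have hm : MemLp (𝓕 f) 2 := (memLp_congr_ae (fourier_ae h1 h2)).1 (Lp.memLp _)
  refine ⟨hm, fun h => ?_⟩
  apply Lp.ext
  exact h.coeFn_toLp.trans (fourier_ae h1 h2).symm

lemma fourierInv_ae {f : ℝ → ℂ} (h1 : Integrable f) (h2 : MemLp f 2) :
    (𝓕⁻ (h2.toLp f) : HH) =ᵐ[volume] 𝓕⁻ f := by
  have hc : Continuous (𝓕⁻ f) := by
    have : 𝓕⁻ f = fun x => 𝓕 f (-x) := by ext x; exact Real.fourierInv_eq_fourier_neg f x
    rw [this]; exact (cont_fourier h1).comp continuous_neg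
  apply ae_eq_of_integral_contDiff_smul_eq (μ := volume)
  · exact (Lp.memLp (𝓕⁻ (h2.toLp f) : HH)).locallyIntegrable (by norm_num)
  · exact hc.locallyIntegrable
  intro g hg hg'
  set gs : 𝓢(ℝ, ℂ) := (hg'.comp_left (g := fun x : ℝ => (x : ℂ)) (by simp)).toSchwartzMap
    (Complex.ofRealCLM.contDiff.comp hg) with hgs
  have hgsx : ∀ x, gs x = (g x : ℂ) := fun x => rfl
  have h := congrArg (fun T => T gs) (Lp.fourierInv_toTemperedDistribution_eq (h2.toLp f : HH))
  simp only [TemperedDistribution.fourierInv_apply, Lp.toTemperedDistribution_apply] at h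
  have e1 : ∫ x, g x • (𝓕⁻ (h2.toLp f) : HH) x = ∫ x, gs x • (𝓕⁻ (h2.toLp f) : HH) x := by
    congr 1
  rw [e1, ← h]
  have e2 : ∫ x, (𝓕⁻ gs) x • (h2.toLp f : HH) x = ∫ x, 𝓕⁻ (gs : ℝ → ℂ) x * f x := by
    apply integral_congr_ae
    filter_upwards [h2.coeFn_toLp] with x hx
    rw [hx, SchwartzMap.fourierInv_coe]; rfl
  rw [e2]
  have e3 : ∫ x, 𝓕⁻ (gs : ℝ → ℂ) x * f x = ∫ x, 𝓕 (gs : ℝ → ℂ) x * f (-x) := by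
    rw [← integral_neg_eq_self]
    congr 1; ext x
    rw [Real.fourierInv_eq_fourier_neg, neg_neg]
  rw [e3, fourier_flip gs.integrable h1.comp_neg]
  congr 1; ext x
  rw [Real.fourierInv_eq_fourier_comp_neg, hgsx]; rfl

/-- build an isometry from pointwise data -/
def mkIso (T : (ℝ → ℂ) → ℝ → ℂ)
    (hm : ∀ f : ℝ → ℂ, MemLp f 2 → MemLp (T f) 2)
    (hn : ∀ f : ℝ → ℂ, MemLp f 2 → eLpNorm (T f) 2 volume = eLpNorm f 2 volume)
    (hc : ∀ f g : ℝ → ℂ, f =ᵐ[volume] g → T f =ᵐ[volume] T g)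
    (ha : ∀ f g : ℝ → ℂ, T (f + g) = T f + T g)
    (hs : ∀ (c : ℂ) (f : ℝ → ℂ), T (c • f) = c • T f) : HH →ₗᵢ[ℂ] HH where
  toFun f := (hm f (Lp.memLp f)).toLp _
  map_add' f g := by
    apply Lp.ext
    refine (MemLp.coeFn_toLp _).trans ?_
    refine EventuallyEq.trans ?_ (Lp.coeFn_add _ _).symm
    refine (hc _ _ (Lp.coeFn_add f g)).trans ?_
    rw [ha]
    exact (MemLp.coeFn_toLp _).symm.add (MemLp.coeFn_toLp _).symm
  map_smul' c f := by
    apply Lp.ext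
    refine (MemLp.coeFn_toLp _).trans ?_
    refine EventuallyEq.trans ?_ (Lp.coeFn_smul _ _).symm
    refine (hc _ _ (Lp.coeFn_smul c f)).trans ?_
    rw [hs]
    exact (MemLp.coeFn_toLp _).symm.const_smul c
  norm_map' f := by
    show ‖(hm f (Lp.memLp f)).toLp _‖ = _
    rw [Lp.norm_toLp, hn f (Lp.memLp f), Lp.norm_def]

lemma mkIso_ae (T : (ℝ → ℂ) → ℝ → ℂ) (hm hn hc ha hs) (f : HH) :
    mkIso T hm hn hc ha hs f =ᵐ[volume] T f :=
  MemLp.coeFn_toLp (hm f (Lp.memLp f))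

/-- quadratic phase -/
def phf (a b c x : ℝ) : ℂ := Complex.exp (Complex.I * ((a * x ^ 2 + b * x + c : ℝ) : ℂ))

lemma norm_phf (a b c x : ℝ) : ‖phf a b c x‖ = 1 := by
  rw [phf, mul_comm]; exact Complex.norm_exp_ofReal_mul_I _

lemma cont_phf (a b c : ℝ) : Continuous (phf a b c) := by
  unfold phf; fun_prop

lemma phf_mul (a b c a' b' c' x : ℝ) :
    phf a b c x * phf a' b' c' x = phf (a + a') (b + b') (c + c') x := by
  simp only [phf, ← Complex.exp_add]; congr 1; push_cast; ring

lemma memLp_phf (a b c : ℝ) {p : ℝ≥0∞} {f : ℝ → ℂ} (hf : MemLp f p) :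
    MemLp (fun x => phf a b c x * f x) p :=
  hf.of_le ((cont_phf a b c).aestronglyMeasurable.mul hf.1)
    (Eventually.of_forall fun x => by rw [norm_mul, norm_phf, one_mul])

lemma integrable_phf (a b c : ℝ) {f : ℝ → ℂ} (hf : Integrable f) :
    Integrable (fun x => phf a b c x * f x) :=
  memLp_one_iff_integrable.1 (memLp_phf a b c (memLp_one_iff_integrable.2 hf))

/-- multiplication by a quadratic phase -/
def ph (a b c : ℝ) : HH →ₗᵢ[ℂ] HH :=
  mkIso (fun f x => phf a b c x * f x) (fun _ hf => memLp_phf a b c hf)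
    (fun f _ => eLpNorm_congr_norm_ae (Eventually.of_forall fun x => by
      rw [norm_mul, norm_phf, one_mul]))
    (fun f g h => by filter_upwards [h] with x hx; rw [hx])
    (fun f g => by ext x; simp [mul_add]) (fun c f => by ext x; simp; ring)

lemma ph_ae (a b c : ℝ) (f : HH) : ph a b c f =ᵐ[volume] fun x => phf a b c x * f x :=
  mkIso_ae _ _ _ _ _ _ f

lemma ae_shift {P : ℝ → Prop} (h : ℝ) (hP : ∀ᵐ x, P x) : ∀ᵐ x, P (x + h) :=
  (measurePreserving_add_right volume h).quasiMeasurePreserving.ae hP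

/-- translation -/
def tr (h : ℝ) : HH →ₗᵢ[ℂ] HH :=
  mkIso (fun f x => f (x + h))
    (fun _ hf => hf.comp_measurePreserving (measurePreserving_add_right volume h))
    (fun f hf => eLpNorm_comp_measurePreserving hf.1 (measurePreserving_add_right volume h))
    (fun f g hfg => ae_shift h hfg)
    (fun f g => rfl) (fun c f => rfl)

lemma tr_ae (h : ℝ) (f : HH) : tr h f =ᵐ[volume] fun x => f (x + h) :=
  mkIso_ae _ _ _ _ _ _ f

lemma ae_scale {P : ℝ → Prop} {c : ℝ} (hc : c ≠ 0) (hP : ∀ᵐ x, P x) : ∀ᵐ x, P (c * x) := by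
  have : Measure.QuasiMeasurePreserving (fun x : ℝ => c * x) volume volume := by
    refine ⟨measurable_const_mul c, ?_⟩
    rw [Real.map_volume_mul_left hc]
    exact Measure.smul_absolutelyContinuous
  exact this.ae hP

lemma eLpNorm_scale {c : ℝ} (hc : 0 < c) (f : ℝ → ℂ) (hf : AEStronglyMeasurable f volume) :
    eLpNorm (fun x => ((√c : ℝ) : ℂ) * f (c * x)) 2 volume = eLpNorm f 2 volume := by
  have h1 : (fun x => ((√c : ℝ) : ℂ) * f (c * x)) = ((√c : ℝ) : ℂ) • (fun x => f (c * x)) := by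
    ext x; simp
  rw [h1, eLpNorm_const_smul]
  have h2 : (fun x => f (c * x)) = f ∘ (fun x => c * x) := rfl
  have h3 : AEStronglyMeasurable f (Measure.map (fun x => c * x) volume) := by
    rw [Real.map_volume_mul_left hc.ne']; exact hf.smul_measure _
  rw [h2, ← eLpNorm_map_measure h3 (measurable_const_mul c).aemeasurable,
    Real.map_volume_mul_left hc.ne', eLpNorm_smul_measure_of_ne_top (by norm_num),
    smul_eq_mul, ← mul_assoc]
  have : ‖((√c : ℝ) : ℂ)‖ₑ * ENNReal.ofReal |c⁻¹| ^ (1 / (2:ℝ≥0∞)).toReal = 1 := by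
    rw [← ofReal_norm, Complex.norm_real, Real.norm_eq_abs, abs_of_nonneg (by positivity),
      abs_of_pos (by positivity), ENNReal.ofReal_rpow_of_pos (by positivity),
      ← ENNReal.ofReal_mul (by positivity), Real.sqrt_eq_rpow]
    have h5 : (1 / (2:ℝ≥0∞)).toReal = 1 / 2 := by simp
    rw [h5, ← Real.mul_rpow hc.le (by positivity), mul_inv_cancel₀ hc.ne']
    simp
  rw [this, one_mul]

/-- unitary dilation -/
def dl (c : ℝ) (hc : 0 < c) : HH →ₗᵢ[ℂ] HH :=
  mkIso (fun f x => ((√c : ℝ) : ℂ) * f (c * x))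
    (fun f hf => by
      refine ⟨?_, ?_⟩
      · have h3 : AEStronglyMeasurable f (Measure.map (fun x => c * x) volume) := by
          rw [Real.map_volume_mul_left hc.ne']; exact hf.1.smul_measure _
        exact (h3.comp_measurable (measurable_const_mul c)).const_mul _
      · rw [eLpNorm_scale hc f hf.1]; exact hf.2)
    (fun f hf => eLpNorm_scale hc f hf.1)
    (fun f g hfg => by filter_upwards [ae_scale hc.ne' hfg] with x hx; rw [hx])
    (fun f g => by ext x; simp [mul_add]) (fun c f => by ext x; simp; ring)

lemma dl_ae (c : ℝ) (hc : 0 < c) (f : HH) :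
    dl c hc f =ᵐ[volume] fun x => ((√c : ℝ) : ℂ) * f (c * x) :=
  mkIso_ae _ _ _ _ _ _ f

lemma ph_ph (a b c a' b' c' : ℝ) (f : HH) :
    ph a b c (ph a' b' c' f) = ph (a + a') (b + b') (c + c') f := by
  apply Lp.ext
  filter_upwards [ph_ae a b c (ph a' b' c' f), ph_ae a' b' c' f,
    ph_ae (a + a') (b + b') (c + c') f] with x h1 h2 h3
  rw [h1, h2, h3, ← mul_assoc, phf_mul]

lemma ph_zero (f : HH) : ph 0 0 0 f = f := by
  apply Lp.ext
  filter_upwards [ph_ae 0 0 0 f] with x h1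
  rw [h1]; simp [phf]

lemma tr_tr (h k : ℝ) (f : HH) : tr h (tr k f) = tr (h + k) f := by
  apply Lp.ext
  filter_upwards [tr_ae h (tr k f), ae_shift h (tr_ae k f), tr_ae (h + k) f] with x h1 h2 h3
  rw [h1, h2, h3, add_assoc]

lemma tr_ph (h a b c : ℝ) (f : HH) :
    tr h (ph a b c f) = ph a (b + 2 * a * h) (a * h ^ 2 + b * h + c) (tr h f) := by
  apply Lp.ext
  filter_upwards [tr_ae h (ph a b c f), ae_shift h (ph_ae a b c f),
    ph_ae a (b + 2 * a * h) (a * h ^ 2 + b * h + c) (tr h f), tr_ae h f] with x h1 h2 h3 h4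
  rw [h1, h2, h3, h4]
  congr 1
  simp only [phf]; congr 1; push_cast; ring

lemma tr_toLp (h : ℝ) {f : ℝ → ℂ} (hf : MemLp f 2) (hf' : MemLp (fun x => f (x + h)) 2) :
    tr h (hf.toLp f) = hf'.toLp _ := by
  apply Lp.ext
  filter_upwards [tr_ae h (hf.toLp f), ae_shift h hf.coeFn_toLp, hf'.coeFn_toLp] with x h1 h2 h3
  rw [h1, h2, h3]

lemma ph_toLp (a b c : ℝ) {f : ℝ → ℂ} (hf : MemLp f 2) :
    ph a b c (hf.toLp f) = (memLp_phf a b c hf).toLp _ := by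
  apply Lp.ext
  filter_upwards [ph_ae a b c (hf.toLp f), hf.coeFn_toLp, (memLp_phf a b c hf).coeFn_toLp]
    with x h1 h2 h3
  rw [h1, h2, h3]

/-- to prove an identity between continuous maps it suffices to check on integrable functions -/
lemma HH_ext {A B : HH → HH} (hA : Continuous A) (hB : Continuous B)
    (h : ∀ (f : ℝ → ℂ), Integrable f → ∀ hf : MemLp f 2, A (hf.toLp f) = B (hf.toLp f))
    (f : HH) : A f = B f := by
  apply DenseRange.induction_on (p := fun f => A f = B f)
    (SchwartzMap.denseRange_toLpCLM (p := 2) (μ := volume) ENNReal.ofNat_ne_top) f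
  · exact isClosed_eq hA hB
  · intro g
    exact h g g.integrable (g.memLp 2)

/-- the Fourier transform as isometric equivalence -/
abbrev FT : HH ≃ₗᵢ[ℂ] HH := Lp.fourierTransformₗᵢ ℝ ℂ

lemma FT_toLp {f : ℝ → ℂ} (h1 : Integrable f) (h2 : MemLp f 2) :
    FT (h2.toLp f) =ᵐ[volume] 𝓕 f := fourier_ae h1 h2

lemma FTs_toLp {f : ℝ → ℂ} (h1 : Integrable f) (h2 : MemLp f 2) :
    FT.symm (h2.toLp f) =ᵐ[volume] 𝓕⁻ f := fourierInv_ae h1 h2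

lemma fourier_formula (f : ℝ → ℂ) (k : ℝ) : 𝓕 f k = ∫ x, phf 0 (-(2 * π * k)) 0 x * f x := by
  rw [Real.fourier_eq']
  congr 1; ext x
  simp only [phf, smul_eq_mul]
  have : inner ℝ x k = x * k := by simp [mul_comm]
  rw [this]; congr 2; push_cast; ring

lemma fourierInv_formula (f : ℝ → ℂ) (k : ℝ) : 𝓕⁻ f k = ∫ x, phf 0 (2 * π * k) 0 x * f x := by
  rw [Real.fourierInv_eq']
  congr 1; ext x
  simp only [phf, smul_eq_mul]
  have : inner ℝ x k = x * k := by simp [mul_comm]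
  rw [this]; congr 2; push_cast; ring

lemma FT_tr (h : ℝ) (f : HH) : FT (tr h f) = ph 0 (2 * π * h) 0 (FT f) := by
  refine HH_ext (A := fun f => FT (tr h f)) (B := fun f => ph 0 (2 * π * h) 0 (FT f))
    (FT.continuous.comp (tr h).continuous) ((ph _ _ _).continuous.comp FT.continuous) ?_ f
  intro f h1 h2
  have h3 : MemLp (fun x => f (x + h)) 2 :=
    h2.comp_measurePreserving (measurePreserving_add_right volume h)
  rw [tr_toLp h h2 h3]
  apply Lp.ext
  filter_upwards [FT_toLp (h1.comp_add_right h) h3, ph_ae 0 (2 * π * h) 0 (FT (h2.toLp f)),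
    FT_toLp h1 h2] with k e1 e2 e3
  rw [e1, e2, e3, fourier_formula, fourier_formula, ← integral_const_mul,
    ← integral_add_right_eq_self (fun x => phf 0 (2 * π * h) 0 k * (phf 0 (-(2 * π * k)) 0 x * f x)) h]
  congr 1; ext x
  rw [← mul_assoc]
  congr 1
  simp only [phf, ← Complex.exp_add]; congr 1; push_cast; ring

lemma FT_ph (h : ℝ) (f : HH) : FT (ph 0 (2 * π * h) 0 f) = tr (-h) (FT f) := by
  refine HH_ext (A := fun f => FT (ph 0 (2 * π * h) 0 f)) (B := fun f => tr (-h) (FT f))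
    (FT.continuous.comp (ph _ _ _).continuous) ((tr _).continuous.comp FT.continuous) ?_ f
  intro f h1 h2
  rw [ph_toLp 0 (2 * π * h) 0 h2]
  apply Lp.ext
  filter_upwards [FT_toLp (integrable_phf 0 (2 * π * h) 0 h1) (memLp_phf 0 (2 * π * h) 0 h2),
    tr_ae (-h) (FT (h2.toLp f)), ae_shift (-h) (FT_toLp h1 h2)] with k e1 e2 e3
  rw [e1, e2, e3, fourier_formula, fourier_formula]
  congr 1; ext x
  rw [← mul_assoc]
  congr 1
  simp only [phf, ← Complex.exp_add]; congr 1; push_cast; ring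

/-- free Schroedinger group on the Hilbert space -/
def UU (t : ℝ) : HH →ₗᵢ[ℂ] HH :=
  FT.symm.toLinearIsometry.comp ((ph (-(4 * π ^ 2 * t)) 0 0).comp FT.toLinearIsometry)

lemma UU_apply (t : ℝ) (f : HH) : UU t f = FT.symm (ph (-(4 * π ^ 2 * t)) 0 0 (FT f)) := rfl

lemma UU_UU (s t : ℝ) (f : HH) : UU s (UU t f) = UU (s + t) f := by
  simp only [UU_apply, LinearIsometryEquiv.apply_symm_apply, ph_ph]
  congr 2 <;> ring_nf

lemma UU_zero (f : HH) : UU 0 f = f := by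
  rw [UU_apply]; simp [ph_zero]

lemma UU_neg (t : ℝ) (f : HH) : UU (-t) (UU t f) = f := by
  rw [UU_UU]; simp [UU_zero]

lemma UU_neg' (t : ℝ) (f : HH) : UU t (UU (-t) f) = f := by
  rw [UU_UU]; simp [UU_zero]

lemma FTs_ph (h : ℝ) (f : HH) : FT.symm (ph 0 (2 * π * h) 0 f) = tr h (FT.symm f) := by
  apply FT.injective
  rw [FT_tr]; simp

lemma FTs_tr (h : ℝ) (f : HH) : FT.symm (tr (-h) f) = ph 0 (2 * π * h) 0 (FT.symm f) := by
  apply FT.injective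
  rw [FT_ph]; simp

lemma UU_tr (t h : ℝ) (f : HH) : UU t (tr h f) = tr h (UU t f) := by
  rw [UU_apply, FT_tr, ph_ph, UU_apply, ← FTs_ph, ph_ph]
  congr 2 <;> ring

/-- Galilean boost -/
def gal (t h : ℝ) : HH →ₗᵢ[ℂ] HH := (ph 0 (2 * π * h) (-(4 * π ^ 2 * t * h ^ 2))).comp (tr (-(4 * π * t * h)))

lemma gal_apply (t h : ℝ) (f : HH) :
  gal t h f = ph 0 (2 * π * h) (-(4 * π ^ 2 * t * h ^ 2)) (tr (-(4 * π * t * h)) f) := rfl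

lemma ph_const_smul (c : ℝ) (f : HH) : ph 0 0 c f = Complex.exp (Complex.I * (c : ℂ)) • f := by
  apply Lp.ext
  filter_upwards [ph_ae 0 0 c f, Lp.coeFn_smul (Complex.exp (Complex.I * (c : ℂ))) f] with x h1 h2
  rw [h1, h2]; simp [phf]

lemma UU_ph (t h : ℝ) (f : HH) : UU t (ph 0 (2 * π * h) 0 f) = gal t h (UU t f) := by
  have e1 : ∀ g : HH, ph (-(4 * π ^ 2 * t)) 0 0 (tr (-h) g)
      = ph 0 0 (-(4 * π ^ 2 * t * h ^ 2)) (tr (-h) (ph 0 (2 * π * (-(4 * π * t * h))) 0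
        (ph (-(4 * π ^ 2 * t)) 0 0 g))) := by
    intro g
    rw [ph_ph, tr_ph, ph_ph]
    congr 1
    congr 1 <;> ring
  rw [UU_apply, FT_ph, e1, ph_const_smul, map_smul, FTs_tr, FTs_ph, gal_apply, UU_apply]
  rw [← ph_const_smul, ph_ph]
  congr 1
  congr 1 <;> ring

lemma UUneg_gal (t h : ℝ) (f : HH) : UU (-t) (gal t h f) = ph 0 (2 * π * h) 0 (UU (-t) f) := by
  have := UU_ph t h (UU (-t) f)
  rw [UU_neg'] at this
  rw [← this, UU_neg]

/-- nonlinearity on the Hilbert space -/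
def FH (α m : ℝ) (hα : 1 ≤ α) (hm : 0 ≤ m) (f : HH) : HH :=
  (Fm_lipschitz hα hm).compLp (Fm_zero α m) f

section
variable {α m : ℝ} (hα : 1 ≤ α) (hm : 0 ≤ m)

lemma FH_ae (f : HH) : FH α m hα hm f =ᵐ[volume] fun x => Fm α m (f x) :=
  LipschitzWith.coeFn_compLp _ _ _

lemma FH_lip (f g : HH) : ‖FH α m hα hm f - FH α m hα hm g‖ ≤ (α + 1) * m ^ α * ‖f - g‖ := by
  have := LipschitzWith.norm_compLp_sub_le (Fm_lipschitz hα hm) (Fm_zero α m) f g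
  rwa [Real.coe_toNNReal _ (by positivity)] at this

lemma FH_norm (f : HH) : ‖FH α m hα hm f‖ ≤ m ^ α * ‖f‖ := by
  have h0 : 0 ≤ m ^ α := by positivity
  apply Lp.norm_le_mul_norm_of_ae_le_mul
  filter_upwards [FH_ae hα hm f] with x hx
  rw [hx]; exact norm_Fm_le (by linarith) hm _

lemma FH_tr (h : ℝ) (f : HH) : FH α m hα hm (tr h f) = tr h (FH α m hα hm f) := by
  apply Lp.ext
  filter_upwards [FH_ae hα hm (tr h f), tr_ae h f, tr_ae h (FH α m hα hm f),
    ae_shift h (FH_ae hα hm f)] with x h1 h2 h3 h4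
  rw [h1, h2, h3, h4]

lemma FH_ph (a b c : ℝ) (f : HH) : FH α m hα hm (ph a b c f) = ph a b c (FH α m hα hm f) := by
  apply Lp.ext
  filter_upwards [FH_ae hα hm (ph a b c f), ph_ae a b c f, ph_ae a b c (FH α m hα hm f),
    FH_ae hα hm f] with x h1 h2 h3 h4
  rw [h1, h2, h3, h4, Fm_unit (norm_phf _ _ _ _)]

lemma FH_gal (t h : ℝ) (f : HH) : FH α m hα hm (gal t h f) = gal t h (FH α m hα hm f) := by
  rw [gal_apply, FH_ph, FH_tr, gal_apply]

lemma Sg_ph (t h : ℝ) (u : HH) :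
    ‖ph 0 (2 * π * h) 0 (UU (-t) (FH α m hα hm u)) - UU (-t) (FH α m hα hm u)‖
      ≤ (α + 1) * m ^ α * ‖ph 0 (2 * π * h) 0 (UU (-t) u) - UU (-t) u‖ := by
  rw [← UUneg_gal, ← UUneg_gal, ← map_sub, ← map_sub, LinearIsometry.norm_map,
    LinearIsometry.norm_map, ← FH_gal]
  exact FH_lip hα hm _ _

lemma Sg_tr (t h : ℝ) (u : HH) :
    ‖tr h (UU (-t) (FH α m hα hm u)) - UU (-t) (FH α m hα hm u)‖
      ≤ (α + 1) * m ^ α * ‖tr h (UU (-t) u) - UU (-t) u‖ := by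
  rw [← UU_tr, ← UU_tr, ← map_sub, ← map_sub, LinearIsometry.norm_map,
    LinearIsometry.norm_map, ← FH_tr]
  exact FH_lip hα hm _ _

end

end NLS
end

noncomputable section
open MeasureTheory Real Filter Topology Set
open scoped ENNReal NNReal FourierTransform SchwartzMap ContDiff
set_option linter.unusedVariables false

namespace NLS

lemma HH_integrable_sq (f : HH) : Integrable (fun x => ‖f x‖ ^ 2) :=
  (Lp.memLp f).integrable_norm_pow (by norm_num)

lemma HH_normsq (f : HH) : ‖f‖ ^ 2 = ∫ x, ‖f x‖ ^ 2 := by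
  have h := MeasureTheory.L2.inner_def (𝕜 := ℂ) f f
  rw [inner_self_eq_norm_sq_to_K] at h
  have h2 : (∫ a, inner ℂ (f a) (f a)) = ((∫ x, ‖f x‖ ^ 2 : ℝ) : ℂ) := by
    rw [← integral_complex_ofReal]
    congr 1; ext x; rw [inner_self_eq_norm_sq_to_K]; simp
  rw [h2] at h
  apply Complex.ofReal_injective
  rw [← h]; simp

lemma HH_tendsto_dom {ι : Type*} {l : Filter ι} [l.IsCountablyGenerated] {F : ι → HH} {F0 : HH}
    {f : ι → ℝ → ℂ} {f0 : ℝ → ℂ} (hF : ∀ n, F n =ᵐ[volume] f n) (hF0 : F0 =ᵐ[volume] f0)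
    {b : ℝ → ℝ} (hb : Integrable fun x => b x ^ 2)
    (hd : ∀ n, ∀ᵐ x, ‖f n x - f0 x‖ ≤ b x)
    (hlim : ∀ᵐ x, Tendsto (fun n => f n x) l (𝓝 (f0 x))) : Tendsto F l (𝓝 F0) := by
  rw [tendsto_iff_norm_sub_tendsto_zero]
  have key : Tendsto (fun n => ‖F n - F0‖ ^ 2) l (𝓝 0) := by
    have h1 : ∀ n, ‖F n - F0‖ ^ 2 = ∫ x, ‖f n x - f0 x‖ ^ 2 := by
      intro n
      rw [HH_normsq]
      apply integral_congr_ae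
      filter_upwards [Lp.coeFn_sub (F n) F0, hF n, hF0] with x h1 h2 h3
      rw [h1, Pi.sub_apply, h2, h3]
    simp_rw [h1]
    have h0 : (0:ℝ) = ∫ x : ℝ, (0:ℝ) := by simp
    rw [h0]
    apply tendsto_integral_filter_of_dominated_convergence (fun x => b x ^ 2)
    · refine Eventually.of_forall fun n => ?_
      have := (Lp.aestronglyMeasurable (F n)).congr (hF n)
      have h2 := (Lp.aestronglyMeasurable F0).congr hF0
      exact (this.sub h2).norm.pow 2
    · refine Eventually.of_forall fun n => ?_
      filter_upwards [hd n] with x hx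
      rw [Real.norm_eq_abs, abs_of_nonneg (by positivity)]
      gcongr
    · exact hb
    · filter_upwards [hlim] with x hx
      have := (tendsto_iff_norm_sub_tendsto_zero.1 hx).pow 2
      simpa using this
  have := (Real.continuous_sqrt.tendsto 0).comp key
  simpa [Function.comp_def, Real.sqrt_sq] using this

lemma HH_ae_unique {F : ℕ → HH} {F0 : HH} {f : ℕ → ℝ → ℂ} {f0 : ℝ → ℂ}
    (hF : ∀ n, F n =ᵐ[volume] f n) (hlim : Tendsto F atTop (𝓝 F0))
    (hp : ∀ᵐ x, Tendsto (fun n => f n x) atTop (𝓝 (f0 x))) : F0 =ᵐ[volume] f0 := by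
  have h1 := MeasureTheory.tendstoInMeasure_of_tendsto_Lp hlim
  obtain ⟨ns, hns, h2⟩ := h1.exists_seq_tendsto_ae
  filter_upwards [h2, hp, ae_all_iff.2 hF] with x hx1 hx2 hx3
  have h3 : Tendsto (fun i => f (ns i) x) atTop (𝓝 (f0 x)) := hx2.comp hns.tendsto_atTop
  simp_rw [hx3] at hx1
  exact tendsto_nhds_unique hx1 h3

lemma ph_continuous (f : HH) {θ : ℝ → ℝ} {t : ℝ} (hθ : ContinuousAt θ t) :
    Tendsto (fun s => ph (θ s) 0 0 f) (𝓝 t) (𝓝 (ph (θ t) 0 0 f)) := by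
  refine HH_tendsto_dom (fun s => ph_ae _ _ _ f) (ph_ae _ _ _ f) (b := fun x => 2 * ‖f x‖) ?_ ?_ ?_
  · have := (HH_integrable_sq f).const_mul 4
    refine this.congr (Eventually.of_forall fun x => ?_); simp only; ring
  · intro n
    refine Eventually.of_forall fun x => ?_
    refine (norm_sub_le _ _).trans ?_
    rw [norm_mul, norm_mul, norm_phf, norm_phf]; linarith
  · refine Eventually.of_forall fun x => ?_
    apply Tendsto.mul_const
    have : ContinuousAt (fun s => phf (θ s) 0 0 x) t := by
      unfold phf; fun_prop
    exact this

lemma UU_continuous (f : HH) : Continuous (fun t => UU t f) := by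
  rw [continuous_iff_continuousAt]
  intro t
  have := ph_continuous (FT f) (θ := fun t => -(4 * π ^ 2 * t)) (t := t) (by fun_prop)
  exact (FT.symm.continuous.tendsto _).comp this

/-- joint continuity -/
lemma UU_tendsto {ι : Type*} {l : Filter ι} {t : ι → ℝ} {t0 : ℝ} {f : ι → HH} {f0 : HH}
    (ht : Tendsto t l (𝓝 t0)) (hf : Tendsto f l (𝓝 f0)) :
    Tendsto (fun i => UU (t i) (f i)) l (𝓝 (UU t0 f0)) := by
  have h1 : Tendsto (fun i => UU (t i) f0) l (𝓝 (UU t0 f0)) :=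
    ((UU_continuous f0).tendsto t0).comp ht
  have h2 : Tendsto (fun i => UU (t i) (f i) - UU (t i) f0) l (𝓝 0) := by
    rw [tendsto_zero_iff_norm_tendsto_zero]
    have := tendsto_iff_norm_sub_tendsto_zero.1 hf
    refine this.congr fun i => ?_
    rw [← map_sub, LinearIsometry.norm_map]
  simpa using h2.add h1

/-- free propagator through its kernel -/
def sg (t : ℝ) (φ : ℝ → ℂ) (x : ℝ) : ℂ :=
  (((4 * π * t : ℝ) : ℂ) * Complex.I) ^ (-(1 : ℂ) / 2) * ∫ y, phf (1 / (4 * t)) 0 0 (x - y) * φ y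

lemma norm_cexp_le_one {z : ℂ} (h : z.re ≤ 0) : ‖Complex.exp z‖ ≤ 1 := by
  rw [Complex.norm_exp]; exact Real.exp_le_one_iff.2 h

/-- regularised kernel identity -/
lemma reg_kernel {φ : ℝ → ℂ} (h1 : Integrable φ) {z : ℂ} (hz : 0 < z.re) (x : ℝ) :
    𝓕⁻ (fun k : ℝ => Complex.exp (-z * (k:ℂ) ^ 2) * 𝓕 φ k) x
      = (π / z) ^ (1 / 2 : ℂ) * ∫ y, Complex.exp (-(π ^ 2 / z) * ((x - y : ℝ) : ℂ) ^ 2) * φ y := by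
  have hz' : (-z).re < 0 := by simpa using hz
  set g : ℝ → ℂ := fun k => Complex.exp (-z * (k:ℂ) ^ 2 + (2 * π * Complex.I * x) * k + 0) with hg
  have hgi : Integrable g := integrable_cexp_quadratic hz _ _
  have hgF : ∀ y, 𝓕 g y = (π / z) ^ (1 / 2 : ℂ) * Complex.exp (-(π ^ 2 / z) * ((x - y : ℝ) : ℂ) ^ 2) := by
    intro y
    rw [fourier_formula]
    have : ∀ k : ℝ, phf 0 (-(2 * π * y)) 0 k * g k
        = Complex.exp (-z * (k:ℂ) ^ 2 + (2 * π * Complex.I * ((x - y : ℝ) : ℂ)) * k + 0) := by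
      intro k
      simp only [phf, hg, ← Complex.exp_add]; congr 1; push_cast; ring
    simp_rw [this]
    rw [integral_cexp_quadratic hz', neg_neg]
    congr 2
    have hz0 : z ≠ 0 := by rintro rfl; simp at hz
    field_simp
    rw [Complex.I_sq]; ring
  rw [fourierInv_formula]
  have e1 : ∀ k : ℝ, phf 0 (2 * π * x) 0 k * (Complex.exp (-z * (k:ℂ) ^ 2) * 𝓕 φ k) = 𝓕 φ k * g k := by
    intro k
    simp only [phf, hg]
    rw [← mul_assoc, ← Complex.exp_add, mul_comm]; congr 2; push_cast; ring
  simp_rw [e1]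
  rw [fourier_flip h1 hgi, ← integral_const_mul]
  congr 1; ext y
  rw [hgF]; ring

lemma fourier_bdd (φ : ℝ → ℂ) (k : ℝ) : ‖𝓕 φ k‖ ≤ ∫ x, ‖φ x‖ := by
  rw [fourier_formula]
  refine (norm_integral_le_integral_norm _).trans (le_of_eq ?_)
  congr 1; ext x; rw [norm_mul, norm_phf, one_mul]

lemma sg_ae {t : ℝ} (ht : t ≠ 0) {φ : ℝ → ℂ} (h1 : Integrable φ) (h2 : MemLp φ 2) :
    UU t (h2.toLp φ) =ᵐ[volume] sg t φ := by
  set z0 : ℂ := ((4 * π ^ 2 * t : ℝ) : ℂ) * Complex.I with hz0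
  set ε : ℕ → ℝ := fun n => 1 / ((n:ℝ) + 1) with hε
  have hε0 : ∀ n, 0 < ε n := fun n => by positivity
  have hεl : Tendsto ε atTop (𝓝 0) := tendsto_one_div_add_atTop_nhds_zero_nat
  set z : ℕ → ℂ := fun n => (ε n : ℂ) + z0 with hzdef
  have hzre : ∀ n, (z n).re = ε n := fun n => by
    simp only [hzdef, hz0, Complex.add_re, Complex.ofReal_re, Complex.re_ofReal_mul, Complex.I_re]; ring
  have hz0ne : z0 ≠ 0 := by
    simp only [hz0]
    apply mul_ne_zero _ Complex.I_ne_zero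
    rw [Complex.ofReal_ne_zero]; positivity
  have hzl : Tendsto z atTop (𝓝 z0) := by
    have : Tendsto (fun n => (ε n : ℂ)) atTop (𝓝 ((0:ℝ):ℂ)) :=
      (Complex.continuous_ofReal.tendsto 0).comp hεl
    simpa [hzdef] using this.add_const z0
  have hzne : ∀ n, z n ≠ 0 := fun n h => by
    have := hzre n; rw [h] at this; simp at this; exact (hε0 n).ne this
  obtain ⟨hFm, hFe⟩ := fourier_toLp h1 h2
  have hcF : Continuous (𝓕 φ) := cont_fourier h1
  set w : ℕ → ℝ → ℂ := fun n k => Complex.exp (-(z n) * (k:ℂ) ^ 2) * 𝓕 φ k with hw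
  have hre : ∀ n (k : ℝ), (-(z n) * (k:ℂ) ^ 2).re ≤ 0 := by
    intro n k
    have : (-(z n) * (k:ℂ) ^ 2).re = -(ε n * k ^ 2) := by
      rw [← Complex.ofReal_pow, Complex.re_mul_ofReal, Complex.neg_re, hzre]; ring
    rw [this]; have := hε0 n; have : 0 ≤ ε n * k ^ 2 := by positivity
    linarith
  have hwc : ∀ n, Continuous (w n) := fun n => by simp only [hw]; fun_prop
  have hw2 : ∀ n, MemLp (w n) 2 := fun n =>
    hFm.of_le (hwc n).aestronglyMeasurable (Eventually.of_forall fun k => by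
      simp only [hw, norm_mul]
      have := norm_cexp_le_one (hre n k)
      have h0 := norm_nonneg (𝓕 φ k)
      nlinarith)
  have hw1 : ∀ n, Integrable (w n) := fun n => by
    have hg : Integrable (fun k : ℝ => Complex.exp (-(z n) * (k:ℂ) ^ 2)) := by
      have := integrable_cexp_quadratic (b := z n) (by rw [hzre]; exact hε0 n) 0 0
      simpa using this
    exact hg.mul_bdd (c := ∫ x, ‖φ x‖) hcF.aestronglyMeasurable
      (Eventually.of_forall fun k => fourier_bdd φ k)
  -- convergence in the Hilbert space
  have hlim : Tendsto (fun n => FT.symm ((hw2 n).toLp (w n))) atTop (𝓝 (UU t (h2.toLp φ))) := by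
    rw [UU_apply]
    refine (FT.symm.continuous.tendsto _).comp ?_
    refine HH_tendsto_dom (f := w) (f0 := fun k => phf (-(4 * π ^ 2 * t)) 0 0 k * 𝓕 φ k)
      (b := fun k => 2 * ‖𝓕 φ k‖) (fun n => (hw2 n).coeFn_toLp) ?_ ?_ ?_ ?_
    · filter_upwards [ph_ae (-(4 * π ^ 2 * t)) 0 0 (FT (h2.toLp φ)), FT_toLp h1 h2] with k e1 e2
      rw [e1, e2]
    · have := (hFm.integrable_norm_pow (by norm_num)).const_mul 4
      refine this.congr (Eventually.of_forall fun x => ?_); simp only; ring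
    · intro n
      refine Eventually.of_forall fun k => ?_
      refine (norm_sub_le _ _).trans ?_
      simp only [hw, norm_mul, norm_phf]
      have := norm_cexp_le_one (hre n k)
      have h0 := norm_nonneg (𝓕 φ k)
      nlinarith
    · refine Eventually.of_forall fun k => ?_
      simp only [hw]
      apply Tendsto.mul_const
      have e : phf (-(4 * π ^ 2 * t)) 0 0 k = Complex.exp (-z0 * (k:ℂ) ^ 2) := by
        simp only [phf, hz0]; congr 1; push_cast; ring
      rw [e]
      have hc : Continuous fun z : ℂ => Complex.exp (-z * (k:ℂ) ^ 2) := by fun_prop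
      exact (hc.tendsto z0).comp hzl
  refine HH_ae_unique (fun n => FTs_toLp (hw1 n) (hw2 n)) hlim ?_
  refine Eventually.of_forall fun x => ?_
  have e : ∀ n, 𝓕⁻ (w n) x = (π / z n) ^ (1 / 2 : ℂ) *
      ∫ y, Complex.exp (-(π ^ 2 / z n) * ((x - y : ℝ) : ℂ) ^ 2) * φ y :=
    fun n => reg_kernel h1 (by rw [hzre]; exact hε0 n) x
  simp_rw [e]
  unfold sg
  apply Tendsto.mul
  · have e1 : (((4 * π * t : ℝ) : ℂ) * Complex.I) = (π / z0)⁻¹ := by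
      simp only [hz0]
      have : (π : ℂ) ≠ 0 := by exact_mod_cast Real.pi_ne_zero
      push_cast
      field_simp
    have him : (π / z0).im ≠ 0 := by
      have : (π / z0) = ((-(4 * π * t)⁻¹ : ℝ) : ℂ) * Complex.I := by
        simp only [hz0]
        have h1 : (π : ℂ) ≠ 0 := by exact_mod_cast Real.pi_ne_zero
        have h2 : (t : ℂ) ≠ 0 := by exact_mod_cast ht
        push_cast
        field_simp
        rw [Complex.I_sq]; ring
      rw [this]
      simp [ht, Real.pi_ne_zero]
    have hsl : (π / z0) ∈ Complex.slitPlane := Or.inr him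
    have e2 : (π / z0 : ℂ)⁻¹ ^ (-(1 : ℂ) / 2) = (π / z0) ^ (1 / 2 : ℂ) := by
      rw [Complex.inv_cpow _ _ (Complex.slitPlane_arg_ne_pi hsl), ← Complex.cpow_neg]
      congr 1; ring
    rw [e1, e2]
    have hd : Tendsto (fun n => (π : ℂ) / z n) atTop (𝓝 (π / z0)) :=
      tendsto_const_nhds.div hzl hz0ne
    exact hd.cpow tendsto_const_nhds hsl
  · refine tendsto_integral_of_dominated_convergence (fun y => ‖φ y‖) ?_ h1.norm ?_ ?_
    · intro n
      have : Continuous fun y : ℝ => Complex.exp (-(π ^ 2 / z n) * ((x - y : ℝ) : ℂ) ^ 2) := by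
        fun_prop
      exact this.aestronglyMeasurable.mul h1.1
    · intro n
      refine Eventually.of_forall fun y => ?_
      rw [norm_mul]
      have : ‖Complex.exp (-(π ^ 2 / z n) * ((x - y : ℝ) : ℂ) ^ 2)‖ ≤ 1 := by
        apply norm_cexp_le_one
        rw [← Complex.ofReal_pow (x - y), Complex.re_mul_ofReal, Complex.neg_re]
        have : 0 ≤ ((π : ℂ) ^ 2 / z n).re := by
          rw [← Complex.ofReal_pow, div_eq_mul_inv, Complex.re_ofReal_mul, Complex.inv_re, hzre]
          have := (hε0 n).le
          have := Complex.normSq_nonneg (z n)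
          positivity
        have h3 : 0 ≤ (x - y) ^ 2 := by positivity
        nlinarith
      have h0 := norm_nonneg (φ y)
      nlinarith
    · refine Eventually.of_forall fun y => ?_
      apply Tendsto.mul_const
      have e3 : phf (1 / (4 * t)) 0 0 (x - y)
          = Complex.exp (-(π ^ 2 / z0) * ((x - y : ℝ) : ℂ) ^ 2) := by
        simp only [phf, hz0]; congr 1
        have h1 : (π : ℂ) ≠ 0 := by exact_mod_cast Real.pi_ne_zero
        have h2 : (t : ℂ) ≠ 0 := by exact_mod_cast ht
        push_cast
        field_simp
        simp only [Complex.I_sq]; ring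
      rw [e3]
      apply (Complex.continuous_exp.tendsto _).comp
      exact ((tendsto_const_nhds.div hzl hz0ne).neg).mul_const _

lemma norm_sg_const {t : ℝ} (ht : 0 < t) :
    ‖(((4 * π * t : ℝ) : ℂ) * Complex.I) ^ (-(1 : ℂ) / 2)‖ = (4 * π * t) ^ (-(1:ℝ) / 2) := by
  have e : (-(1 : ℂ) / 2) = ((-(1:ℝ) / 2 : ℝ) : ℂ) := by push_cast; ring
  have h0 : (((4 * π * t : ℝ) : ℂ) * Complex.I) ≠ 0 :=
    mul_ne_zero (by rw [Complex.ofReal_ne_zero]; positivity) Complex.I_ne_zero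
  rw [e, Complex.norm_cpow_of_ne_zero h0]
  simp only [Complex.ofReal_im, mul_zero, Real.exp_zero, div_one, Complex.ofReal_re]
  rw [norm_mul, Complex.norm_I, mul_one, Complex.norm_real, Real.norm_eq_abs]
  rw [abs_of_pos (by positivity : 0 < 4 * π * t)]

lemma sg_eq {t : ℝ} (ht : t ≠ 0) (φ : ℝ → ℂ) (x : ℝ) :
    sg t φ x = (((4 * π * t : ℝ) : ℂ) * Complex.I) ^ (-(1 : ℂ) / 2) * phf (1 / (4 * t)) 0 0 x *
      𝓕 (fun y => phf (1 / (4 * t)) 0 0 y * φ y) (x / (4 * π * t)) := by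
  have this : ∫ y, phf (1 / (4 * t)) 0 0 (x - y) * φ y = phf (1 / (4 * t)) 0 0 x *
      ∫ y, phf 0 (-(2 * π * (x / (4 * π * t)))) 0 y * (phf (1 / (4 * t)) 0 0 y * φ y) := by
    rw [← integral_const_mul]
    apply integral_congr_ae; refine Eventually.of_forall fun y => ?_
    simp only
    rw [← mul_assoc, ← mul_assoc]
    congr 1
    simp only [phf, ← Complex.exp_add]; congr 1
    have h1 : (π : ℂ) ≠ 0 := by exact_mod_cast Real.pi_ne_zero
    have h2 : (t : ℂ) ≠ 0 := by exact_mod_cast ht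
    push_cast
    field_simp
    ring
  rw [sg, fourier_formula, this]
  ring

/-- unimodular constant in the factorisation of the free group -/
def cst (t : ℝ) : ℂ := (((4 * π * t : ℝ) : ℂ) * Complex.I) ^ (-(1 : ℂ) / 2) * ((√(4 * π * t) : ℝ) : ℂ)

lemma norm_cst {t : ℝ} (ht : 0 < t) : ‖cst t‖ = 1 := by
  rw [cst, norm_mul, norm_sg_const ht, Complex.norm_real, Real.norm_eq_abs,
    abs_of_nonneg (by positivity), Real.sqrt_eq_rpow, ← Real.rpow_add (by positivity)]
  norm_num

lemma scale_pos {t : ℝ} (ht : 0 < t) : 0 < (4 * π * t)⁻¹ := by positivity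

/-- factorisation of the free group -/
lemma UU_factor {t : ℝ} (ht : 0 < t) (f : HH) :
    UU t f = cst t • ph (1 / (4 * t)) 0 0 (dl (4 * π * t)⁻¹ (scale_pos ht)
      (FT (ph (1 / (4 * t)) 0 0 f))) := by
  refine HH_ext (A := fun f => UU t f) (B := fun f => cst t • ph (1 / (4 * t)) 0 0
    (dl (4 * π * t)⁻¹ (scale_pos ht) (FT (ph (1 / (4 * t)) 0 0 f)))) (UU t).continuous ?_ ?_ f
  · exact Continuous.const_smul (((ph _ _ _).continuous.comp (dl _ _).continuous).comp
      (FT.continuous.comp (ph _ _ _).continuous)) (cst t)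
  intro φ h1 h2
  apply Lp.ext
  rw [ph_toLp (1 / (4 * t)) 0 0 h2]
  set W := FT ((memLp_phf (1 / (4 * t)) 0 0 h2).toLp _) with hW
  have hWae := FT_toLp (integrable_phf (1 / (4 * t)) 0 0 h1) (memLp_phf (1 / (4 * t)) 0 0 h2)
  filter_upwards [sg_ae ht.ne' h1 h2, Lp.coeFn_smul (cst t)
    (ph (1 / (4 * t)) 0 0 (dl (4 * π * t)⁻¹ (scale_pos ht) W)),
    ph_ae (1 / (4 * t)) 0 0 (dl (4 * π * t)⁻¹ (scale_pos ht) W),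
    dl_ae (4 * π * t)⁻¹ (scale_pos ht) W, ae_scale (scale_pos ht).ne' hWae] with x e1 e2 e3 e4 e5
  rw [e1, e2, Pi.smul_apply, e3, e4, hW, e5, sg_eq ht.ne', smul_eq_mul, cst]
  have : ((√(4 * π * t) : ℝ) : ℂ) * ((√((4 * π * t)⁻¹) : ℝ) : ℂ) = 1 := by
    rw [← Complex.ofReal_mul, ← Real.sqrt_mul (by positivity), mul_inv_cancel₀ (by positivity)]
    simp
  have e6 : (4 * π * t)⁻¹ * x = x / (4 * π * t) := by rw [div_eq_inv_mul]
  rw [e6]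
  generalize (((4 * π * t : ℝ) : ℂ) * Complex.I) ^ (-(1 : ℂ) / 2) = A
  generalize 𝓕 (fun y => phf (1 / (4 * t)) 0 0 y * φ y) (x / (4 * π * t)) = B
  linear_combination (-A * phf (1 / (4 * t)) 0 0 x * B) * this

end NLS
end

noncomputable section
open MeasureTheory Real Filter Topology Set
open scoped ENNReal NNReal FourierTransform SchwartzMap ContDiff
set_option linter.unusedVariables false

namespace NLS

lemma HH_fatou {F : ℕ → HH} {f : ℕ → ℝ → ℂ} {g : ℝ → ℂ} {C : ℝ}
    (hF : ∀ n, F n =ᵐ[volume] f n) (hlim : ∀ᵐ x, Tendsto (fun n => f n x) atTop (𝓝 (g x)))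
    (hC : ∀ n, ‖F n‖ ≤ C) : MemLp g 2 ∧ eLpNorm g 2 volume ≤ ENNReal.ofReal C := by
  have hm : AEStronglyMeasurable g volume :=
    aestronglyMeasurable_of_tendsto_ae atTop (fun n => (Lp.aestronglyMeasurable (F n)).congr (hF n)) hlim
  have h1 : eLpNorm g 2 volume ≤ ENNReal.ofReal C := by
    refine (Lp.eLpNorm_lim_le_liminf_eLpNorm
      (fun n => (Lp.aestronglyMeasurable (F n)).congr (hF n)) g hlim).trans ?_
    refine liminf_le_of_le (by isBoundedDefault) fun b hb => ?_
    obtain ⟨n, hn⟩ := hb.exists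
    refine hn.trans ?_
    rw [← eLpNorm_congr_ae (hF n)]
    have := hC n
    rw [Lp.norm_def] at this
    rw [← ENNReal.ofReal_toReal (Lp.eLpNorm_ne_top (F n))]
    exact ENNReal.ofReal_le_ofReal this
  exact ⟨⟨hm, h1.trans_lt ENNReal.ofReal_lt_top⟩, h1⟩

/-- domain of the position operator -/
def DX (f : HH) : Prop := MemLp (fun x : ℝ => (x : ℂ) * f x) 2 volume

open Classical in
/-- position operator -/
def XX (f : HH) : HH := if h : DX f then MemLp.toLp _ h else 0

lemma XX_ae {f : HH} (h : DX f) : XX f =ᵐ[volume] fun x => (x : ℂ) * f x := by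
  rw [XX, dif_pos h]; exact MemLp.coeFn_toLp h

lemma XX_unique {f g : HH} (hg : g =ᵐ[volume] fun x => (x : ℂ) * f x) : DX f ∧ XX f = g := by
  have h : DX f := (memLp_congr_ae hg).1 (Lp.memLp g)
  exact ⟨h, Lp.ext ((XX_ae h).trans hg.symm)⟩

lemma XX_sub {f g : HH} (hf : DX f) (hg : DX g) : DX (f - g) ∧ XX (f - g) = XX f - XX g := by
  apply XX_unique
  filter_upwards [Lp.coeFn_sub (XX f) (XX g), Lp.coeFn_sub f g, XX_ae hf, XX_ae hg] with x h1 h2 h3 h4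
  rw [h1, h2, Pi.sub_apply, Pi.sub_apply, h3, h4]; ring

lemma XX_smul {f : HH} (c : ℂ) (hf : DX f) : DX (c • f) ∧ XX (c • f) = c • XX f := by
  apply XX_unique
  filter_upwards [Lp.coeFn_smul c (XX f), Lp.coeFn_smul c f, XX_ae hf] with x h1 h2 h3
  rw [h1, h2, Pi.smul_apply, Pi.smul_apply, h3]; simp only [smul_eq_mul]; ring

lemma XX_ph {f : HH} (a b c : ℝ) (hf : DX f) :
    DX (ph a b c f) ∧ XX (ph a b c f) = ph a b c (XX f) := by
  apply XX_unique
  filter_upwards [ph_ae a b c (XX f), ph_ae a b c f, XX_ae hf] with x h1 h2 h3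
  rw [h1, h2, h3]; ring

lemma S_le {f : HH} (h : DX f) (k : ℝ) : ‖ph 0 k 0 f - f‖ ≤ |k| * ‖XX f‖ := by
  apply Lp.norm_le_mul_norm_of_ae_le_mul
  filter_upwards [Lp.coeFn_sub (ph 0 k 0 f) f, ph_ae 0 k 0 f, XX_ae h] with x h1 h2 h3
  rw [h1, Pi.sub_apply, h2, h3]
  have : phf 0 k 0 x * f x - f x = (phf 0 k 0 x - 1) * f x := by ring
  rw [this, norm_mul, norm_mul, ← mul_assoc]
  gcongr
  have := Real.norm_exp_I_mul_ofReal_sub_one_le (x := k * x)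
  rw [phf, Complex.norm_real, Real.norm_eq_abs, ← abs_mul]
  simpa using this

lemma DX_of_S {f : HH} {C : ℝ} (H : ∀ k, ‖ph 0 k 0 f - f‖ ≤ C * |k|) : DX f ∧ ‖XX f‖ ≤ C := by
  have hpos : ∀ n : ℕ, (0:ℝ) < (n:ℝ) + 1 := fun n => by positivity
  have hC : 0 ≤ C := by
    have := (norm_nonneg _).trans (H 1); simpa using this
  have key := HH_fatou (F := fun n : ℕ => ((-Complex.I) * (((n:ℝ)+1 : ℝ) : ℂ)) •
      (ph 0 (((n:ℝ)+1)⁻¹) 0 f - f))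
    (f := fun n x => ((-Complex.I) * (((n:ℝ)+1 : ℝ) : ℂ)) * ((phf 0 (((n:ℝ)+1)⁻¹) 0 x - 1) * f x))
    (g := fun x => (x : ℂ) * f x) (C := C) ?_ ?_ ?_
  · obtain ⟨h1, h2⟩ := key
    refine ⟨h1, ?_⟩
    rw [Lp.norm_def, eLpNorm_congr_ae (XX_ae h1)]
    exact ENNReal.toReal_le_of_le_ofReal hC h2
  · intro n
    filter_upwards [Lp.coeFn_sub (ph 0 (((n:ℝ)+1)⁻¹) 0 f) f, ph_ae 0 (((n:ℝ)+1)⁻¹) 0 f,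
      Lp.coeFn_smul ((-Complex.I) * (((n:ℝ)+1 : ℝ) : ℂ)) (ph 0 (((n:ℝ)+1)⁻¹) 0 f - f)] with x h1 h2 h3
    rw [h3, Pi.smul_apply, h1, Pi.sub_apply, h2, smul_eq_mul]; ring
  · refine Eventually.of_forall fun x => ?_
    simp_rw [← mul_assoc]
    apply Tendsto.mul_const
    have hd : HasDerivAt (fun s : ℝ => Complex.exp (Complex.I * ((s * x : ℝ) : ℂ)))
        (Complex.I * x) 0 := by
      have h1 : HasDerivAt (fun s : ℝ => ((s * x : ℝ) : ℂ)) ((1 * x : ℝ) : ℂ) 0 :=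
        ((hasDerivAt_id (0:ℝ)).mul_const x).ofReal_comp
      have := (h1.const_mul Complex.I).cexp
      simpa using this
    have hs := hd.tendsto_slope_zero
    have hseq : Tendsto (fun n : ℕ => ((n:ℝ)+1)⁻¹) atTop (𝓝[≠] 0) := by
      rw [tendsto_nhdsWithin_iff]
      refine ⟨?_, Eventually.of_forall fun n => (inv_pos.2 (hpos n)).ne'⟩
      have := tendsto_one_div_add_atTop_nhds_zero_nat (𝕜 := ℝ)
      simpa using this
    have h4 := (hs.comp hseq).const_mul (-Complex.I)
    have e1 : -Complex.I * (Complex.I * x) = x := by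
      rw [← mul_assoc, neg_mul, Complex.I_mul_I]; simp
    rw [e1] at h4
    refine h4.congr fun n => ?_
    simp only [Function.comp, inv_inv, zero_add, zero_mul, Complex.ofReal_zero, mul_zero,
      Complex.exp_zero, Complex.real_smul, phf]
    simp only [add_zero]; ring
  · intro n
    rw [norm_smul, norm_mul, norm_neg, Complex.norm_I, one_mul, Complex.norm_real, Real.norm_eq_abs,
      abs_of_pos (hpos n)]
    have := H (((n:ℝ)+1)⁻¹)
    rw [abs_of_pos (inv_pos.2 (hpos n))] at this
    calc ((n:ℝ)+1) * ‖ph 0 (((n:ℝ)+1)⁻¹) 0 f - f‖ ≤ ((n:ℝ)+1) * (C * ((n:ℝ)+1)⁻¹) := by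
          have := hpos n; gcongr
      _ = C := by have := (hpos n).ne'; field_simp

lemma inner_XX {f g : HH} (hf : DX f) (hg : DX g) : inner ℂ f (XX g) = inner ℂ (XX f) g := by
  rw [MeasureTheory.L2.inner_def, MeasureTheory.L2.inner_def]
  apply integral_congr_ae
  filter_upwards [XX_ae hf, XX_ae hg] with x h1 h2
  rw [h1, h2]; simp [Complex.conj_ofReal]; ring

lemma DX_dense (f : HH) : ∃ F : ℕ → HH, (∀ n, DX (F n)) ∧ Tendsto F atTop (𝓝 f) := by
  have hpos : ∀ n : ℕ, (0:ℝ) < (n:ℝ) + 1 := fun n => by positivity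
  let w : ℕ → ℝ → ℝ := fun n x => (1 + x ^ 2 / ((n:ℝ)+1))⁻¹
  have hw0 : ∀ n x, 0 < w n x := fun n x => by
    have := hpos n; simp only [w]; positivity
  have hw1 : ∀ n x, w n x ≤ 1 := fun n x => by
    have := hpos n; simp only [w]; apply inv_le_one_of_one_le₀
    have : 0 ≤ x ^ 2 / ((n:ℝ)+1) := by positivity
    linarith
  have hwm : ∀ n, Continuous (w n) := fun n => by
    simp only [w]
    refine Continuous.inv₀ (by fun_prop) fun x => ?_
    have := hpos n; positivity
  have hm : ∀ n, MemLp (fun x => (w n x : ℂ) * f x) 2 := fun n =>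
    (Lp.memLp f).of_le ((Complex.continuous_ofReal.comp (hwm n)).aestronglyMeasurable.mul
      (Lp.aestronglyMeasurable f)) (Eventually.of_forall fun x => by
        rw [norm_mul, Complex.norm_real, Real.norm_eq_abs, abs_of_pos (hw0 n x)]
        exact mul_le_of_le_one_left (norm_nonneg _) (hw1 n x))
  refine ⟨fun n => (hm n).toLp, fun n => ?_, ?_⟩
  · refine ((Lp.memLp f).const_mul (((n:ℝ)+1 : ℝ) : ℂ)).of_le ?_ ?_
    · exact Complex.continuous_ofReal.aestronglyMeasurable.mul (Lp.aestronglyMeasurable _)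
    · filter_upwards [(hm n).coeFn_toLp] with x hx
      rw [hx, norm_mul, norm_mul, norm_mul, ← mul_assoc]
      gcongr
      rw [Complex.norm_real, Complex.norm_real, Complex.norm_real, Real.norm_eq_abs, Real.norm_eq_abs,
        Real.norm_eq_abs, abs_of_pos (hw0 n x), abs_of_pos (hpos n)]
      simp only [w]
      rw [← div_eq_mul_inv, div_le_iff₀ (by have := hpos n; positivity)]
      have e : ((n:ℝ)+1) * (1 + x ^ 2 / ((n:ℝ)+1)) = (n:ℝ) + 1 + x ^ 2 := by
        have := (hpos n).ne'; field_simp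
      rw [e]
      have : (0:ℝ) ≤ n := n.cast_nonneg
      nlinarith [sq_nonneg (|x| - 1), sq_abs x, abs_nonneg x]
  · refine HH_tendsto_dom (fun n => (hm n).coeFn_toLp) (f0 := f) (EventuallyEq.rfl)
      (b := fun x => 2 * ‖f x‖) ?_ ?_ ?_
    · have := (HH_integrable_sq f).const_mul 4
      refine this.congr (Eventually.of_forall fun x => ?_); simp only; ring
    · intro n
      refine Eventually.of_forall fun x => ?_
      refine (norm_sub_le _ _).trans ?_
      rw [norm_mul, Complex.norm_real, Real.norm_eq_abs, abs_of_pos (hw0 n x)]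
      nlinarith [norm_nonneg (f x), hw1 n x]
    · refine Eventually.of_forall fun x => ?_
      have h1 : Tendsto (fun n : ℕ => x ^ 2 / ((n:ℝ)+1)) atTop (𝓝 0) := by
        have := (tendsto_one_div_add_atTop_nhds_zero_nat (𝕜 := ℝ)).const_mul (x ^ 2)
        simpa [div_eq_mul_inv] using this
      have h2 : Tendsto (fun n => w n x) atTop (𝓝 1) := by
        have := (h1.const_add 1).inv₀ (by norm_num)
        simpa using this
      have h3 := ((Complex.continuous_ofReal.tendsto _).comp h2).mul_const (f x)
      simpa [Function.comp_def] using h3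

lemma XX_weak {ι : Type*} {l : Filter ι} {q : ι → HH} {q0 : HH} {C : ℝ} (hq : Tendsto q l (𝓝 q0))
    (hD : ∀ᶠ i in l, DX (q i) ∧ ‖XX (q i)‖ ≤ C) (h0 : DX q0) (Φ : HH) :
    Tendsto (fun i => inner ℂ Φ (XX (q i))) l (𝓝 (inner ℂ Φ (XX q0))) := by
  rcases l.eq_or_neBot with rfl | hl
  · exact tendsto_bot
  have hC : 0 ≤ C := by
    obtain ⟨i, hi⟩ := hD.exists; exact (norm_nonneg _).trans hi.2
  obtain ⟨F, hF, hFl⟩ := DX_dense Φ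
  rw [Metric.tendsto_nhds]
  intro ε hε
  have hb : Tendsto (fun n => ‖F n - Φ‖ * (C + ‖XX q0‖)) atTop (𝓝 0) := by
    have := (tendsto_iff_norm_sub_tendsto_zero.1 hFl).mul_const (C + ‖XX q0‖)
    simpa using this
  obtain ⟨n, hn⟩ := ((tendsto_order.1 hb).2 (ε / 2) (by positivity)).exists
  have h1 : Tendsto (fun i => inner ℂ (XX (F n)) (q i)) l (𝓝 (inner ℂ (XX (F n)) q0)) :=
    tendsto_const_nhds.inner hq
  filter_upwards [hD, (Metric.tendsto_nhds.1 h1) (ε / 2) (by positivity)] with i hi1 hi2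
  rw [dist_eq_norm] at hi2 ⊢
  rw [← inner_XX (hF n) hi1.1, ← inner_XX (hF n) h0] at hi2
  have e : inner ℂ Φ (XX (q i)) - inner ℂ Φ (XX q0)
      = (inner ℂ (F n) (XX (q i)) - inner ℂ (F n) (XX q0))
        - (inner ℂ (F n - Φ) (XX (q i)) - inner ℂ (F n - Φ) (XX q0)) := by
    rw [inner_sub_left, inner_sub_left]; ring
  rw [e]
  have h3 : ‖inner ℂ (F n - Φ) (XX (q i)) - inner ℂ (F n - Φ) (XX q0)‖ ≤ ‖F n - Φ‖ * (C + ‖XX q0‖) := by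
    refine (norm_sub_le _ _).trans ?_
    rw [mul_add]
    refine add_le_add ((norm_inner_le_norm _ _).trans ?_) (norm_inner_le_norm _ _)
    gcongr; exact hi1.2
  refine (norm_sub_le _ _).trans_lt ?_
  linarith

/-- Gronwall -/
lemma gron {f f' : ℝ → HH} {k a : ℝ → ℝ} {s T : ℝ} (hf : ∀ t ∈ Icc s T, HasDerivAt f (f' t) t)
    (ha : ∀ t ∈ Icc s T, HasDerivAt a (k t) t) (hk : ∀ t ∈ Icc s T, ‖f' t‖ ≤ k t * ‖f t‖)
    {t : ℝ} (ht : t ∈ Icc s T) : ‖f t‖ ≤ ‖f s‖ * Real.exp (a t - a s) := by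
  let G : ℝ → ℝ := fun t => ‖f t‖ ^ 2 * Real.exp (-(2 * a t))
  have hG : ∀ t ∈ Icc s T, HasDerivAt G (2 * inner ℝ (f t) (f' t) * Real.exp (-(2 * a t))
      + ‖f t‖ ^ 2 * (Real.exp (-(2 * a t)) * -(2 * k t))) t := by
    intro t ht
    exact (hf t ht).norm_sq.mul ((((ha t ht).const_mul 2).neg).exp)
  have hanti : AntitoneOn G (Icc s T) := by
    apply antitoneOn_of_deriv_nonpos (convex_Icc s T)
    · exact fun x hx => (hG x hx).continuousAt.continuousWithinAt
    · intro x hx; rw [interior_Icc] at hx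
      exact (hG x (Ioo_subset_Icc_self hx)).differentiableAt.differentiableWithinAt
    · intro x hx; rw [interior_Icc] at hx
      have hx := Ioo_subset_Icc_self hx
      rw [(hG x hx).deriv]
      have h1 : inner ℝ (f x) (f' x) ≤ ‖f x‖ * (k x * ‖f x‖) :=
        (real_inner_le_norm _ _).trans (mul_le_mul_of_nonneg_left (hk x hx) (norm_nonneg _))
      nlinarith [Real.exp_pos (-(2 * a x))]
  have h := hanti (left_mem_Icc.2 (ht.1.trans ht.2)) ht ht.1
  simp only [G] at h
  have h2 : ‖f t‖ ^ 2 ≤ (‖f s‖ * Real.exp (a t - a s)) ^ 2 := by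
    have e1 : (‖f s‖ * Real.exp (a t - a s)) ^ 2 = ‖f s‖ ^ 2 * Real.exp (-(2 * a s)) * Real.exp (2 * a t) := by
      rw [mul_pow, ← Real.exp_nat_mul, mul_assoc, ← Real.exp_add]; congr 2; push_cast; ring
    have e2 : ‖f t‖ ^ 2 = ‖f t‖ ^ 2 * Real.exp (-(2 * a t)) * Real.exp (2 * a t) := by
      rw [mul_assoc, ← Real.exp_add]; simp
    rw [e1, e2]; gcongr
  exact le_of_sq_le_sq h2 (by positivity)

lemma mvt {f f' : ℝ → HH} {k a : ℝ → ℝ} {s T : ℝ} (hf : ∀ t ∈ Icc s T, HasDerivAt f (f' t) t)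
    (ha : ∀ t ∈ Icc s T, HasDerivAt a (k t) t) (hk : ∀ t ∈ Icc s T, ‖f' t‖ ≤ k t)
    {t : ℝ} (ht : t ∈ Icc s T) : ‖f t - f s‖ ≤ a t - a s := by
  refine image_norm_le_of_norm_deriv_right_le_deriv_boundary' (f := fun t => f t - f s) (f' := f')
    (a := s) (b := T) (B := fun t => a t - a s) (B' := k) ?_ ?_ (by simp) ?_ ?_ ?_ ht
  · exact fun x hx => ((hf x hx).sub_const _).continuousAt.continuousWithinAt
  · exact fun x hx => ((hf x (Ico_subset_Icc_self hx)).sub_const _).hasDerivWithinAt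
  · exact fun x hx => ((ha x hx).sub_const _).continuousAt.continuousWithinAt
  · exact fun x hx => ((ha x (Ico_subset_Icc_self hx)).sub_const _).hasDerivWithinAt
  · exact fun x hx => hk x (Ico_subset_Icc_self hx)

end NLS
end

noncomputable section
open MeasureTheory Real Filter Topology Set
open scoped ENNReal NNReal FourierTransform SchwartzMap ContDiff
set_option linter.unusedVariables false

namespace NLS

lemma XX_normsq {f : HH} (h : DX f) :
    Integrable (fun x => x ^ 2 * ‖f x‖ ^ 2) ∧ ‖XX f‖ ^ 2 = ∫ x, x ^ 2 * ‖f x‖ ^ 2 := by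
  have e : (fun x => ‖XX f x‖ ^ 2) =ᵐ[volume] fun x => x ^ 2 * ‖f x‖ ^ 2 := by
    filter_upwards [XX_ae h] with x hx
    rw [hx, norm_mul, mul_pow, Complex.norm_real, Real.norm_eq_abs, sq_abs]
  exact ⟨(HH_integrable_sq (XX f)).congr e, by rw [HH_normsq, integral_congr_ae e]⟩

lemma DX_integrable {f : HH} (h : DX f) : Integrable f := by
  have h1 := (integrable_inv_one_add_sq.add ((HH_integrable_sq f).add (XX_normsq h).1))
  refine h1.mono' (Lp.aestronglyMeasurable f) (Eventually.of_forall fun x => ?_)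
  simp only [Pi.add_apply]
  have hp : 0 < 1 + x ^ 2 := by positivity
  have hi : (1 + x ^ 2)⁻¹ * (1 + x ^ 2) = 1 := inv_mul_cancel₀ hp.ne'
  have hi0 : 0 < (1 + x ^ 2)⁻¹ := by positivity
  have e : (1 + x ^ 2)⁻¹ + (‖f x‖ ^ 2 + x ^ 2 * ‖f x‖ ^ 2) - 2 * ‖f x‖
    = (1 + x ^ 2)⁻¹ * (1 - (1 + x ^ 2) * ‖f x‖) ^ 2 := by
    field_simp; ring
  have : 0 ≤ (1 + x ^ 2)⁻¹ * (1 - (1 + x ^ 2) * ‖f x‖) ^ 2 := by positivity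
  nlinarith [norm_nonneg (f x)]

lemma exp_sub_sq (θ : ℝ) : ‖Complex.exp (Complex.I * (θ : ℂ)) - 1‖ ^ 2 ≤ 2 * θ ^ 2 / (1 + θ ^ 2 / 4) := by
  have h1 : ‖Complex.exp (Complex.I * (θ : ℂ)) - 1‖ ^ 2 ≤ θ ^ 2 := by
    rw [← sq_abs θ]
    have := Real.norm_exp_I_mul_ofReal_sub_one_le (x := θ)
    exact pow_le_pow_left₀ (norm_nonneg _) this 2
  have h2 : ‖Complex.exp (Complex.I * (θ : ℂ)) - 1‖ ^ 2 ≤ 4 := by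
    have h3 : ‖Complex.exp (Complex.I * (θ : ℂ)) - 1‖ ≤ 2 := by
      refine (norm_sub_le _ _).trans ?_
      rw [mul_comm, Complex.norm_exp_ofReal_mul_I]; norm_num
    nlinarith [norm_nonneg (Complex.exp (Complex.I * (θ : ℂ)) - 1)]
  rw [le_div_iff₀ (by positivity)]
  rcases le_total (θ ^ 2) 4 with h | h <;> nlinarith [sq_nonneg θ]

lemma osc {f : HH} (h : DX f) {μ : ℝ} (hμ : 0 < μ) (ξ η : ℝ) :
    ‖𝓕 (f : ℝ → ℂ) ξ - 𝓕 (f : ℝ → ℂ) η‖ ≤ (μ * (8 * π ^ 2 * |ξ - η|) + ‖XX f‖ ^ 2 / μ) / 2 := by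
  rcases eq_or_ne ξ η with rfl | hne
  · simp; positivity
  have hδ : π * (ξ - η) ≠ 0 := mul_ne_zero Real.pi_ne_zero (sub_ne_zero.2 hne)
  have hi := DX_integrable h
  rw [fourier_formula, fourier_formula, ← integral_sub (integrable_phf _ _ _ hi) (integrable_phf _ _ _ hi)]
  have hA : Integrable (fun x : ℝ => (1 + (π * (ξ - η) * x) ^ 2)⁻¹) :=
    integrable_inv_one_add_sq.comp_mul_left' hδ
  have hAi : ∫ x : ℝ, (1 + (π * (ξ - η) * x) ^ 2)⁻¹ = |ξ - η|⁻¹ := by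
    have := Measure.integral_comp_mul_left (fun x : ℝ => (1 + x ^ 2)⁻¹) (π * (ξ - η))
    rw [this, integral_univ_inv_one_add_sq, abs_inv, abs_mul, abs_of_pos Real.pi_pos, smul_eq_mul]
    have : |ξ - η| ≠ 0 := abs_ne_zero.2 (sub_ne_zero.2 hne)
    field_simp
  refine (norm_integral_le_of_norm_le (g := fun x => (μ * (8 * π ^ 2 * (ξ - η) ^ 2) / 2) *
    (1 + (π * (ξ - η) * x) ^ 2)⁻¹ + (1 / (2 * μ)) * (x ^ 2 * ‖f x‖ ^ 2))
    ((hA.const_mul _).add ((XX_normsq h).1.const_mul _)) (Eventually.of_forall fun x => ?_)).trans ?_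
  · rw [← sub_mul, norm_mul]
    have e1 : ‖phf 0 (-(2 * π * ξ)) 0 x - phf 0 (-(2 * π * η)) 0 x‖
        = ‖Complex.exp (Complex.I * ((2 * π * (η - ξ) * x : ℝ) : ℂ)) - 1‖ := by
      have : phf 0 (-(2 * π * ξ)) 0 x - phf 0 (-(2 * π * η)) 0 x
        = phf 0 (-(2 * π * η)) 0 x * (Complex.exp (Complex.I * ((2 * π * (η - ξ) * x : ℝ) : ℂ)) - 1) := by
        rw [mul_sub, mul_one, phf, phf, ← Complex.exp_add]; congr 2; push_cast; ring
      rw [this, norm_mul, norm_phf, one_mul]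
    rw [e1]
    have h2 := exp_sub_sq (2 * π * (η - ξ) * x)
    set N := ‖Complex.exp (Complex.I * ((2 * π * (η - ξ) * x : ℝ) : ℂ)) - 1‖ with hN
    have hN0 : 0 ≤ N := norm_nonneg _
    set D := (1 + (π * (ξ - η) * x) ^ 2) with hD
    have hDp : 0 < D := by positivity
    have e2 : 1 + (2 * π * (η - ξ) * x) ^ 2 / 4 = D := by rw [hD]; ring
    rw [e2, div_eq_mul_inv] at h2
    set y := 8 * π ^ 2 * (ξ - η) ^ 2 * D⁻¹ with hy
    have hy0 : 0 ≤ y := by positivity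
    have h3 : N ^ 2 ≤ y * x ^ 2 := by
      refine h2.trans (le_of_eq ?_); rw [hy]; ring
    have h4 : N ≤ √y * |x| := by
      rw [← Real.sqrt_sq_eq_abs, ← Real.sqrt_mul hy0]; exact Real.le_sqrt_of_sq_le h3
    have h5 : N * ‖f x‖ ≤ √y * (|x| * ‖f x‖) := by
      rw [← mul_assoc]; gcongr
    have h6 : √y * (|x| * ‖f x‖) ≤ μ / 2 * y + (1 / (2 * μ)) * (x ^ 2 * ‖f x‖ ^ 2) := by
      have e3 : x ^ 2 * ‖f x‖ ^ 2 = (|x| * ‖f x‖) ^ 2 := by rw [mul_pow, sq_abs]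
      rw [e3]
      generalize |x| * ‖f x‖ = b
      have e4 : y = √y ^ 2 := (Real.sq_sqrt hy0).symm
      rw [e4, Real.sqrt_sq (Real.sqrt_nonneg _)]
      generalize √y = a
      have : μ / 2 * a ^ 2 + 1 / (2 * μ) * b ^ 2 - a * b = (μ * a - b) ^ 2 / (2 * μ) := by
        field_simp; ring
      have h7 : 0 ≤ (μ * a - b) ^ 2 / (2 * μ) := by positivity
      linarith
    refine (h5.trans h6).trans (le_of_eq ?_)
    rw [hy]; ring
  · rw [integral_add (hA.const_mul _) ((XX_normsq h).1.const_mul _), integral_const_mul,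
      integral_const_mul, hAi, ← (XX_normsq h).2]
    have h0 : |ξ - η| ≠ 0 := abs_ne_zero.2 (sub_ne_zero.2 hne)
    rw [← sq_abs (ξ - η)]
    apply le_of_eq; field_simp

lemma GN_aux {v : ℝ → ℂ} {r X K E : ℝ} (hr : 0 < r) (hX : 0 ≤ X) (hK : X < K)
    (hosc : ∀ {μ : ℝ}, 0 < μ → ∀ ξ η, ‖v ξ - v η‖ ≤ (μ * (8 * π ^ 2 * |ξ - η|) + X / μ) / 2)
    (hE' : Integrable fun ξ => ‖v ξ‖ ^ r) (hEd : E = ∫ ξ, ‖v ξ‖ ^ r) (hE0 : 0 ≤ E) (ξ : ℝ) :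
    ‖v ξ‖ ^ (r + 2) ≤ 16 * π ^ 2 * 2 ^ r * E * K := by
  have hK0 : 0 < K := hX.trans_lt hK
  rcases eq_or_lt_of_le (norm_nonneg (v ξ)) with hB | hB
  · rw [← hB, Real.zero_rpow (by linarith)]; exact mul_nonneg (mul_nonneg (by positivity) hE0) hK0.le
  set B := ‖v ξ‖ with hBd
  set δ := B ^ 2 / (32 * π ^ 2 * K) with hδ
  have hδ0 : 0 < δ := by positivity
  have h1 : ∀ η ∈ Icc (ξ - δ) (ξ + δ), B / 2 ≤ ‖v η‖ := by
    intro η hη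
    have hd : |ξ - η| ≤ δ := by rw [abs_le]; constructor <;> linarith [hη.1, hη.2]
    have h2 := hosc (μ := 2 * K / B) (by positivity) ξ η
    have h3 : (2 * K / B * (8 * π ^ 2 * |ξ - η|) + X / (2 * K / B)) / 2 ≤ B / 2 := by
      have h4 : 2 * K / B * (8 * π ^ 2 * |ξ - η|) ≤ 2 * K / B * (8 * π ^ 2 * δ) := by gcongr
      have h5 : X / (2 * K / B) ≤ K / (2 * K / B) := by gcongr
      have h6 : 2 * K / B * (8 * π ^ 2 * δ) = B / 2 := by rw [hδ]; field_simp; norm_num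
      have h7 : K / (2 * K / B) = B / 2 := by field_simp
      linarith
    have h8 := norm_sub_norm_le (v ξ) (v η)
    linarith
  have h9 : 2 * δ * (B / 2) ^ r ≤ E := by
    calc 2 * δ * (B / 2) ^ r = ∫ η in Icc (ξ - δ) (ξ + δ), (B / 2) ^ r := by
          rw [setIntegral_const, smul_eq_mul, Measure.real, Real.volume_Icc, ENNReal.toReal_ofReal (by linarith)]
          ring
      _ ≤ ∫ η in Icc (ξ - δ) (ξ + δ), ‖v η‖ ^ r := by
          apply setIntegral_mono_on (by simp) hE'.integrableOn measurableSet_Icc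
          intro η hη
          exact Real.rpow_le_rpow (by positivity) (h1 η hη) hr.le
      _ ≤ E := by rw [hEd]; exact setIntegral_le_integral hE' (Eventually.of_forall fun x => by positivity)
  have e1 : B ^ (r + 2) = 16 * π ^ 2 * 2 ^ r * (2 * δ * (B / 2) ^ r) * K := by
    rw [Real.div_rpow hB.le (by norm_num), Real.rpow_add hB, hδ]
    have : (2:ℝ) ^ r ≠ 0 := by positivity
    rw [Real.rpow_two]
    field_simp; norm_num
  rw [e1]; gcongr

lemma GN {f : HH} (h : DX f) {r : ℝ} (hr : 0 < r) (hE : Integrable fun ξ => ‖FT f ξ‖ ^ r) :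
    ∀ᵐ ξ, ‖FT f ξ‖ ^ (r + 2) ≤ 16 * π ^ 2 * 2 ^ r * (∫ ξ, ‖FT f ξ‖ ^ r) * ‖XX f‖ ^ 2 := by
  have hi := DX_integrable h
  have hae : FT f =ᵐ[volume] 𝓕 (f : ℝ → ℂ) := by
    have := FT_toLp hi (Lp.memLp f)
    rwa [Lp.toLp_coeFn] at this
  have hcae : (fun ξ => ‖FT f ξ‖ ^ r) =ᵐ[volume] fun ξ => ‖𝓕 (f : ℝ → ℂ) ξ‖ ^ r := by
    filter_upwards [hae] with x hx; rw [hx]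
  rw [integral_congr_ae hcae]
  have hE' := hE.congr hcae
  set v := 𝓕 (f : ℝ → ℂ) with hv
  set E := ∫ ξ, ‖v ξ‖ ^ r with hEd
  have hE0 : 0 ≤ E := integral_nonneg fun x => by positivity
  filter_upwards [hae] with ξ hξ
  rw [hξ]
  have key : ∀ K, ‖XX f‖ ^ 2 < K → ‖v ξ‖ ^ (r + 2) ≤ 16 * π ^ 2 * 2 ^ r * E * K :=
    fun K hK => GN_aux hr (sq_nonneg _) hK (fun hμ ξ η => osc h hμ ξ η) hE' hEd hE0 ξ
  refine le_of_forall_pos_le_add fun ε hε => ?_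
  have hc : 0 ≤ 16 * π ^ 2 * 2 ^ r * E := by positivity
  have := key (‖XX f‖ ^ 2 + ε / (16 * π ^ 2 * 2 ^ r * E + 1)) (by linarith [show 0 < ε / (16 * π ^ 2 * 2 ^ r * E + 1) by positivity])
  refine this.trans ?_
  rw [mul_add]
  have h3 : 16 * π ^ 2 * 2 ^ r * E * (ε / (16 * π ^ 2 * 2 ^ r * E + 1)) ≤ ε := by
    rw [mul_div_assoc', div_le_iff₀ (by linarith)]
    nlinarith
  linarith

end NLS
end

noncomputable section
open MeasureTheory Real Filter Topology Set
open scoped ENNReal NNReal FourierTransform SchwartzMap ContDiff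
set_option linter.unusedVariables false

namespace NLS

lemma FH_indep {α m m' : ℝ} (hα : 1 ≤ α) (hm : 0 ≤ m) (hm' : 0 ≤ m') {f : HH}
    (h : ∀ᵐ x, ‖f x‖ ≤ m) (h' : ∀ᵐ x, ‖f x‖ ≤ m') : FH α m hα hm f = FH α m' hα hm' f := by
  apply Lp.ext
  filter_upwards [FH_ae hα hm f, FH_ae hα hm' f, h, h'] with x h1 h2 h3 h4
  rw [h1, h2, Fm_eq h3, Fm_eq h4]

lemma norm_UU_ae {t : ℝ} (ht : 0 < t) (f : HH) : ∀ᵐ x, ‖UU t f x‖ =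
    √((4 * π * t)⁻¹) * ‖FT (ph (1 / (4 * t)) 0 0 f) ((4 * π * t)⁻¹ * x)‖ := by
  rw [UU_factor ht f]
  filter_upwards [Lp.coeFn_smul (cst t) (ph (1 / (4 * t)) 0 0 (dl (4 * π * t)⁻¹ (scale_pos ht)
      (FT (ph (1 / (4 * t)) 0 0 f)))), ph_ae (1 / (4 * t)) 0 0 (dl (4 * π * t)⁻¹ (scale_pos ht)
      (FT (ph (1 / (4 * t)) 0 0 f))), dl_ae (4 * π * t)⁻¹ (scale_pos ht)
      (FT (ph (1 / (4 * t)) 0 0 f))] with x h1 h2 h3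
  rw [h1, Pi.smul_apply, smul_eq_mul, h2, h3, norm_mul, norm_mul, norm_mul, norm_cst ht, norm_phf,
    one_mul, one_mul, Complex.norm_real, Real.norm_eq_abs, abs_of_nonneg (Real.sqrt_nonneg _)]

lemma V_bdd {t m : ℝ} (ht : 0 < t) {f : HH} (h : ∀ᵐ x, ‖UU t f x‖ ≤ m) :
    ∀ᵐ x, ‖FT (ph (1 / (4 * t)) 0 0 f) x‖ ≤ m * √(4 * π * t) := by
  have h1 : ∀ᵐ x, √((4 * π * t)⁻¹) * ‖FT (ph (1 / (4 * t)) 0 0 f) ((4 * π * t)⁻¹ * x)‖ ≤ m := by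
    filter_upwards [h, norm_UU_ae ht f] with x h1 h2; rwa [← h2]
  have h0 : 0 < 4 * π * t := by positivity
  filter_upwards [ae_scale h0.ne' h1] with x hx
  rw [inv_mul_cancel_left₀ h0.ne', Real.sqrt_inv, inv_mul_le_iff₀ (Real.sqrt_pos.2 h0)] at hx
  rw [mul_comm m]; exact hx

lemma u_bdd {t m : ℝ} (ht : 0 < t) {f : HH} (h : ∀ᵐ x, ‖FT (ph (1 / (4 * t)) 0 0 f) x‖ ≤ m) :
    ∀ᵐ x, ‖UU t f x‖ ≤ √((4 * π * t)⁻¹) * m := by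
  filter_upwards [norm_UU_ae ht f, ae_scale (scale_pos ht).ne' h] with x h1 h2
  rw [h1]; gcongr

lemma E_scale {t r : ℝ} (ht : 0 < t) (f : HH) : ∫ x, ‖UU t f x‖ ^ (r + 2) =
    (4 * π * t) ^ (-r / 2) * ∫ x, ‖FT (ph (1 / (4 * t)) 0 0 f) x‖ ^ (r + 2) := by
  have h0 : 0 < 4 * π * t := by positivity
  have e : (fun x => ‖UU t f x‖ ^ (r + 2)) =ᵐ[volume] fun x => √((4 * π * t)⁻¹) ^ (r + 2) *
      ‖FT (ph (1 / (4 * t)) 0 0 f) ((4 * π * t)⁻¹ * x)‖ ^ (r + 2) := by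
    filter_upwards [norm_UU_ae ht f] with x hx
    rw [hx, Real.mul_rpow (by positivity) (by positivity)]
  rw [integral_congr_ae e, integral_const_mul, Measure.integral_comp_mul_left
    (fun x => ‖FT (ph (1 / (4 * t)) 0 0 f) x‖ ^ (r + 2)), smul_eq_mul, ← mul_assoc]
  congr 1
  rw [inv_inv, abs_of_pos h0, Real.sqrt_eq_rpow, ← Real.rpow_mul (by positivity), Real.inv_rpow h0.le,
    ← Real.rpow_neg h0.le]
  nth_rewrite 2 [← Real.rpow_one (4 * π * t)]
  rw [← Real.rpow_add h0]
  congr 1; ring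

lemma Fm_scale {α m s : ℝ} (hs : 0 < s) (z : ℂ) :
    Fm α m ((s : ℂ) * z) = (s : ℂ) * ((s ^ α : ℝ) : ℂ) * Fm α (m * s⁻¹) z := by
  simp only [Fm, norm_mul, Complex.norm_real, Real.norm_eq_abs, abs_of_pos hs]
  have : min (s * ‖z‖) m = s * min ‖z‖ (m * s⁻¹) := by
    rw [mul_min_of_nonneg _ _ hs.le]; congr 1; field_simp
  by_cases hm : 0 ≤ min ‖z‖ (m * s⁻¹)
  · rw [this, Real.mul_rpow hs.le hm]; push_cast; ring
  · rw [this]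
    have h1 : m * s⁻¹ < 0 := by
      by_contra h; exact hm (le_min (norm_nonneg _) (not_lt.1 h))
    have h2 : min ‖z‖ (m * s⁻¹) = m * s⁻¹ := min_eq_right (h1.le.trans (norm_nonneg _))
    rw [h2, Real.rpow_def_of_neg h1, Real.rpow_def_of_neg (mul_neg_of_pos_of_neg hs h1),
      Real.log_mul hs.ne' h1.ne, Real.rpow_def_of_pos hs, add_mul, Real.exp_add]
    push_cast; ring

lemma g_eq {α t m : ℝ} (hα : 1 ≤ α) (hm : 0 ≤ m) (ht : 0 < t) (f : HH)
    (hm' : 0 ≤ m * √(4 * π * t)) :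
    ph (1 / (4 * t)) 0 0 (UU (-t) (FH α m hα hm (UU t f))) =
      (((4 * π * t) ^ (-α / 2) : ℝ) : ℂ) •
        FT.symm (FH α (m * √(4 * π * t)) hα hm' (FT (ph (1 / (4 * t)) 0 0 f))) := by
  have h0 : 0 < 4 * π * t := by positivity
  set V := FT (ph (1 / (4 * t)) 0 0 f) with hV
  set g := UU (-t) (FH α m hα hm (UU t f)) with hg
  have h1 : UU t g = FH α m hα hm (UU t f) := by rw [hg, UU_neg']
  have hsm : ∀ w : HH, FH α m hα hm (cst t • w) = cst t • FH α m hα hm w := by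
    intro w
    apply Lp.ext
    filter_upwards [FH_ae hα hm (cst t • w), Lp.coeFn_smul (cst t) w,
      Lp.coeFn_smul (cst t) (FH α m hα hm w), FH_ae hα hm w] with x h1 h2 h3 h4
    rw [h1, h2, h3, Pi.smul_apply, Pi.smul_apply, h4, smul_eq_mul, smul_eq_mul, Fm_unit (norm_cst ht)]
  have hdl : FH α m hα hm (dl (4 * π * t)⁻¹ (scale_pos ht) V) = dl (4 * π * t)⁻¹ (scale_pos ht)
      ((((4 * π * t) ^ (-α / 2) : ℝ) : ℂ) • FH α (m * √(4 * π * t)) hα hm' V) := by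
    apply Lp.ext
    filter_upwards [FH_ae hα hm (dl (4 * π * t)⁻¹ (scale_pos ht) V), dl_ae (4 * π * t)⁻¹ (scale_pos ht) V,
      dl_ae (4 * π * t)⁻¹ (scale_pos ht)
        ((((4 * π * t) ^ (-α / 2) : ℝ) : ℂ) • FH α (m * √(4 * π * t)) hα hm' V),
      ae_scale (scale_pos ht).ne' (Lp.coeFn_smul (((4 * π * t) ^ (-α / 2) : ℝ) : ℂ)
        (FH α (m * √(4 * π * t)) hα hm' V)),
      ae_scale (scale_pos ht).ne' (FH_ae hα hm' V)] with x h1 h2 h3 h4 h5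
    have hs : 0 < √((4 * π * t)⁻¹) := Real.sqrt_pos.2 (scale_pos ht)
    rw [h1, h2, h3, h4, Pi.smul_apply, h5, Fm_scale hs, smul_eq_mul, ← mul_assoc]
    have e1 : √((4 * π * t)⁻¹) ^ α = (4 * π * t) ^ (-α / 2) := by
      rw [Real.sqrt_eq_rpow, ← Real.rpow_mul (by positivity), Real.inv_rpow h0.le,
        ← Real.rpow_neg h0.le]
      congr 1; ring
    have e2 : (√((4 * π * t)⁻¹))⁻¹ = √(4 * π * t) := by rw [Real.sqrt_inv, inv_inv]
    rw [e1, e2]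
  rw [UU_factor ht g, UU_factor ht f, hsm, FH_ph, ← hV, hdl] at h1
  have h2 : cst t ≠ 0 := by
    intro h; have := norm_cst ht; rw [h] at this; simp at this
  have h3 := smul_right_injective HH h2 h1
  have h4 := (dl _ _).injective ((ph _ _ _).injective h3)
  apply FT.injective
  rw [h4, map_smul]; simp

lemma deriv_K {φ : ℝ → HH} {φ' : HH} {t L : ℝ} (hφ : HasDerivAt φ φ' t)
    (hD : ∀ᶠ τ in 𝓝 t, DX (φ τ) ∧ ‖XX (φ τ) - XX (φ t)‖ ≤ L * |τ - t|) (h0 : DX φ') :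
    HasDerivAt (fun τ => ‖XX (φ τ)‖ ^ 2) (2 * (inner ℂ (XX (φ t)) (XX φ')).re) t := by
  have hDt : DX (φ t) := hD.self_of_nhds.1
  rw [hasDerivAt_iff_tendsto_slope]
  have hD' : ∀ᶠ τ in 𝓝[≠] t, DX (φ τ) ∧ ‖XX (φ τ) - XX (φ t)‖ ≤ L * |τ - t| :=
    hD.filter_mono nhdsWithin_le_nhds
  have hne : ∀ᶠ τ in 𝓝[≠] t, τ ≠ t := eventually_mem_nhdsWithin
  have hq : Tendsto (fun τ => (((τ - t)⁻¹ : ℝ) : ℂ) • (φ τ - φ t)) (𝓝[≠] t) (𝓝 φ') := by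
    have := hasDerivAt_iff_tendsto_slope.1 hφ
    refine this.congr fun τ => ?_
    rw [slope_def_module]; exact (Complex.coe_smul _ _).symm
  have hqX : ∀ᶠ τ in 𝓝[≠] t, DX ((((τ - t)⁻¹ : ℝ) : ℂ) • (φ τ - φ t)) ∧
      XX ((((τ - t)⁻¹ : ℝ) : ℂ) • (φ τ - φ t)) = (((τ - t)⁻¹ : ℝ) : ℂ) • (XX (φ τ) - XX (φ t)) := by
    filter_upwards [hD'] with τ hτ
    have h1 := XX_sub hτ.1 hDt
    have h2 := XX_smul (((τ - t)⁻¹ : ℝ) : ℂ) h1.1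
    exact ⟨h2.1, by rw [h2.2, h1.2]⟩
  have hw := XX_weak hq (C := L) (by
    filter_upwards [hqX, hD', hne] with τ h1 h2 h3
    refine ⟨h1.1, ?_⟩
    rw [h1.2, norm_smul, Complex.norm_real, Real.norm_eq_abs, abs_inv,
      inv_mul_le_iff₀ (abs_pos.2 (sub_ne_zero.2 h3)), mul_comm]
    exact h2.2) h0 (XX (φ t))
  have h1 := ((Complex.continuous_re.tendsto _).comp hw).const_mul 2
  have h2 : Tendsto (fun τ => (τ - t)⁻¹ * ‖XX (φ τ) - XX (φ t)‖ ^ 2) (𝓝[≠] t) (𝓝 0) := by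
    rw [tendsto_zero_iff_norm_tendsto_zero]
    have hb : Tendsto (fun τ => L ^ 2 * |τ - t|) (𝓝[≠] t) (𝓝 0) := by
      have : Tendsto (fun τ : ℝ => L ^ 2 * |τ - t|) (𝓝 t) (𝓝 (L ^ 2 * |t - t|)) :=
        Continuous.tendsto (by fun_prop) t
      simp at this
      exact this.mono_left nhdsWithin_le_nhds
    refine squeeze_zero' (Eventually.of_forall fun _ => norm_nonneg _) ?_ hb
    filter_upwards [hD', hne] with τ h2 h3
    have h4 : 0 < |τ - t| := abs_pos.2 (sub_ne_zero.2 h3)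
    rw [norm_mul, norm_pow, norm_norm, Real.norm_eq_abs, abs_inv, inv_mul_le_iff₀ h4]
    calc ‖XX (φ τ) - XX (φ t)‖ ^ 2 ≤ (L * |τ - t|) ^ 2 := by gcongr; exact h2.2
      _ = _ := by ring
  have h3 := h1.add h2
  rw [add_zero] at h3
  refine h3.congr' ?_
  filter_upwards [hqX, hne] with τ h1 h3
  simp only [Function.comp]
  rw [h1.2, slope_def_field, inner_smul_right, Complex.re_ofReal_mul]
  have e : XX (φ τ) = XX (φ t) + (XX (φ τ) - XX (φ t)) := by abel
  nth_rewrite 3 [e]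
  rw [norm_add_sq (𝕜 := ℂ)]
  simp only [RCLike.re_to_complex]
  have := sub_ne_zero.2 h3
  field_simp; ring

end NLS
end

noncomputable section
open MeasureTheory Real Filter Topology Set
open scoped ENNReal NNReal FourierTransform SchwartzMap ContDiff
set_option linter.unusedVariables false

namespace NLS

lemma phf_deriv {τ : ℝ} (hτ : τ ≠ 0) (x : ℝ) :
    HasDerivAt (fun τ : ℝ => phf (1 / (4 * τ)) 0 0 x)
      (-(Complex.I * ((x ^ 2 / (4 * τ ^ 2) : ℝ) : ℂ)) * phf (1 / (4 * τ)) 0 0 x) τ := by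
  have h0 : HasDerivAt (fun τ : ℝ => τ⁻¹) (-(τ ^ 2)⁻¹) τ := hasDerivAt_inv hτ
  have h1 : HasDerivAt (fun τ : ℝ => 1 / (4 * τ) * x ^ 2 + 0 * x + 0) (-(x ^ 2 / (4 * τ ^ 2))) τ := by
    have h2 := h0.mul_const (x ^ 2 / 4)
    have e1 : (fun τ : ℝ => 1 / (4 * τ) * x ^ 2 + 0 * x + 0) = fun τ => τ⁻¹ * (x ^ 2 / 4) := by
      ext s; rw [one_div, mul_inv]; ring
    rw [e1]
    refine h2.congr_deriv ?_
    rw [div_eq_mul_inv (x ^ 2) (4 * τ ^ 2), mul_inv]; ring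
  have h3 := (h1.ofReal_comp.const_mul Complex.I).cexp
  have e : ∀ τ : ℝ, phf (1 / (4 * τ)) 0 0 x = Complex.exp (Complex.I * ((1 / (4 * τ) * x ^ 2 + 0 * x + 0 : ℝ) : ℂ)) := by
    intro τ
    simp only [phf]
  simp_rw [e]
  refine h3.congr_deriv ?_
  rw [Complex.ofReal_neg]
  ring

lemma deriv_pair0 {G f : HH} (hG : DX G) (hf : DX f) {t : ℝ} (ht : 0 < t) :
    HasDerivAt (fun τ => inner ℂ G (ph (1 / (4 * τ)) 0 0 f))
      (-(Complex.I * ((1 / (4 * t ^ 2) : ℝ) : ℂ)) * inner ℂ (XX G) (XX (ph (1 / (4 * t)) 0 0 f))) t := by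
  have hin : ∀ τ, inner ℂ G (ph (1 / (4 * τ)) 0 0 f)
      = ∫ x, phf (1 / (4 * τ)) 0 0 x * f x * (starRingEnd ℂ) (G x) := by
    intro τ
    rw [MeasureTheory.L2.inner_def]
    apply integral_congr_ae
    filter_upwards [ph_ae (1 / (4 * τ)) 0 0 f] with x hx
    rw [hx, RCLike.inner_apply]
  simp_rw [hin]
  have hms : ∀ τ, AEStronglyMeasurable
      (fun x => phf (1 / (4 * τ)) 0 0 x * f x * (starRingEnd ℂ) (G x)) volume := fun τ =>
    ((cont_phf _ _ _).aestronglyMeasurable.mul (Lp.aestronglyMeasurable f)).mul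
      (Complex.continuous_conj.comp_aestronglyMeasurable (Lp.aestronglyMeasurable G))
  have hbi : Integrable (fun x => (1 / t ^ 2) * (‖XX f x‖ * ‖XX G x‖)) :=
    ((Lp.memLp (XX f)).norm.integrable_mul (Lp.memLp (XX G)).norm).const_mul _
  have key := hasDerivAt_integral_of_dominated_loc_of_deriv_le (μ := volume) (𝕜 := ℝ)
    (F := fun τ x => phf (1 / (4 * τ)) 0 0 x * f x * (starRingEnd ℂ) (G x)) (x₀ := t)
    (F' := fun τ x => -(Complex.I * ((x ^ 2 / (4 * τ ^ 2) : ℝ) : ℂ)) * phf (1 / (4 * τ)) 0 0 x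
      * f x * (starRingEnd ℂ) (G x))
    (s := Ioi (t / 2)) (bound := fun x => (1 / t ^ 2) * (‖XX f x‖ * ‖XX G x‖))
    (Ioi_mem_nhds (by linarith)) (Eventually.of_forall hms) ?_ ?_ ?_ hbi ?_
  · have e : (-(Complex.I * ((1 / (4 * t ^ 2) : ℝ) : ℂ)) * inner ℂ (XX G) (XX (ph (1 / (4 * t)) 0 0 f)))
        = ∫ x, -(Complex.I * ((x ^ 2 / (4 * t ^ 2) : ℝ) : ℂ)) * phf (1 / (4 * t)) 0 0 x
          * f x * (starRingEnd ℂ) (G x) := ?_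
    · rw [e]; exact key.2
    rw [MeasureTheory.L2.inner_def, ← integral_const_mul]
    apply integral_congr_ae
    filter_upwards [XX_ae hG, XX_ae (XX_ph (1 / (4 * t)) 0 0 hf).1, ph_ae (1 / (4 * t)) 0 0 f]
      with x h1 h2 h3
    rw [h1, h2, h3, RCLike.inner_apply, map_mul, Complex.conj_ofReal]
    push_cast; ring
  · have := MeasureTheory.L2.integrable_inner (𝕜 := ℂ) G (ph (1 / (4 * t)) 0 0 f)
    refine this.congr ?_
    filter_upwards [ph_ae (1 / (4 * t)) 0 0 f] with x hx
    rw [hx, RCLike.inner_apply]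
  · have h1 : Continuous fun x : ℝ => -(Complex.I * ((x ^ 2 / (4 * t ^ 2) : ℝ) : ℂ)) :=
      (continuous_const.mul (Complex.continuous_ofReal.comp (by fun_prop))).neg
    have := h1.aestronglyMeasurable.mul (hms t)
    refine this.congr (Eventually.of_forall fun x => ?_)
    simp only [Pi.mul_apply]; ring
  · filter_upwards [XX_ae hG, XX_ae hf] with x h1 h2 τ hτ
    have hτ : t / 2 < τ := hτ
    rw [h1, h2, norm_mul, norm_mul, norm_mul, norm_mul, norm_mul, norm_neg, norm_mul, norm_phf, Complex.norm_I,
      RCLike.norm_conj, Complex.norm_real, Complex.norm_real, Real.norm_eq_abs, Real.norm_eq_abs,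
      abs_of_nonneg (by positivity)]
    have h3 : x ^ 2 / (4 * τ ^ 2) ≤ 1 / t ^ 2 * x ^ 2 := by
      rw [div_mul_eq_mul_div, one_mul]
      apply div_le_div_of_nonneg_left (by positivity) (by positivity)
      nlinarith
    calc 1 * (x ^ 2 / (4 * τ ^ 2)) * 1 * ‖f x‖ * ‖G x‖ ≤ 1 * (1 / t ^ 2 * x ^ 2) * 1 * ‖f x‖ * ‖G x‖ := by
          gcongr
      _ = _ := by rw [← sq_abs x]; ring
  · refine Eventually.of_forall fun x τ hτ => ?_
    have hτ : t / 2 < τ := hτ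
    have h := (phf_deriv (τ := τ) (by linarith) x)
    exact ((h.mul_const (f x)).mul_const ((starRingEnd ℂ) (G x)))

lemma deriv_pair {G : HH} {φ : ℝ → HH} {φ' : HH} {t : ℝ} (ht : 0 < t) (hG : DX G) (hf : DX (φ t))
    (hφ : HasDerivAt φ φ' t) :
    HasDerivAt (fun τ => (inner ℂ G (ph (1 / (4 * τ)) 0 0 (φ τ))).re)
      ((inner ℂ G (ph (1 / (4 * t)) 0 0 φ')).re +
        (inner ℂ (XX G) (XX (ph (1 / (4 * t)) 0 0 (φ t)))).im / (4 * t ^ 2)) t := by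
  have h1 : HasDerivAt (fun τ => inner ℂ G (ph (1 / (4 * τ)) 0 0 (φ τ - φ t)))
      (inner ℂ G (ph (1 / (4 * t)) 0 0 φ')) t := by
    rw [hasDerivAt_iff_tendsto_slope]
    have hq := hasDerivAt_iff_tendsto_slope.1 hφ
    have h2 : Tendsto (fun τ => ph (1 / (4 * τ)) 0 0 φ') (𝓝[≠] t) (𝓝 (ph (1 / (4 * t)) 0 0 φ')) := by
      refine (ph_continuous φ' (θ := fun τ => 1 / (4 * τ)) (t := t) ?_).mono_left nhdsWithin_le_nhds
      exact ContinuousAt.div continuousAt_const (by fun_prop) (by positivity)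
    have h3 : Tendsto (fun τ => ph (1 / (4 * τ)) 0 0 (slope φ t τ)) (𝓝[≠] t)
        (𝓝 (ph (1 / (4 * t)) 0 0 φ')) := by
      have h4 : Tendsto (fun τ => ph (1 / (4 * τ)) 0 0 (slope φ t τ) - ph (1 / (4 * τ)) 0 0 φ')
          (𝓝[≠] t) (𝓝 0) := by
        rw [tendsto_zero_iff_norm_tendsto_zero]
        refine (tendsto_iff_norm_sub_tendsto_zero.1 hq).congr fun τ => ?_
        rw [← map_sub, LinearIsometry.norm_map]
      simpa using h4.add h2
    have h5 : Tendsto (fun τ => inner ℂ G (ph (1 / (4 * τ)) 0 0 (slope φ t τ))) (𝓝[≠] t)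
        (𝓝 (inner ℂ G (ph (1 / (4 * t)) 0 0 φ'))) := tendsto_const_nhds.inner h3
    refine h5.congr fun τ => ?_
    have hs : ((τ - t)⁻¹ : ℝ) • (φ τ - φ t) = (((τ - t)⁻¹ : ℝ) : ℂ) • (φ τ - φ t) :=
      (Complex.coe_smul _ _).symm
    rw [slope_def_module, slope_def_module, sub_self, map_zero, inner_zero_right, sub_zero,
      hs, map_smul, inner_smul_right, Complex.real_smul]
  have h2 := h1.add (deriv_pair0 hG hf ht)
  have h3 : HasDerivAt (fun τ => inner ℂ G (ph (1 / (4 * τ)) 0 0 (φ τ)))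
      (inner ℂ G (ph (1 / (4 * t)) 0 0 φ') + -(Complex.I * ((1 / (4 * t ^ 2) : ℝ) : ℂ)) *
        inner ℂ (XX G) (XX (ph (1 / (4 * t)) 0 0 (φ t)))) t := by
    refine h2.congr_of_eventuallyEq (Eventually.of_forall fun τ => ?_)
    rw [Pi.add_apply, ← inner_add_right, ← map_add]; simp
  have h4 := Complex.reCLM.hasFDerivAt.comp_hasDerivAt t h3
  refine h4.congr_deriv ?_
  rw [Complex.reCLM_apply, Complex.add_re]
  congr 1
  generalize inner ℂ (XX G) (XX (ph (1 / (4 * t)) 0 0 (φ t))) = z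
  rw [Complex.mul_re, Complex.neg_re, Complex.neg_im, Complex.mul_re, Complex.mul_im, Complex.I_re, Complex.I_im,
    Complex.ofReal_re, Complex.ofReal_im]
  ring

lemma deriv_D {φ : ℝ → HH} {φ' : HH} {t : ℝ} (ht : 0 < t) (hf : DX (φ t))
    (hφ : HasDerivAt φ φ' t) :
    HasDerivAt (fun τ => ‖ph (1 / (4 * τ)) 0 0 (φ τ) - ph (1 / (4 * t)) 0 0 (φ t)‖ ^ 2) 0 t := by
  have h0 := XX_ph (1 / (4 * t)) 0 0 hf
  have h1 := deriv_pair (G := ph (1 / (4 * t)) 0 0 (φ t)) ht h0.1 hf hφ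
  have h2 : HasDerivAt (fun τ => ‖φ τ‖ ^ 2) (2 * inner ℝ (φ t) φ') t := hφ.norm_sq
  have h3 := (h2.sub (h1.const_mul 2)).add_const (‖φ t‖ ^ 2)
  have e0 : (inner ℂ (XX (ph (1 / (4 * t)) 0 0 (φ t))) (XX (ph (1 / (4 * t)) 0 0 (φ t)))).im = 0 := by
    exact inner_self_im (𝕜 := ℂ) (XX (ph (1 / (4 * t)) 0 0 (φ t)))
  have e1 : inner ℝ (φ t) φ' = (inner ℂ (φ t) φ').re := by
    rw [MeasureTheory.L2.inner_def, MeasureTheory.L2.inner_def]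
    have := integral_re (𝕜 := ℂ) (MeasureTheory.L2.integrable_inner (𝕜 := ℂ) (φ t) φ')
    simp only [RCLike.re_to_complex] at this
    rw [← this]; rfl
  rw [e0, LinearIsometry.inner_map_map, e1] at h3
  have e3 : 2 * (inner ℂ (φ t) φ').re - 2 * ((inner ℂ (φ t) φ').re + 0 / (4 * t ^ 2)) = 0 := by ring
  rw [e3] at h3
  refine h3.congr_of_eventuallyEq (Eventually.of_forall fun τ => ?_)
  have hsy := inner_re_symm (𝕜 := ℂ) (ph (1 / (4 * τ)) 0 0 (φ τ)) (ph (1 / (4 * t)) 0 0 (φ t))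
  show ‖ph (1 / (4 * τ)) 0 0 (φ τ) - ph (1 / (4 * t)) 0 0 (φ t)‖ ^ 2 = ‖φ τ‖ ^ 2 - 2 *
    (inner ℂ (ph (1 / (4 * t)) 0 0 (φ t)) (ph (1 / (4 * τ)) 0 0 (φ τ))).re + ‖φ t‖ ^ 2
  rw [norm_sub_sq (𝕜 := ℂ), LinearIsometry.norm_map, LinearIsometry.norm_map, hsy]
  rfl

lemma E_integrable {α m : ℝ} (hα : 0 ≤ α) {V : HH} (h : ∀ᵐ x, ‖V x‖ ≤ m) :
    Integrable fun x => ‖V x‖ ^ (α + 2) := by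
  refine ((HH_integrable_sq V).const_mul (m ^ α)).mono' ?_ ?_
  · exact ((Lp.aestronglyMeasurable V).norm.aemeasurable.pow_const _).aestronglyMeasurable
  · filter_upwards [h] with x hx
    rw [Real.norm_eq_abs, abs_of_nonneg (by positivity)]
    rcases eq_or_lt_of_le (norm_nonneg (V x)) with h0 | h0
    · rw [← h0, Real.zero_rpow (by linarith)]; simp
    rw [Real.rpow_add h0, Real.rpow_two]
    gcongr

lemma E_convex {α m : ℝ} (hα : 1 ≤ α) (hm : 0 ≤ m) {V W : HH} (hV : ∀ᵐ x, ‖V x‖ ≤ m)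
    (hW : ∀ᵐ x, ‖W x‖ ≤ m) :
    (α + 2) * (inner ℂ (FH α m hα hm V) (W - V)).re ≤
      (∫ x, ‖W x‖ ^ (α + 2)) - ∫ x, ‖V x‖ ^ (α + 2) := by
  have hVi := E_integrable (by linarith : 0 ≤ α) hV
  have hWi := E_integrable (by linarith : 0 ≤ α) hW
  have hin := MeasureTheory.L2.integrable_inner (𝕜 := ℂ) (FH α m hα hm V) (W - V)
  have h1 := integral_re (𝕜 := ℂ) hin
  simp only [RCLike.re_to_complex] at h1
  rw [MeasureTheory.L2.inner_def, ← h1, ← integral_sub hWi hVi, ← integral_const_mul]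
  refine integral_mono_ae (hin.re.const_mul _) (hWi.sub hVi) ?_
  filter_upwards [FH_ae hα hm V, Lp.coeFn_sub W V, hV] with x h1 h2 h3
  have := conv_ineq (by linarith : 0 ≤ α) (V x) (W x)
  simp only [Pi.sub_apply, RCLike.inner_apply, RCLike.re_to_complex]
  rw [h1, h2, Fm_eq h3, Pi.sub_apply, mul_comm (W x - V x)]
  have e : (starRingEnd ℂ) (Fn α (V x)) = star (Fn α (V x)) := rfl
  rw [e]; linarith

lemma deriv_E {α m : ℝ} (hα : 1 ≤ α) (hm : 0 ≤ m) {φ : ℝ → HH} {φ' : HH} {t : ℝ} (ht : 0 < t)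
    (hf : DX (φ t)) (hφ : HasDerivAt φ φ' t)
    (hb : ∀ᶠ τ in 𝓝 t, ∀ᵐ x, ‖FT (ph (1 / (4 * τ)) 0 0 (φ τ)) x‖ ≤ m) {G : HH}
    (hGd : G = FT.symm (FH α m hα hm (FT (ph (1 / (4 * t)) 0 0 (φ t))))) (hG : DX G) :
    HasDerivAt (fun τ => ∫ x, ‖FT (ph (1 / (4 * τ)) 0 0 (φ τ)) x‖ ^ (α + 2))
      ((α + 2) * ((inner ℂ G (ph (1 / (4 * t)) 0 0 φ')).re +
        (inner ℂ (XX G) (XX (ph (1 / (4 * t)) 0 0 (φ t)))).im / (4 * t ^ 2))) t := by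
  have hA := (deriv_pair ht hG hf hφ).const_mul (α + 2)
  have hD := deriv_D ht hf hφ
  set W : ℝ → HH := fun τ => ph (1 / (4 * τ)) 0 0 (φ τ) with hW
  set E : ℝ → ℝ := fun τ => ∫ x, ‖FT (W τ) x‖ ^ (α + 2) with hE
  set f : ℝ → ℝ := fun τ => (α + 2) * (inner ℂ G (W τ)).re with hfd
  have hbt := hb.self_of_nhds
  have hFG : ∀ w : HH, inner ℂ (FH α m hα hm (FT (W t))) (FT w) = inner ℂ G w := by
    intro w
    have h := LinearIsometryEquiv.inner_map_map FT (FT.symm (FH α m hα hm (FT (W t)))) w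
    rw [LinearIsometryEquiv.apply_symm_apply] at h
    rw [h, hGd]
  have hR : HasDerivAt (fun τ => E τ - f τ) 0 t := by
    rw [hasDerivAt_iff_isLittleO] at hD ⊢
    simp only [smul_zero, sub_zero, sub_self, norm_zero, ne_eq, OfNat.ofNat_ne_zero, not_false_eq_true, zero_pow] at hD ⊢
    refine Asymptotics.IsBigO.trans_isLittleO (Asymptotics.IsBigO.of_bound
      ((α + 2) * ((α + 1) * m ^ α)) ?_) hD
    filter_upwards [hb] with τ hτ
    have h1 := E_convex hα hm hbt hτ
    have h2 := E_convex hα hm hτ hbt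
    have hl := FH_lip hα hm (FT (W τ)) (FT (W t))
    rw [← map_sub, LinearIsometryEquiv.norm_map] at hl
    have h3 : (inner ℂ (FH α m hα hm (FT (W τ)) - FH α m hα hm (FT (W t))) (FT (W τ) - FT (W t))).re
        ≤ (α + 1) * m ^ α * ‖W τ - W t‖ ^ 2 := by
      refine (Complex.re_le_norm _).trans ((norm_inner_le_norm _ _).trans ?_)
      rw [← map_sub, LinearIsometryEquiv.norm_map, pow_two, ← mul_assoc]
      gcongr
    rw [inner_sub_left, Complex.sub_re] at h3
    have e1 : inner ℂ (FH α m hα hm (FT (W t))) (FT (W τ) - FT (W t)) = inner ℂ G (W τ) - inner ℂ G (W t) := by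
      rw [← map_sub, hFG, inner_sub_right]
    have e2 : inner ℂ (FH α m hα hm (FT (W τ))) (FT (W t) - FT (W τ)) =
       - inner ℂ (FH α m hα hm (FT (W τ))) (FT (W τ) - FT (W t)) := by
      rw [← inner_neg_right, neg_sub]
    simp only [hW] at e1 e2
    simp only [hW] at h1 h2 h3
    rw [e1, Complex.sub_re] at h1 h3
    rw [e2, Complex.neg_re] at h2
    rw [Real.norm_eq_abs, norm_pow, norm_norm]
    simp only [hE, hfd, hW]
    have h4 : (α + 2) * (inner ℂ (FH α m hα hm (FT (ph (1 / (4 * τ)) 0 0 (φ τ))))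
        (FT (ph (1 / (4 * τ)) 0 0 (φ τ)) - FT (ph (1 / (4 * t)) 0 0 (φ t)))).re ≤ (α + 2) * (
         ((inner ℂ G (ph (1 / (4 * τ)) 0 0 (φ τ))).re - (inner ℂ G (ph (1 / (4 * t)) 0 0 (φ t))).re)
         + (α + 1) * m ^ α * ‖ph (1 / (4 * τ)) 0 0 (φ τ) - ph (1 / (4 * t)) 0 0 (φ t)‖ ^ 2) :=
      mul_le_mul_of_nonneg_left (by linarith) (by linarith)
    rw [abs_le]
    have h5 : 0 ≤ (α + 2) * ((α + 1) * m ^ α) * ‖ph (1 / (4 * τ)) 0 0 (φ τ) - ph (1 / (4 * t)) 0 0 (φ t)‖ ^ 2 := by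
      positivity
    constructor <;> linarith
  have := hR.add hA
  rw [zero_add] at this
  refine this.congr_of_eventuallyEq (Eventually.of_forall fun τ => ?_)
  simp [hfd, hW]

end NLS
end

noncomputable section
open MeasureTheory Real Filter Topology Set
open scoped ENNReal NNReal FourierTransform SchwartzMap ContDiff
set_option linter.unusedVariables false

namespace NLS

lemma ode {Y E w : ℝ → ℝ} {δ p C1 t0 : ℝ} (ht0 : 0 < t0) (hδ : 0 < δ) (hp : 0 < p) (hC1 : 0 ≤ C1)
    (hY : ∀ t, 0 < t → 0 ≤ Y t) (hE : ∀ t, 0 ≤ E t)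
    (dY : ∀ t, t0 < t → HasDerivAt Y (-δ * Y t / t + w t) t)
    (dE : ∀ t, t0 < t → HasDerivAt E (w t) t)
    (hw : ∀ t, t0 < t → w t ≤ C1 / t * (E t * Y t) ^ p * Y t)
    {C : ℝ} (h4 : ∀ T, ∃ t, T ≤ t ∧ E t ≤ C) :
    ∃ C' γ t1 : ℝ, 0 < γ ∧ t0 < t1 ∧ 0 ≤ C' ∧ ∀ t, t1 ≤ t → (E t * Y t) ^ p ≤ C' * t ^ (-γ) := by
  have hC : 0 ≤ C := by obtain ⟨t, -, h⟩ := h4 0; exact (hE t).trans h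
  have anti : ∀ {f f' : ℝ → ℝ} {a : ℝ}, t0 < a → (∀ t, t0 < t → HasDerivAt f (f' t) t) →
      (∀ t, a ≤ t → f' t ≤ 0) → AntitoneOn f (Ici a) := by
    intro f f' a hta h1 h2
    apply antitoneOn_of_deriv_nonpos (convex_Ici a)
    · exact fun x hx => (h1 x (lt_of_lt_of_le hta hx)).continuousAt.continuousWithinAt
    · intro x hx; rw [interior_Ici] at hx
      exact (h1 x (hta.trans hx)).differentiableAt.differentiableWithinAt
    · intro x hx; rw [interior_Ici] at hx
      rw [(h1 x (hta.trans hx)).deriv]; exact h2 x (le_of_lt hx)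
  have dN : ∀ t, t0 < t → HasDerivAt (fun t => Y t - E t) (-δ * Y t / t) t := by
    intro t ht
    exact ((dY t ht).sub (dE t ht)).congr_deriv (by ring)
  have hN : ∀ a, t0 < a → AntitoneOn (fun t => Y t - E t) (Ici a) := by
    intro a ha
    refine anti ha dN fun t ht => ?_
    have h0 : 0 < t := by linarith
    have := hY t h0
    rw [neg_mul, neg_div, neg_nonpos]; positivity
  have hNl : ∀ t, t0 < t → -C ≤ Y t - E t := by
    intro t ht
    obtain ⟨t', h1, h2⟩ := h4 t
    have := hN t ht (mem_Ici.2 le_rfl) (mem_Ici.2 h1) h1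
    have := hY t' (by linarith)
    simp only at *; linarith
  -- epsilon
  set q := (δ / (2 * (C1 + 1))) ^ (1 / p) with hq
  have hqpos : 0 < q := by positivity
  set ε := min 1 (q / (1 + C)) with hε
  have hεpos : 0 < ε := by positivity
  have hε1 : ε ≤ 1 := min_le_left _ _
  have key : ∀ t, t0 < t → Y t ≤ ε → C1 * (E t * Y t) ^ p ≤ δ / 2 := by
    intro t ht h
    have hYt := hY t (by linarith)
    have h1 : E t ≤ 1 + C := by have := hNl t ht; linarith
    have h2 : E t * Y t ≤ q := by
      calc E t * Y t ≤ (1 + C) * (q / (1 + C)) := by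
            apply mul_le_mul h1 (h.trans (min_le_right _ _)) hYt (by positivity)
        _ = q := by field_simp
    have h3 : (E t * Y t) ^ p ≤ δ / (2 * (C1 + 1)) := by
      calc (E t * Y t) ^ p ≤ q ^ p := Real.rpow_le_rpow (mul_nonneg (hE t) hYt) h2 hp.le
        _ = _ := by rw [hq, ← Real.rpow_mul (by positivity), one_div_mul_cancel hp.ne', Real.rpow_one]
    calc C1 * (E t * Y t) ^ p ≤ C1 * (δ / (2 * (C1 + 1))) := by gcongr
      _ ≤ (C1 + 1) * (δ / (2 * (C1 + 1))) := by gcongr; linarith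
      _ = δ / 2 := by field_simp
  -- there is a time with small Y
  obtain ⟨t1, ht1, hYt1⟩ : ∃ t1, t0 + 1 ≤ t1 ∧ Y t1 < ε := by
    by_contra! hcon
    have h1 : AntitoneOn (fun t => Y t - E t + δ * ε * Real.log t) (Ici (t0 + 1)) := by
      refine anti (f' := fun t => -δ * Y t / t + δ * ε * t⁻¹) (by linarith) (fun t ht =>
        (dN t ht).add ((Real.hasDerivAt_log (by linarith)).const_mul _)) fun t ht => ?_
      have h0 : 0 < t := by linarith
      have h2 := hcon t ht
      rw [div_eq_mul_inv, ← add_mul]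
      apply mul_nonpos_of_nonpos_of_nonneg _ (by positivity)
      nlinarith
    obtain ⟨t, ht, hlt⟩ := ((tendsto_atTop.1 Real.tendsto_log_atTop
      ((Y (t0+1) - E (t0+1) + δ * ε * Real.log (t0+1) + C + 1) / (δ * ε))).and
        (eventually_ge_atTop (t0+1))).exists
    have h2 := h1 (mem_Ici.2 le_rfl) (mem_Ici.2 hlt) hlt
    have h3 := hNl t (by linarith)
    rw [div_le_iff₀ (by positivity)] at ht
    simp only at h2
    linarith
  have hYε : ∀ t, t1 ≤ t → Y t ≤ ε := by
    intro t ht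
    refine image_le_of_deriv_right_lt_deriv_boundary' (f := Y) (f' := fun t => -δ * Y t / t + w t) (a := t1) (b := t)
      (B := fun _ => ε) (B' := fun _ => 0) ?_ ?_ hYt1.le continuousOn_const
      (fun x hx => hasDerivWithinAt_const _ _ _) ?_ (right_mem_Icc.2 ht)
    · exact fun x hx => (dY x (by linarith [hx.1])).continuousAt.continuousWithinAt
    · exact fun x hx => (dY x (by linarith [hx.1])).hasDerivWithinAt
    · intro x hx hxe
      have hx0 : t0 < x := by linarith [hx.1]
      have hx0' : 0 < x := by linarith
      have h1 := key x hx0 hxe.le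
      have h2 := hw x hx0
      rw [hxe] at h2
      rw [hxe] at h1 ⊢
      have h3 : C1 / x * (E x * ε) ^ p * ε ≤ (δ / 2) / x * ε := by
        rw [div_mul_eq_mul_div]; gcongr
      have h4 : 0 < δ / 2 / x * ε := by positivity
      have h5 : -δ * ε / x = - 2 * (δ / 2 / x * ε) := by ring
      linarith
  set β := δ / 2 with hβ
  have hanti : AntitoneOn (fun t => t ^ β * Y t) (Ici t1) := by
    refine anti (f' := fun t => β * t ^ (β - 1) * Y t + t ^ β * (-δ * Y t / t + w t)) (by linarith) (fun t ht =>
        (Real.hasDerivAt_rpow_const (Or.inl (by linarith))).mul (dY t ht)) fun t ht => ?_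
    have h0 : 0 < t := by linarith
    have h1 := key t (by linarith) (hYε t ht)
    have h2 := hw t (by linarith)
    have hYt := hY t h0
    have h3 : C1 / t * (E t * Y t) ^ p * Y t ≤ β / t * Y t := by
      rw [div_mul_eq_mul_div]; gcongr
    have h4 : β * t ^ (β - 1) * Y t = t ^ β * (β / t * Y t) := by
      rw [Real.rpow_sub_one h0.ne']; ring
    rw [h4, ← mul_add]
    apply mul_nonpos_of_nonneg_of_nonpos (by positivity)
    have h5 : -δ * Y t / t = - 2 * (β / t * Y t) := by rw [hβ]; ring
    linarith
  set A := t1 ^ β * Y t1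
  have ht1p : 0 < t1 := by linarith
  have hA : 0 ≤ A := mul_nonneg (by positivity) (hY t1 ht1p)
  refine ⟨((1 + C) * A) ^ p, β * p, t1, by positivity, by linarith, by positivity, fun t ht => ?_⟩
  have h0 : 0 < t := by linarith
  have h1 : t ^ β * Y t ≤ A := hanti (mem_Ici.2 le_rfl) (mem_Ici.2 ht) ht
  have h2 : Y t ≤ A * t ^ (-β) := by
    rw [Real.rpow_neg h0.le, ← div_eq_mul_inv, le_div_iff₀ (by positivity), mul_comm]; exact h1
  have h3 : E t ≤ 1 + C := by have := hNl t (by linarith); have := hYε t ht; linarith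
  calc (E t * Y t) ^ p ≤ ((1 + C) * (A * t ^ (-β))) ^ p :=
        Real.rpow_le_rpow (mul_nonneg (hE t) (hY t h0))
          (mul_le_mul h3 h2 (hY t h0) (by positivity)) hp.le
    _ = _ := by
      rw [← mul_assoc, Real.mul_rpow (by positivity) (by positivity), ← Real.rpow_mul h0.le, neg_mul]

structure Flow (α lam : ℝ) (φ : ℝ → HH) : Prop where
  hα : 1 ≤ α
  hl : 0 < lam
  bdd : ∀ δ T, 0 < δ → ∃ m, 0 ≤ m ∧ ∀ t ∈ Icc δ T, ∀ᵐ x, ‖UU t (φ t) x‖ ≤ m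
  der : ∀ t, 0 < t → ∀ m (hm : 0 ≤ m), (∀ᵐ x, ‖UU t (φ t) x‖ ≤ m) →
    HasDerivAt φ ((Complex.I * (lam : ℂ)) • UU (-t) (FH α m hα hm (UU t (φ t)))) t

def Good (S : HH →L[ℂ] HH) : Prop := ∀ (α m : ℝ) (hα : 1 ≤ α) (hm : 0 ≤ m) (t : ℝ) (u : HH),
  ‖S (UU (-t) (FH α m hα hm u))‖ ≤ (α + 1) * m ^ α * ‖S (UU (-t) u)‖

def Sph (h : ℝ) : HH →L[ℂ] HH := (ph 0 h 0).toContinuousLinearMap - ContinuousLinearMap.id ℂ HH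
def Str (h : ℝ) : HH →L[ℂ] HH := (tr h).toContinuousLinearMap - ContinuousLinearMap.id ℂ HH

lemma Sph_apply (h : ℝ) (f : HH) : Sph h f = ph 0 h 0 f - f := rfl
lemma Str_apply (h : ℝ) (f : HH) : Str h f = tr h f - f := rfl

lemma good_id : Good (ContinuousLinearMap.id ℂ HH) := by
  intro α m hα hm t u
  simp only [ContinuousLinearMap.coe_id', id]
  rw [LinearIsometry.norm_map, LinearIsometry.norm_map]
  refine (FH_norm hα hm u).trans ?_
  gcongr
  have : 0 ≤ m ^ α := by positivity
  nlinarith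

lemma good_ph (h : ℝ) : Good (Sph h) := by
  intro α m hα hm t u
  have := Sg_ph hα hm t (h / (2 * π)) u
  rwa [mul_div_cancel₀ _ (by positivity : (2 * π) ≠ 0)] at this

lemma good_tr (h : ℝ) : Good (Str h) := by
  intro α m hα hm t u
  exact Sg_tr hα hm t h u

variable {α lam : ℝ} {φ : ℝ → HH}

lemma Flow.evol (F : Flow α lam φ) {S : HH →L[ℂ] HH} (hS : Good S) {k a : ℝ → ℝ} {s T A : ℝ} (hs : 0 < s)
    (ha : ∀ t ∈ Icc s T, HasDerivAt a (k t) t) (hA : ∀ t ∈ Icc s T, a t ≤ A)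
    (hk : ∀ t ∈ Icc s T, ∃ m, 0 ≤ m ∧ (∀ᵐ x, ‖UU t (φ t) x‖ ≤ m) ∧ lam * ((α + 1) * m ^ α) ≤ k t) :
    (∀ t ∈ Icc s T, ‖S (φ t)‖ ≤ ‖S (φ s)‖ * Real.exp (A - a s)) ∧
    (∀ t' ∈ Icc s T, ∀ t ∈ Icc t' T, ‖S (φ t) - S (φ t')‖ ≤ ‖S (φ s)‖ * Real.exp (A - a s) * (a t - a t')) := by
  have hl := F.hl
  have h : ∀ t, ∃ d : HH, t ∈ Icc s T → HasDerivAt (fun t => S (φ t)) d t ∧ ‖d‖ ≤ k t * ‖S (φ t)‖ := by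
    intro t
    by_cases ht : t ∈ Icc s T
    · obtain ⟨m, hm, hb, hmk⟩ := hk t ht
      have hd := F.der t (lt_of_lt_of_le hs ht.1) m hm hb
      refine ⟨_, fun _ => ⟨(S.hasFDerivAt.restrictScalars ℝ).comp_hasDerivAt t hd, ?_⟩⟩
      have hg := hS α m F.hα hm t (UU t (φ t))
      rw [UU_neg] at hg
      simp only [ContinuousLinearMap.coe_restrictScalars', map_smul, norm_smul, norm_mul, Complex.norm_I,
        one_mul, Complex.norm_real, Real.norm_eq_abs, abs_of_pos hl]
      calc _ ≤ lam * ((α + 1) * m ^ α * ‖S (φ t)‖) := by gcongr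
        _ = lam * ((α + 1) * m ^ α) * ‖S (φ t)‖ := by ring
        _ ≤ _ := by gcongr
    · exact ⟨0, fun h => absurd h ht⟩
  choose d hd using h
  have h1 : ∀ t ∈ Icc s T, ‖S (φ t)‖ ≤ ‖S (φ s)‖ * Real.exp (A - a s) := by
    intro t ht
    refine (gron (fun t ht => (hd t ht).1) ha (fun t ht => (hd t ht).2) ht).trans ?_
    gcongr; exact hA t ht
  refine ⟨h1, fun t' ht' t ht => ?_⟩
  have hsub : ∀ x ∈ Icc t' T, x ∈ Icc s T := fun x hx => ⟨ht'.1.trans hx.1, hx.2⟩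
  set B := ‖S (φ s)‖ * Real.exp (A - a s)
  have := mvt (f := fun t => S (φ t)) (k := fun t => B * k t) (a := fun t => B * a t) (fun x hx => (hd x (hsub x hx)).1)
    (fun x hx => (ha x (hsub x hx)).const_mul B) (fun x hx => ?_) ht
  · rw [mul_sub]; exact this
  · obtain ⟨m, hm, -, hmk⟩ := hk x (hsub x hx)
    have h0 : 0 ≤ k x := le_trans (by have := F.hα; positivity) hmk
    calc _ ≤ k x * ‖S (φ x)‖ := (hd x (hsub x hx)).2
      _ ≤ k x * B := by gcongr; exact h1 x (hsub x hx)
      _ = _ := mul_comm _ _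

/-- constant bound version -/
lemma Flow.evol_const (F : Flow α lam φ) {s T : ℝ} (hs : 0 < s) (hsT : s ≤ T) : ∃ L B, 0 ≤ L ∧ 0 ≤ B ∧
    ∀ S : HH →L[ℂ] HH, Good S → (∀ t ∈ Icc s T, ‖S (φ t)‖ ≤ B * ‖S (φ s)‖) ∧
    ∀ t' ∈ Icc s T, ∀ t ∈ Icc s T, ‖S (φ t) - S (φ t')‖ ≤ ‖S (φ s)‖ * L * |t - t'| := by
  obtain ⟨m, hm, hb⟩ := F.bdd s T hs
  have hα := F.hα
  have hl := F.hl
  set M := lam * ((α + 1) * m ^ α) with hM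
  have hM0 : 0 ≤ M := by positivity
  refine ⟨Real.exp (M * T - M * s) * M, Real.exp (M * T - M * s), by positivity, by positivity, fun S hS => ?_⟩
  have h := F.evol hS (k := fun _ => M) (a := fun t => M * t) (A := M * T) hs
    (fun t ht => by simpa using (hasDerivAt_id t).const_mul M)
    (fun t ht => by have := ht.2; gcongr) (fun t ht => ⟨m, hm, hb t ht, le_rfl⟩)
  have h2 : ∀ t' ∈ Icc s T, ∀ t ∈ Icc t' T, ‖S (φ t) - S (φ t')‖ ≤
      ‖S (φ s)‖ * (Real.exp (M * T - M * s) * M) * |t - t'| := by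
    intro t' ht' t ht
    refine (h.2 t' ht' t ht).trans (le_of_eq ?_)
    rw [abs_of_nonneg (by linarith [ht.1])]; ring
  refine ⟨fun t ht => (h.1 t ht).trans (le_of_eq (mul_comm _ _)), fun t' ht' t ht => ?_⟩
  rcases le_total t' t with hle | hle
  · exact h2 t' ht' t ⟨hle, ht.2⟩
  · rw [norm_sub_rev, abs_sub_comm]; exact h2 t ht t' ⟨hle, ht'.2⟩

lemma Flow.DX_all (F : Flow α lam φ) {s : ℝ} (hs : 0 < s) (h0 : DX (φ s)) {t : ℝ} (ht : s ≤ t) : DX (φ t) := by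
  obtain ⟨L, B, hL, hB, h⟩ := F.evol_const hs ht
  refine (DX_of_S (C := B * ‖XX (φ s)‖) fun k => ?_).1
  have := (h _ (good_ph k)).1 t (right_mem_Icc.2 ht)
  rw [Sph_apply, Sph_apply] at this
  calc _ ≤ _ := this
    _ ≤ B * (|k| * ‖XX (φ s)‖) := by gcongr; exact S_le h0 k
    _ = _ := by ring

lemma Flow.XX_lip (F : Flow α lam φ) {s T : ℝ} (hs : 0 < s) (hsT : s ≤ T) (h0 : DX (φ s)) : ∃ L, 
    ∀ t' ∈ Icc s T, ∀ t ∈ Icc s T, ‖XX (φ t) - XX (φ t')‖ ≤ L * |t - t'| := by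
  obtain ⟨L, B, hL, hB, h⟩ := F.evol_const hs hsT
  refine ⟨‖XX (φ s)‖ * L, fun t' ht' t ht => ?_⟩
  have h1 := XX_sub (F.DX_all hs h0 ht.1) (F.DX_all hs h0 ht'.1)
  rw [← h1.2]
  refine (DX_of_S fun k => ?_).2
  have := (h _ (good_ph k)).2 t' ht' t ht
  rw [← map_sub, Sph_apply, Sph_apply] at this
  calc _ ≤ _ := this
    _ ≤ (|k| * ‖XX (φ s)‖) * L * |t - t'| := by gcongr; exact S_le h0 k
    _ = _ := by ring

lemma DX_g {m : ℝ} (hα : 1 ≤ α) (hm : 0 ≤ m) (t : ℝ) {f : HH} (h0 : DX f) :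
    DX (UU (-t) (FH α m hα hm (UU t f))) ∧
      ‖XX (UU (-t) (FH α m hα hm (UU t f)))‖ ≤ (α + 1) * m ^ α * ‖XX f‖ := by
  refine DX_of_S fun k => ?_
  have := good_ph k α m hα hm t (UU t f)
  rw [UU_neg, Sph_apply, Sph_apply] at this
  calc _ ≤ _ := this
    _ ≤ (α + 1) * m ^ α * (|k| * ‖XX f‖) := by gcongr; exact S_le h0 k
    _ = _ := by ring

end NLS
end

noncomputable section
open MeasureTheory Real Filter Topology Set
open scoped ENNReal NNReal FourierTransform SchwartzMap ContDiff
set_option linter.unusedVariables false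

namespace NLS

variable {α lam : ℝ} {φ : ℝ → HH}

def EE (α : ℝ) (φ : ℝ → HH) (τ : ℝ) : ℝ := ∫ x, ‖FT (ph (1 / (4 * τ)) 0 0 (φ τ)) x‖ ^ (α + 2)

lemma re_aux (lam c : ℝ) (z : ℂ) : ((Complex.I * (lam : ℂ)) * ((c : ℂ) * z)).re = - (lam * c * z.im) := by
  simp [Complex.mul_re, Complex.mul_im]; ring

lemma Flow.derivs (F : Flow α lam φ) {s t : ℝ} (hs : 0 < s) (h0 : DX (φ s)) (ht : s < t) : ∃ z : ℝ,
    HasDerivAt (fun τ => ‖XX (φ τ)‖ ^ 2) (2 * lam * (4 * π * t) ^ (-α / 2) * z) t ∧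
    HasDerivAt (EE α φ) ((α + 2) * z / (4 * t ^ 2)) t ∧
    ∀ m, 0 ≤ m → (∀ᵐ x, ‖UU t (φ t) x‖ ≤ m) →
      2 * lam * (4 * π * t) ^ (-α / 2) * z ≤ 2 * lam * ((α + 1) * m ^ α) * ‖XX (φ t)‖ ^ 2 := by
  have hα := F.hα
  have hl := F.hl
  have htp : 0 < t := hs.trans ht
  have hDt := F.DX_all hs h0 ht.le
  obtain ⟨m, hm, hb⟩ := F.bdd s (2 * t) hs
  have htI : t ∈ Icc s (2 * t) := ⟨ht.le, by linarith⟩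
  have hnb : Icc s (2 * t) ∈ 𝓝 t := Icc_mem_nhds ht (by linarith)
  have hd := F.der t htp m hm (hb t htI)
  obtain ⟨L, hL⟩ := F.XX_lip hs (by linarith : s ≤ 2 * t) h0
  have hg := DX_g hα hm t hDt
  set g := UU (-t) (FH α m hα hm (UU t (φ t))) with hgd
  have hig := XX_smul (Complex.I * (lam : ℂ)) hg.1
  have hK := deriv_K (L := L) hd (by
    filter_upwards [hnb] with τ hτ
    exact ⟨F.DX_all hs h0 hτ.1, hL t htI τ hτ⟩) hig.1
  -- E
  set M := m * √(4 * π * (2 * t)) with hM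
  have hM0 : 0 ≤ M := by positivity
  have hm' : 0 ≤ m * √(4 * π * t) := by positivity
  have hVb : ∀ τ ∈ Icc s (2 * t), ∀ᵐ x, ‖FT (ph (1 / (4 * τ)) 0 0 (φ τ)) x‖ ≤ M := by
    intro τ hτ
    filter_upwards [V_bdd (lt_of_lt_of_le hs hτ.1) (hb τ hτ)] with x hx
    refine hx.trans ?_
    have := hτ.2
    rw [hM]; gcongr
  set c : ℝ := (4 * π * t) ^ (-α / 2) with hc
  have hcpos : 0 < c := by positivity
  set G := FT.symm (FH α M hα hM0 (FT (ph (1 / (4 * t)) 0 0 (φ t)))) with hG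
  have hgeq : ph (1 / (4 * t)) 0 0 g = (c : ℂ) • G := by
    rw [hgd, g_eq hα hm htp (φ t) hm', hG,
      FH_indep hα hm' hM0 (V_bdd htp (hb t htI)) (hVb t htI)]
  have hXg := XX_ph (1 / (4 * t)) 0 0 hg.1
  have hGD : DX G := by
    have : G = ((c : ℂ)⁻¹) • ph (1 / (4 * t)) 0 0 g := by
      rw [hgeq, smul_smul, inv_mul_cancel₀ (by exact_mod_cast hcpos.ne'), one_smul]
    rw [this]; exact (XX_smul _ hXg.1).1
  have hE := deriv_E hα hM0 htp hDt hd (by filter_upwards [hnb] with τ hτ using hVb τ hτ) hG hGD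
  set z := (inner ℂ (XX G) (XX (ph (1 / (4 * t)) 0 0 (φ t)))).im with hz
  have hXGg : XX (ph (1 / (4 * t)) 0 0 g) = (c : ℂ) • XX G := by rw [hgeq, (XX_smul _ hGD).2]
  have eK : 2 * (inner ℂ (XX (φ t)) (XX ((Complex.I * (lam : ℂ)) • g))).re = 2 * lam * c * z := by
    rw [hig.2, inner_smul_right, ← LinearIsometry.inner_map_map (ph (1 / (4 * t)) 0 0) (XX (φ t)),
      ← (XX_ph (1 / (4 * t)) 0 0 hDt).2, ← hXg.2, hXGg, inner_smul_right, re_aux, hz,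
      ← inner_conj_symm, Complex.conj_im]
    ring
  have eE : (inner ℂ G (ph (1 / (4 * t)) 0 0 ((Complex.I * (lam : ℂ)) • g))).re = 0 := by
    rw [map_smul, hgeq, inner_smul_right, inner_smul_right, re_aux]
    have : (inner ℂ G G).im = 0 := inner_self_im (𝕜 := ℂ) G
    rw [this]; simp
  rw [eK] at hK
  rw [eE, zero_add] at hE
  refine ⟨z, hK, hE.congr_deriv (by ring), fun m1 hm1 hb1 => ?_⟩
  have hg1 := (DX_g hα hm1 t hDt).2
  rw [FH_indep hα hm1 hm hb1 (hb t htI)] at hg1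
  rw [← eK, hig.2]
  have h1 : (inner ℂ (XX (φ t)) ((Complex.I * (lam : ℂ)) • XX g)).re ≤
      ‖XX (φ t)‖ * (lam * ((α + 1) * m1 ^ α * ‖XX (φ t)‖)) := by
    refine (Complex.re_le_norm _).trans ((norm_inner_le_norm _ _).trans ?_)
    rw [norm_smul, norm_mul, Complex.norm_I, one_mul, Complex.norm_real, Real.norm_eq_abs, abs_of_pos hl]
    gcongr
  calc _ ≤ 2 * (‖XX (φ t)‖ * (lam * ((α + 1) * m1 ^ α * ‖XX (φ t)‖))) := by gcongr
    _ = _ := by ring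

lemma Flow.mbound (F : Flow α lam φ) (hα2 : α ^ 2 = α + 4) {t : ℝ} (htp : 0 < t) (hDt : DX (φ t)) :
    ∃ m, 0 ≤ m ∧ (∀ᵐ x, ‖UU t (φ t) x‖ ≤ m) ∧ m ^ α = (4 * π) ^ (-α / 2) * (16 * π ^ 2 * 2 ^ (α + 2)) ^ (1 / α) / t *
      (EE α φ t * (t ^ (α / 2 - 2) * ‖XX (φ t)‖ ^ 2)) ^ (1 / α) := by
  have hα := F.hα
  obtain ⟨m0, hm0, hb0⟩ := F.bdd t t htp
  have hV := V_bdd htp (hb0 t ⟨le_rfl, le_rfl⟩)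
  have hX := XX_ph (1 / (4 * t)) 0 0 hDt
  have hGN := GN hX.1 (r := α + 2) (by linarith) (E_integrable (by linarith) hV)
  rw [hX.2, LinearIsometry.norm_map] at hGN
  set c := 16 * π ^ 2 * 2 ^ (α + 2) with hc
  have hE0 : 0 ≤ EE α φ t := integral_nonneg fun x => by positivity
  set K := ‖XX (φ t)‖ ^ 2 with hK
  have hK0 : 0 ≤ K := by positivity
  have hGN' : ∀ᵐ x, ‖FT (ph (1 / (4 * t)) 0 0 (φ t)) x‖ ≤ (c * EE α φ t * K) ^ (1 / α ^ 2) := by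
    filter_upwards [hGN] with x hx
    have e : α + 2 + 2 = α ^ 2 := by rw [hα2]; ring
    rw [e] at hx
    have := Real.rpow_le_rpow (by positivity) hx (by positivity : 0 ≤ 1 / α ^ 2)
    rwa [← Real.rpow_mul (norm_nonneg _), mul_one_div_cancel (by positivity), Real.rpow_one] at this
  refine ⟨_, by positivity, u_bdd htp hGN', ?_⟩
  have hpi : 0 < 4 * π := by positivity
  rw [Real.mul_rpow (by positivity) (by positivity), ← Real.rpow_mul (by positivity), Real.sqrt_eq_rpow,
    ← Real.rpow_mul (by positivity), Real.inv_rpow (by positivity), ← Real.rpow_neg (by positivity),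
    Real.mul_rpow hpi.le htp.le]
  have e1 : 1 / α ^ 2 * α = 1 / α := by field_simp
  rw [e1, mul_assoc c, Real.mul_rpow (x := c) (by positivity) (by positivity)]
  have e2 : EE α φ t * (t ^ (α / 2 - 2) * K) = t ^ (α / 2 - 2) * (EE α φ t * K) := by ring
  rw [e2, Real.mul_rpow (x := t ^ (α / 2 - 2)) (y := EE α φ t * K) (by positivity) (by positivity), ← Real.rpow_mul htp.le]
  have e3 : t ^ (-(1 / 2 * α)) = t ^ (-1 : ℝ) * t ^ ((α / 2 - 2) * (1 / α)) := by
    rw [← Real.rpow_add htp]; congr 1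
    field_simp; nlinarith
  rw [e3, Real.rpow_neg_one]
  have e4 : -(1 / 2 * α) = -α / 2 := by ring
  rw [e4]; ring

lemma Flow.decay (F : Flow α lam φ) (hα2 : α ^ 2 = α + 4) {s : ℝ} (hs : 0 < s) (h0 : DX (φ s))
    {C : ℝ} (h4 : ∀ T, ∃ t, T ≤ t ∧ EE α φ t ≤ C) :
    ∃ C' γ t1 : ℝ, 0 < γ ∧ s < t1 ∧ 0 ≤ C' ∧ ∀ t, t1 ≤ t → 
      ∃ m, 0 ≤ m ∧ (∀ᵐ x, ‖UU t (φ t) x‖ ≤ m) ∧ lam * ((α + 1) * m ^ α) ≤ C' * t ^ (-γ - 1) := by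
  have hα := F.hα
  have hl := F.hl
  have hα4 : α < 4 := by nlinarith
  set κ := 8 * lam * (4 * π) ^ (-α / 2) / (α + 2) with hκ
  have hκ0 : 0 < κ := by positivity
  set c0 := (4 * π) ^ (-α / 2) * (16 * π ^ 2 * 2 ^ (α + 2)) ^ (1 / α) with hc0
  have hc00 : 0 < c0 := by positivity
  have H : ∀ t, ∃ z : ℝ, s < t → (HasDerivAt (fun τ => ‖XX (φ τ)‖ ^ 2) (2 * lam * (4 * π * t) ^ (-α / 2) * z) t ∧
    HasDerivAt (EE α φ) ((α + 2) * z / (4 * t ^ 2)) t ∧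
    ∀ m, 0 ≤ m → (∀ᵐ x, ‖UU t (φ t) x‖ ≤ m) →
      2 * lam * (4 * π * t) ^ (-α / 2) * z ≤ 2 * lam * ((α + 1) * m ^ α) * ‖XX (φ t)‖ ^ 2) := by
    intro t
    by_cases ht : s < t
    · obtain ⟨z, hz⟩ := F.derivs hs h0 ht
      exact ⟨z, fun _ => hz⟩
    · exact ⟨0, fun h => absurd h ht⟩
  choose z hz using H
  set Y : ℝ → ℝ := fun t => t ^ (α / 2 - 2) * ‖XX (φ t)‖ ^ 2 with hY
  have hE0 : ∀ t, 0 ≤ EE α φ t := fun t => integral_nonneg fun x => by positivity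
  have hpow : ∀ t, s < t → t ^ (α / 2 - 2) * (4 * π * t) ^ (-α / 2) = (4 * π) ^ (-α / 2) / t ^ 2 := by
    intro t ht
    have htp : 0 < t := hs.trans ht
    rw [Real.mul_rpow (by positivity) htp.le, ← mul_assoc, mul_comm (t ^ (α / 2 - 2)), mul_assoc, ← Real.rpow_add htp]
    have : α / 2 - 2 + -α / 2 = -(2 : ℕ) := by push_cast; ring
    rw [this, Real.rpow_neg htp.le, Real.rpow_natCast]; rfl
  have hode := ode (Y := Y) (E := fun t => κ * EE α φ t)
    (w := fun t => t ^ (α / 2 - 2) * (2 * lam * (4 * π * t) ^ (-α / 2) * z t)) (δ := 2 - α / 2) (p := 1 / α)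
    (C1 := 2 * lam * (α + 1) * (c0 * (1 / κ) ^ (1 / α))) (C := κ * C) hs (by linarith) (by positivity) (by positivity)
    (fun t ht => by positivity) (fun t => mul_nonneg hκ0.le (hE0 t)) ?_ ?_ ?_ ?_
  · obtain ⟨C', γ, t1, hγ, ht1, hC', hdec⟩ := hode
    refine ⟨lam * (α + 1) * (c0 * (1 / κ) ^ (1 / α)) * C', γ, t1, hγ, ht1, by positivity, fun t ht => ?_⟩
    have hst : s < t := by linarith
    have htp : 0 < t := by linarith
    obtain ⟨m, hm, hb, he⟩ := F.mbound hα2 htp (F.DX_all hs h0 hst.le)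
    refine ⟨m, hm, hb, ?_⟩
    have h1 := hdec t ht
    have e : EE α φ t * Y t = 1 / κ * (κ * EE α φ t * Y t) := by field_simp
    rw [he]
    change lam * ((α + 1) * (c0 / t * (EE α φ t * Y t) ^ (1 / α))) ≤ _
    have hYt : 0 ≤ Y t := by positivity
    rw [e, Real.mul_rpow (by positivity) (mul_nonneg (mul_nonneg hκ0.le (hE0 t)) hYt), Real.rpow_sub_one htp.ne']
    calc _ = lam * (α + 1) * (c0 * (1 / κ) ^ (1 / α)) / t * (κ * EE α φ t * Y t) ^ (1 / α) := by ring
      _ ≤ lam * (α + 1) * (c0 * (1 / κ) ^ (1 / α)) / t * (C' * t ^ (-γ)) := by gcongr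
      _ = _ := by ring
  · intro t ht
    have htp : 0 < t := by linarith
    have h1 : HasDerivAt (fun t : ℝ => t ^ (α / 2 - 2)) ((α / 2 - 2) * t ^ (α / 2 - 2 - 1)) t :=
      Real.hasDerivAt_rpow_const (Or.inl htp.ne')
    refine (h1.mul (hz t ht).1).congr_deriv ?_
    rw [Real.rpow_sub_one htp.ne']
    simp only [hY]; ring
  · intro t ht
    refine ((hz t ht).2.1.const_mul κ).congr_deriv ?_
    have htp : 0 < t := by linarith
    calc _ = 2 * lam * ((4 * π) ^ (-α / 2) / t ^ 2) * z t := by rw [hκ]; field_simp; ring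
      _ = _ := by rw [← hpow t ht]; ring
  · intro t ht
    have htp : 0 < t := by linarith
    obtain ⟨m, hm, hb, he⟩ := F.mbound hα2 htp (F.DX_all hs h0 ht.le)
    have h1 := (hz t ht).2.2 m hm hb
    have e : EE α φ t * Y t = 1 / κ * (κ * EE α φ t * Y t) := by field_simp
    have hYt : 0 ≤ Y t := by positivity
    have he' : m ^ α = c0 / t * ((1 / κ) ^ (1 / α) * (κ * EE α φ t * Y t) ^ (1 / α)) := by
      rw [he, ← Real.mul_rpow (by positivity) (mul_nonneg (mul_nonneg hκ0.le (hE0 t)) hYt), ← e]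
    calc _ ≤ t ^ (α / 2 - 2) * (2 * lam * ((α + 1) * m ^ α) * ‖XX (φ t)‖ ^ 2) := by gcongr
      _ = 2 * lam * (α + 1) * m ^ α * Y t := by simp only [hY]; ring
      _ = _ := by rw [he']; ring
  · intro T
    obtain ⟨t, h1, h2⟩ := h4 T
    exact ⟨t, h1, by gcongr⟩

/-- Core theorem -/
theorem Flow.core (F : Flow α lam φ) (hα2 : α ^ 2 = α + 4) {s C0 : ℝ} (hs : 0 < s)
    (h3 : ∀ h, ‖Sph h (φ s)‖ ≤ C0 * |h|) (h3' : ∀ h, ‖Str h (φ s)‖ ≤ C0 * |h|)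
    {C : ℝ} (h4 : ∀ T, ∃ t, T ≤ t ∧ EE α φ t ≤ C) :
    ∃ φp : HH, ∃ D γ t1 : ℝ, 0 < γ ∧ 0 < t1 ∧ ∀ t, t1 ≤ t →
      ‖φ t - φp‖ ≤ D * t ^ (-γ) ∧ (∀ h, ‖Sph h (φ t - φp)‖ ≤ D * t ^ (-γ) * |h|) ∧
        (∀ h, ‖Str h (φ t - φp)‖ ≤ D * t ^ (-γ) * |h|) ∧ 
        (∀ h, ‖Sph h (φ t)‖ ≤ D * |h|) ∧ (∀ h, ‖Str h (φ t)‖ ≤ D * |h|) := by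
  have h0 : DX (φ s) := (DX_of_S h3).1
  obtain ⟨C', γ, t1, hγ, ht1, hC', hdec⟩ := F.decay hα2 hs h0 h4
  have ht1p : 0 < t1 := hs.trans ht1
  have hC0 : 0 ≤ C0 := by have := (norm_nonneg _).trans (h3 1); simpa using this
  obtain ⟨L, B, hL, hB, hc⟩ := F.evol_const hs ht1.le
  set a : ℝ → ℝ := fun t => - (C' / γ) * t ^ (-γ) with ha
  have hda : ∀ t, t1 ≤ t → HasDerivAt a (C' * t ^ (-γ - 1)) t := by
    intro t ht
    refine ((Real.hasDerivAt_rpow_const (Or.inl (by linarith))).const_mul (-(C' / γ))).congr_deriv ?_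
    field_simp
  have ha0 : ∀ t, t1 ≤ t → a t ≤ 0 := by
    intro t ht
    have : 0 < t := by linarith
    have h1 : 0 ≤ C' / γ * t ^ (-γ) := by positivity
    simp only [ha]; linarith
  set Q := Real.exp (0 - a t1) with hQ
  have hQ0 : 0 ≤ Q := (Real.exp_pos _).le
  have hev : ∀ S : HH →L[ℂ] HH, Good S → ∀ t, t1 ≤ t → ‖S (φ t)‖ ≤ B * ‖S (φ s)‖ * Q ∧
      ∀ t', t ≤ t' → ‖S (φ t') - S (φ t)‖ ≤ B * ‖S (φ s)‖ * Q * (C' / γ) * t ^ (-γ) := by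
    intro S hS t ht
    have hb := (hc S hS).1 t1 (right_mem_Icc.2 ht1.le)
    have key : ∀ T, t ≤ T → _ := fun T hT => F.evol hS (k := fun t => C' * t ^ (-γ - 1)) (a := a) (A := 0)
      (s := t1) (T := T) ht1p (fun t ht => hda t ht.1) (fun t ht => ha0 t ht.1) (fun t ht => hdec t ht.1)
    refine ⟨?_, fun t' ht' => ?_⟩
    · calc _ ≤ _ := (key t le_rfl).1 t ⟨ht, le_rfl⟩
        _ ≤ _ := by gcongr
    · have htp : 0 < t := by linarith
      calc _ ≤ _ := (key t' ht').2 t ⟨ht, ht'⟩ t' ⟨ht', le_rfl⟩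
        _ ≤ B * ‖S (φ s)‖ * Q * (0 - a t) := by
            have h5 := ha0 t' (ht.trans ht')
            have h6 := ha0 t ht
            have h7 : a t' - a t ≤ 0 - a t := by linarith
            have h8 : 0 ≤ 0 - a t := by linarith
            calc _ ≤ ‖S (φ t1)‖ * Real.exp (0 - a t1) * (0 - a t) := by gcongr
              _ ≤ _ := by gcongr
        _ = _ := by simp only [ha]; ring
  -- limit
  have hcau : ∃ φp, Tendsto φ atTop (𝓝 φp) := by
    apply cauchySeq_tendsto_of_complete
    have h1 : Tendsto (fun t : ℝ => B * ‖φ s‖ * Q * (C' / γ) * t ^ (-γ)) atTop (𝓝 0) := by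
      simpa using (tendsto_rpow_neg_atTop hγ).const_mul (B * ‖φ s‖ * Q * (C' / γ))
    rw [Metric.cauchySeq_iff']
    intro ε hε
    obtain ⟨t, h2, h3⟩ := ((h1.eventually (gt_mem_nhds hε)).and (eventually_ge_atTop t1)).exists
    refine ⟨t, fun t' ht' => ?_⟩
    rw [dist_eq_norm]
    exact lt_of_le_of_lt ((hev _ good_id t h3).2 t' ht') h2
  obtain ⟨φp, hφp⟩ := hcau
  have hlim : ∀ S : HH →L[ℂ] HH, Good S → ∀ t, t1 ≤ t → ‖S (φ t - φp)‖ ≤ B * ‖S (φ s)‖ * Q * (C' / γ) * t ^ (-γ) := by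
    intro S hS t ht
    have h1 : Tendsto (fun t' => ‖S (φ t') - S (φ t)‖) atTop (𝓝 ‖S φp - S (φ t)‖) :=
      (((S.continuous.tendsto _).comp hφp).sub_const _).norm
    have h2 := le_of_tendsto h1 (by
      filter_upwards [eventually_ge_atTop t] with t' ht'
      exact (hev S hS t ht).2 t' ht')
    rwa [norm_sub_rev, ← map_sub] at h2
  refine ⟨φp, B * (‖φ s‖ + C0) * Q * (C' / γ + 1), γ, t1, hγ, ht1p, fun t ht => ?_⟩
  have htp : 0 < t := by linarith
  have hCg : 0 ≤ C' / γ := by positivity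
  have hn := norm_nonneg (φ s)
  have aux : ∀ S : HH →L[ℂ] HH, Good S → ∀ h : ℝ, ‖S (φ s)‖ ≤ C0 * |h| →
      ‖S (φ t - φp)‖ ≤ B * (‖φ s‖ + C0) * Q * (C' / γ + 1) * t ^ (-γ) * |h| ∧
      ‖S (φ t)‖ ≤ B * (‖φ s‖ + C0) * Q * (C' / γ + 1) * |h| := by
    intro S hS h hh
    have hb : ‖S (φ s)‖ ≤ (‖φ s‖ + C0) * |h| := hh.trans (by gcongr; linarith)
    constructor
    · calc _ ≤ _ := hlim S hS t ht
        _ ≤ B * ((‖φ s‖ + C0) * |h|) * Q * (C' / γ + 1) * t ^ (-γ) := by gcongr; linarith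
        _ = _ := by ring
    · calc _ ≤ _ := (hev S hS t ht).1
        _ ≤ B * ((‖φ s‖ + C0) * |h|) * Q * 1 := by rw [mul_one]; gcongr
        _ ≤ B * ((‖φ s‖ + C0) * |h|) * Q * (C' / γ + 1) := by gcongr; linarith
        _ = _ := by ring
  refine ⟨?_, fun h => (aux _ (good_ph h) h (h3 h)).1, fun h => (aux _ (good_tr h) h (h3' h)).1,
    fun h => (aux _ (good_ph h) h (h3 h)).2, fun h => (aux _ (good_tr h) h (h3' h)).2⟩
  calc _ ≤ _ := hlim _ good_id t ht
    _ ≤ _ := by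
      simp only [ContinuousLinearMap.coe_id', id]
      gcongr <;> linarith

end NLS
end

noncomputable section
open MeasureTheory Real Filter Topology Set
open scoped ENNReal NNReal FourierTransform SchwartzMap ContDiff
set_option linter.unusedVariables false

namespace NLS

lemma not_integrable_kernel {a x : ℝ} {φ : ℝ → ℂ} (h : ¬ Integrable φ) :
    ¬ Integrable (fun y => phf a 0 0 (x - y) * φ y) := by
  intro h2
  apply h
  have h3 := h2.bdd_mul (c := 1) (f := fun y => phf (-a) 0 0 (x - y))
    ((cont_phf (-a) 0 0).comp (by fun_prop : Continuous fun y => x - y)).aestronglyMeasurable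
    (Eventually.of_forall fun y => (norm_phf _ _ _ _).le)
  refine h3.congr (Eventually.of_forall fun y => ?_)
  simp only
  rw [← mul_assoc, phf_mul]
  simp [phf]

lemma sg_continuous (t : ℝ) (φ : ℝ → ℂ) : Continuous (sg t φ) := by
  unfold sg
  apply continuous_const.mul
  by_cases h : Integrable φ
  · apply continuous_of_dominated (bound := fun y => ‖φ y‖)
    · intro x
      exact ((cont_phf _ 0 0).comp (by fun_prop : Continuous fun y => x - y)).aestronglyMeasurable.mul h.1
    · intro x
      exact Eventually.of_forall fun y => by rw [norm_mul, norm_phf, one_mul]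
    · exact h.norm
    · exact Eventually.of_forall fun y =>
        ((cont_phf _ 0 0).comp (by fun_prop : Continuous fun x => x - y)).mul continuous_const
  · have : (fun x => ∫ y, phf (1 / (4 * t)) 0 0 (x - y) * φ y) = fun _ => 0 := by
      funext x; exact integral_undef (not_integrable_kernel h)
    rw [this]; exact continuous_const

lemma meas_int {g : ℝ → ℝ → ℂ} {μ : Measure ℝ} [SFinite μ] (hg : ∀ τ, Continuous (g τ)) :
    Measurable (fun x => ∫ τ, g τ x ∂μ) := by
  classical
  set X : Set ℝ := {x | AEStronglyMeasurable (fun τ => g τ x) μ} with hX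
  have hXc : IsClosed X := by
    apply IsSeqClosed.isClosed
    intro xs x hxs hlim
    refine aestronglyMeasurable_of_tendsto_ae atTop hxs (Eventually.of_forall fun τ => ?_)
    exact ((hg τ).tendsto x).comp hlim
  refine measurable_of_restrict_of_restrict_compl hXc.measurableSet ?_ ?_
  · obtain ⟨D, hDc, hDd⟩ := TopologicalSpace.exists_countable_dense X
    have hN0 : μ (⋃ d ∈ D, {τ | ¬ g τ d = (d.2 : AEStronglyMeasurable (fun τ => g τ d) μ).mk _ τ}) = 0 := by
      rw [measure_biUnion_null_iff hDc]
      intro d hd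
      exact (d.2 : AEStronglyMeasurable (fun τ => g τ d) μ).ae_eq_mk
    set N := ⋃ d ∈ D, {τ | ¬ g τ d = (d.2 : AEStronglyMeasurable (fun τ => g τ d) μ).mk _ τ} with hN
    set N' := toMeasurable μ N with hN'
    have hN'0 : μ N' = 0 := by rw [hN', measure_toMeasurable, hN0]
    let w : X → ℝ → ℂ := fun x => N'ᶜ.indicator (fun τ => g τ x)
    have hwD : ∀ d ∈ D, StronglyMeasurable (w d) := by
      intro d hd
      have h1 : w d = N'ᶜ.indicator ((d.2 : AEStronglyMeasurable (fun τ => g τ d) μ).mk _) := by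
        funext τ
        by_cases hτ : τ ∈ N'
        · simp [w, hτ]
        · simp only [w, indicator_of_mem (show τ ∈ N'ᶜ from hτ)]
          by_contra hne
          exact hτ (subset_toMeasurable μ N (mem_biUnion hd hne))
      rw [h1]
      exact (d.2 : AEStronglyMeasurable (fun τ => g τ d) μ).stronglyMeasurable_mk.indicator
        (measurableSet_toMeasurable _ _).compl
    have hwc : ∀ τ, Continuous fun x : X => w x τ := by
      intro τ
      by_cases hτ : τ ∈ N'
      · simp only [w, indicator_of_notMem (show τ ∉ N'ᶜ from fun h => h hτ)]; exact continuous_const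
      · simp only [w, indicator_of_mem (show τ ∈ N'ᶜ from hτ)]
        exact (hg τ).comp continuous_subtype_val
    have hws : ∀ x, StronglyMeasurable (w x) := by
      intro x
      obtain ⟨d, hd, hlim⟩ := mem_closure_iff_seq_limit.1 (hDd x)
      refine stronglyMeasurable_of_tendsto atTop (fun n => hwD (d n) (hd n)) ?_
      rw [tendsto_pi_nhds]
      intro τ
      exact ((hwc τ).tendsto x).comp hlim
    have h2 := stronglyMeasurable_uncurry_of_continuous_of_stronglyMeasurable hwc hws
    have h3 := h2.integral_prod_right (ν := μ)
    have h4 : (X.domRestrict fun x => ∫ τ, g τ x ∂μ) = fun x : X => ∫ τ, w x τ ∂μ := ?_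
    · rw [h4]; exact h3.measurable
    funext x
    apply integral_congr_ae
    have : ∀ᵐ τ ∂μ, τ ∉ N' := measure_eq_zero_iff_ae_notMem.1 hN'0
    filter_upwards [this] with τ hτ
    simp only [w, indicator_of_mem (show τ ∈ N'ᶜ from hτ)]
  · have : (Xᶜ.domRestrict fun x => ∫ τ, g τ x ∂μ) = fun _ => 0 := by
      funext x
      exact integral_non_aestronglyMeasurable x.2
    rw [this]; exact measurable_const

structure Raw (α lam : ℝ) (v : ℝ → ℝ → ℂ) : Prop where
  hα2 : α ^ 2 = α + 4
  hα : 2 < α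
  hl : 0 < lam
  m0 : MemLp (v 0) 2
  x0 : MemLp (fun x : ℝ => (x : ℂ) * v 0 x) 2
  duh : ∀ t, 0 < t → ∀ x, v t x = sg t (v 0) x + Complex.I * (lam : ℂ) *
    ∫ τ in (0:ℝ)..t, sg (t - τ) (fun y => Fn α (v τ y)) x
  c : ∀ t ∈ Ici (0:ℝ), Tendsto (fun s => eLpNorm (fun x => v s x - v t x) 2 volume) (𝓝[Ici 0] t) (𝓝 0)
  cx : ∀ t ∈ Ici (0:ℝ), Tendsto (fun s => eLpNorm (fun x : ℝ => (x : ℂ) * (v s x - v t x)) 2 volume)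
    (𝓝[Ici 0] t) (𝓝 0)
  dec : ∃ A : ℝ≥0∞, A < ⊤ ∧ ∀ c : ℝ≥0, (c : ℝ≥0∞) *
    (volume {t ∈ Ioi (0:ℝ) | (c : ℝ≥0∞) ≤ eLpNorm (v t) (ENNReal.ofReal (α + 2)) volume}) ^ (1 / (α + 1)) ≤ A

variable {α lam : ℝ} {v : ℝ → ℝ → ℂ}

namespace Raw

lemma meas (R : Raw α lam v) {t : ℝ} (ht : 0 ≤ t) : AEStronglyMeasurable (v t) volume := by
  rcases ht.eq_or_lt with rfl | ht
  · exact R.m0.1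
  · have h : v t = fun x => sg t (v 0) x + Complex.I * (lam : ℂ) *
      ∫ τ in (0:ℝ)..t, sg (t - τ) (fun y => Fn α (v τ y)) x := funext (R.duh t ht)
    rw [h]
    simp_rw [intervalIntegral.integral_of_le ht.le]
    exact ((sg_continuous _ _).measurable.add
      ((meas_int fun τ => sg_continuous _ _).const_mul _)).aestronglyMeasurable

lemma mem_gen (R : Raw α lam v) (w : ℝ → ℂ) (hw : Continuous w)
    (h0 : MemLp (fun x => w x * v 0 x) 2)
    (hc : ∀ t ∈ Ici (0:ℝ), Tendsto (fun s => eLpNorm (fun x : ℝ => w x * (v s x - v t x)) 2 volume)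
      (𝓝[Ici 0] t) (𝓝 0)) {t : ℝ} (ht : 0 ≤ t) : MemLp (fun x => w x * v t x) 2 := by
  have key := isPreconnected_Ici.induction₂ (s := Ici (0:ℝ))
    (fun s t => MemLp (fun x => w x * v s x) 2 volume ↔ MemLp (fun x => w x * v t x) 2 volume)
    (fun s hs => ?_) (fun x y z _ _ _ h1 h2 => h1.trans h2) (fun x y _ _ h => h.symm)
    (x := 0) (y := t) (mem_Ici.2 le_rfl) ht
  · exact key.1 h0
  · have h1 := (hc s hs).eventually (gt_mem_nhds (show (0:ℝ≥0∞) < 1 by simp))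
    filter_upwards [h1, self_mem_nhdsWithin] with r hr hr0
    have hd : MemLp (fun x : ℝ => w x * (v r x - v s x)) 2 :=
      ⟨hw.aestronglyMeasurable.mul ((R.meas hr0).sub (R.meas hs)), hr.trans ENNReal.one_lt_top⟩
    constructor
    · intro h
      refine (h.add hd).ae_eq (Eventually.of_forall fun x => ?_)
      simp only [Pi.add_apply]; ring
    · intro h
      refine (h.sub hd).ae_eq (Eventually.of_forall fun x => ?_)
      simp only [Pi.sub_apply]; ring

lemma mem (R : Raw α lam v) {t : ℝ} (ht : 0 ≤ t) : MemLp (v t) 2 := by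
  simpa using R.mem_gen (fun _ => 1) continuous_const (by simpa using R.m0) (by simpa using R.c) ht

lemma memx (R : Raw α lam v) {t : ℝ} (ht : 0 ≤ t) : MemLp (fun x : ℝ => (x : ℂ) * v t x) 2 :=
  R.mem_gen (fun x => (x : ℂ)) Complex.continuous_ofReal R.x0 R.cx ht

/-- the solution as an L2-valued function -/
def f (R : Raw α lam v) (t : ℝ) : HH := (R.mem (le_max_right t 0)).toLp _

lemma f_ae (R : Raw α lam v) {t : ℝ} (ht : 0 ≤ t) : R.f t =ᵐ[volume] v t := by
  have := MemLp.coeFn_toLp (R.mem (le_max_right t 0))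
  have h2 : v (max t 0) = v t := by rw [max_eq_left ht]
  exact this.trans (by rw [h2])

lemma tends_max (t : ℝ) : Tendsto (fun s : ℝ => max s 0) (𝓝 t) (𝓝[Ici 0] (max t 0)) := by
  refine tendsto_nhdsWithin_iff.2 ⟨(continuous_id.max continuous_const).tendsto t,
    Eventually.of_forall fun s => mem_Ici.2 (le_max_right _ _)⟩

lemma f_cont (R : Raw α lam v) : Continuous R.f := by
  rw [continuous_iff_continuousAt]
  intro t
  unfold ContinuousAt
  rw [Lp.tendsto_Lp_iff_tendsto_eLpNorm']
  refine ((R.c (max t 0) (le_max_right t 0)).comp (tends_max t)).congr fun s => ?_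
  apply eLpNorm_congr_ae
  filter_upwards [MemLp.coeFn_toLp (R.mem (le_max_right t 0)),
    MemLp.coeFn_toLp (R.mem (le_max_right s 0))] with x h1 h2
  simp only [Pi.sub_apply, f, h1, h2]

lemma f_DX (R : Raw α lam v) (t : ℝ) : DX (R.f t) := by
  refine (R.memx (le_max_right t 0)).ae_eq ?_
  filter_upwards [MemLp.coeFn_toLp (R.mem (le_max_right t 0))] with x h1
  simp only [f, h1]

lemma xf_cont (R : Raw α lam v) : Continuous (fun t => XX (R.f t)) := by
  rw [continuous_iff_continuousAt]
  intro t
  unfold ContinuousAt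
  rw [Lp.tendsto_Lp_iff_tendsto_eLpNorm']
  refine ((R.cx (max t 0) (le_max_right t 0)).comp (tends_max t)).congr fun s => ?_
  apply eLpNorm_congr_ae
  filter_upwards [MemLp.coeFn_toLp (R.mem (le_max_right t 0)),
    MemLp.coeFn_toLp (R.mem (le_max_right s 0)), XX_ae (R.f_DX t), XX_ae (R.f_DX s)] with x h1 h2 h3 h4
  rw [Pi.sub_apply, h3, h4]
  simp only [f, h1, h2]; ring

lemma f_int (R : Raw α lam v) (t : ℝ) : Integrable (R.f t) := DX_integrable (R.f_DX t)

lemma v_int (R : Raw α lam v) {t : ℝ} (ht : 0 ≤ t) : Integrable (v t) := (R.f_int t).congr (R.f_ae ht)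

end Raw

end NLS
end

noncomputable section
open MeasureTheory Real Filter Topology Set
open scoped ENNReal NNReal FourierTransform SchwartzMap ContDiff
set_option linter.unusedVariables false

namespace NLS

def LL (p : ℝ) (f : HH) : ℝ≥0∞ := ∫⁻ x, ‖f x‖ₑ ^ p

lemma LL_lsc (p : ℝ) : LowerSemicontinuous (LL p) := by
  rw [lowerSemicontinuous_iff_isClosed_preimage]
  intro y
  apply IsSeqClosed.isClosed
  intro F f hF hlim
  obtain ⟨ns, hns, h2⟩ := (MeasureTheory.tendstoInMeasure_of_tendsto_Lp hlim).exists_seq_tendsto_ae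
  have h3 : LL p f ≤ liminf (fun n => LL p (F (ns n))) atTop := by
    refine le_trans (lintegral_mono_ae ?_) (lintegral_liminf_le' fun n => ?_)
    · filter_upwards [h2] with x hx
      exact (((ENNReal.continuous_rpow_const (y := p)).tendsto _).comp hx.enorm).liminf_eq.ge
    · exact ((Lp.aestronglyMeasurable _).enorm).pow_const _
  refine h3.trans ?_
  refine liminf_le_of_le (by isBoundedDefault) fun b hb => ?_
  obtain ⟨n, hn⟩ := hb.exists
  exact hn.trans (hF _)

lemma LL_holder {p q r a b : ℝ} (ha : 0 ≤ a) (hb : 0 ≤ b) (hab : a + b = 1) (hp : 0 ≤ p) (hr : 0 ≤ r)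
    (h : q = p * a + r * b) (f : HH) : LL q f ≤ LL p f ^ a * LL r f ^ b := by
  have h1 := ENNReal.lintegral_mul_norm_pow_le (μ := volume) (f := fun x => ‖f x‖ₑ ^ p) (g := fun x => ‖f x‖ₑ ^ r)
    (((Lp.aestronglyMeasurable f).enorm).pow_const _) (((Lp.aestronglyMeasurable f).enorm).pow_const _)
    ha hb hab
  refine le_trans (le_of_eq ?_) h1
  refine lintegral_congr fun x => ?_
  rw [← ENNReal.rpow_mul, ← ENNReal.rpow_mul, ← ENNReal.rpow_add_of_nonneg _ _ (by positivity) (by positivity), h]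

lemma LL_two (f : HH) : LL 2 f = ENNReal.ofReal (‖f‖ ^ 2) := by
  rw [HH_normsq, ofReal_integral_eq_lintegral_ofReal (HH_integrable_sq f)
    (Eventually.of_forall fun x => by positivity)]
  refine lintegral_congr fun x => ?_
  rw [ENNReal.ofReal_pow (norm_nonneg _), ofReal_norm]
  norm_cast

/-- weak type to strong type on bounded intervals -/
lemma weak_strong {n : ℝ → ℝ≥0∞} (hn : Measurable n) {a T : ℝ} {A : ℝ≥0∞} (ha : 3 < a) (hA : A < ⊤)
    (h : ∀ c : ℝ≥0, (c : ℝ≥0∞) * (volume {t ∈ Ioi (0:ℝ) | (c : ℝ≥0∞) ≤ n t}) ^ (1 / a) ≤ A) :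
    ∫⁻ t in Ioo 0 T, n t ^ (3:ℝ) < ⊤ := by
  have hpt : ∀ t, n t ^ (3:ℝ) ≤ 1 + ∑' k : ℕ, (8:ℝ≥0∞) ^ (k + 1) *
      ({t | (2:ℝ≥0∞) ^ k ≤ n t} : Set ℝ).indicator 1 t := by
    intro t
    by_cases h1 : n t ≤ 1
    · exact le_add_right (ENNReal.rpow_le_one h1 (by norm_num))
    push Not at h1
    by_cases h2 : n t = ⊤
    · have : ∑' k : ℕ, (8:ℝ≥0∞) ^ (k + 1) * ({t | (2:ℝ≥0∞) ^ k ≤ n t} : Set ℝ).indicator 1 t = ⊤ := by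
        rw [eq_top_iff, ← ENNReal.tsum_const_eq_top_of_ne_zero (α := ℕ) (c := 1) one_ne_zero]
        refine ENNReal.tsum_le_tsum fun k => ?_
        rw [indicator_of_mem (by simp [h2])]
        simp only [Pi.one_apply, mul_one]
        exact one_le_pow₀ (by norm_num)
      rw [this]; simp
    · obtain ⟨y, hy⟩ : ∃ y : ℝ≥0, n t = y := ⟨(n t).toNNReal, (ENNReal.coe_toNNReal h2).symm⟩
      have hy1 : 1 ≤ y := by rw [hy] at h1; exact_mod_cast h1.le
      obtain ⟨k, hk1, hk2⟩ := exists_nat_pow_near hy1 (show (1:ℝ≥0) < 2 by norm_num)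
      refine le_trans ?_ (le_trans (ENNReal.le_tsum k) le_add_self)
      rw [indicator_of_mem (by simp only [mem_ofPred_eq, hy]; exact_mod_cast hk1)]
      simp only [Pi.one_apply, mul_one, hy]
      have : (y:ℝ≥0∞) ≤ (2:ℝ≥0∞) ^ (k+1) := by exact_mod_cast hk2.le
      calc (y:ℝ≥0∞) ^ (3:ℝ) ≤ ((2:ℝ≥0∞) ^ (k+1)) ^ (3:ℝ) := by gcongr
        _ = (8:ℝ≥0∞) ^ (k+1) := by
          rw [show (3:ℝ) = ((3:ℕ):ℝ) by norm_num, ENNReal.rpow_natCast, ← pow_mul, mul_comm, pow_mul]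
          norm_num
  have hms : ∀ k : ℕ, MeasurableSet ({t | (2:ℝ≥0∞) ^ k ≤ n t} : Set ℝ) := fun k => measurableSet_le measurable_const hn
  have hvol : ∀ k : ℕ, volume (({t | (2:ℝ≥0∞) ^ k ≤ n t} : Set ℝ) ∩ Ioo 0 T) ≤ A ^ a * (2⁻¹ ^ a) ^ k := by
    intro k
    have h1 := h (2 ^ k)
    set V := volume {t ∈ Ioi (0:ℝ) | (((2:ℝ≥0) ^ k : ℝ≥0) : ℝ≥0∞) ≤ n t} with hV
    have h2 : volume (({t | (2:ℝ≥0∞) ^ k ≤ n t} : Set ℝ) ∩ Ioo 0 T) ≤ V := by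
      apply measure_mono
      rintro t ⟨h1, h2⟩
      exact ⟨h2.1, by push_cast; exact h1⟩
    refine h2.trans ?_
    have h3 := ENNReal.rpow_le_rpow h1 (show 0 ≤ a by linarith)
    rw [ENNReal.mul_rpow_of_nonneg _ _ (by linarith), ← ENNReal.rpow_mul, one_div,
      inv_mul_cancel₀ (by linarith), ENNReal.rpow_one] at h3
    have e1 : (2⁻¹ ^ a : ℝ≥0∞) ^ k = (((((2:ℝ≥0) ^ k : ℝ≥0)) : ℝ≥0∞) ^ a)⁻¹ := by
      push_cast
      rw [ENNReal.inv_rpow, ← ENNReal.inv_pow, ← ENNReal.rpow_natCast, ← ENNReal.rpow_natCast,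
        ← ENNReal.rpow_mul, ← ENNReal.rpow_mul, mul_comm]
    rw [e1, ← div_eq_mul_inv, ENNReal.le_div_iff_mul_le, mul_comm]
    · exact h3
    · left; simp
    · left; simp
  calc ∫⁻ t in Ioo 0 T, n t ^ (3:ℝ) ≤ ∫⁻ t in Ioo 0 T, (1 + ∑' k : ℕ, (8:ℝ≥0∞) ^ (k + 1) *
      ({t | (2:ℝ≥0∞) ^ k ≤ n t} : Set ℝ).indicator 1 t) := lintegral_mono fun t => hpt t
    _ = volume (Ioo 0 T) + ∑' k : ℕ, (8:ℝ≥0∞) ^ (k+1) * volume (({t | (2:ℝ≥0∞) ^ k ≤ n t} : Set ℝ) ∩ Ioo 0 T) := by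
      rw [lintegral_add_left measurable_const, lintegral_tsum]
      · congr 1
        · simp
        · congr 1; funext k
          rw [lintegral_const_mul _ (measurable_one.indicator (hms k)), lintegral_indicator_one (hms k),
            Measure.restrict_apply (hms k)]
      · intro k
        exact ((measurable_one.indicator (hms k)).const_mul _).aemeasurable
    _ ≤ volume (Ioo 0 T) + ∑' k : ℕ, (8 * A ^ a) * (8 * 2⁻¹ ^ a) ^ k := by
      refine add_le_add le_rfl (ENNReal.tsum_le_tsum fun k => ?_)
      calc _ ≤ (8:ℝ≥0∞) ^ (k+1) * (A ^ a * (2⁻¹ ^ a) ^ k) := mul_le_mul_right (hvol k) _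
        _ = _ := by rw [mul_pow]; ring
    _ < ⊤ := by
      rw [ENNReal.tsum_mul_left, ENNReal.tsum_geometric]
      refine ENNReal.add_lt_top.2 ⟨by simp, ENNReal.mul_lt_top (ENNReal.mul_lt_top (by simp)
        (ENNReal.rpow_lt_top_of_nonneg (by linarith) hA.ne)) ?_⟩
      rw [ENNReal.inv_lt_top, tsub_pos_iff_lt]
      have h8 : (8:ℝ≥0∞) = 2 ^ (3:ℝ) := by
        rw [show (3:ℝ) = ((3:ℕ):ℝ) by norm_num, ENNReal.rpow_natCast]; norm_num
      rw [h8, ENNReal.inv_rpow, ← ENNReal.rpow_neg, ← ENNReal.rpow_add _ _ (by norm_num) (by norm_num)]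
      exact ENNReal.rpow_lt_one_of_one_lt_of_neg (by norm_num) (by linarith)

/-- beta-type integral bound -/
lemma beta_bound {ρ t β : ℝ} (hρ : ρ < t) (hβ : 0 ≤ β) (hβ' : β ≤ 3/4) :
    ∫⁻ σ in Ioo ρ t, ENNReal.ofReal ((t - σ) ^ (-(3/4:ℝ)) * (σ - ρ) ^ (-β)) ≤
      ENNReal.ofReal (16 * (t - ρ) ^ (1/4 - β)) := by
  have hL : 0 < t - ρ := by linarith
  set L := t - ρ with hLd
  have i0 : ∀ γ : ℝ, 0 ≤ γ → γ ≤ 3/4 → IntervalIntegrable (fun x : ℝ => x ^ (-γ)) volume 0 L ∧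
      (∫ x in (0:ℝ)..L, x ^ (-γ)) ≤ 4 * L ^ (1 - γ) := by
    intro γ h1 h2
    refine ⟨intervalIntegral.intervalIntegrable_rpow' (by linarith), ?_⟩
    rw [integral_rpow (Or.inl (by linarith)), Real.zero_rpow (by linarith), sub_zero, neg_add_eq_sub,
      div_le_iff₀ (by linarith)]
    have : 0 < L ^ (1 - γ) := by positivity
    nlinarith
  have i1 : ∀ γ : ℝ, 0 ≤ γ → γ ≤ 3/4 → IntervalIntegrable (fun σ : ℝ => (σ - ρ) ^ (-γ)) volume ρ t ∧
      (∫ σ in ρ..t, (σ - ρ) ^ (-γ)) ≤ 4 * L ^ (1 - γ) := by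
    intro γ h1 h2
    constructor
    · have := (i0 γ h1 h2).1.comp_sub_right ρ
      simpa [hLd] using this
    · rw [intervalIntegral.integral_comp_sub_right (fun x => x ^ (-γ)), sub_self]
      exact (i0 γ h1 h2).2
  have i2 : ∀ γ : ℝ, 0 ≤ γ → γ ≤ 3/4 → IntervalIntegrable (fun σ : ℝ => (t - σ) ^ (-γ)) volume ρ t ∧
      (∫ σ in ρ..t, (t - σ) ^ (-γ)) ≤ 4 * L ^ (1 - γ) := by
    intro γ h1 h2
    constructor
    · have := ((i0 γ h1 h2).1.comp_sub_left t).symm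
      simpa [hLd] using this
    · rw [intervalIntegral.integral_comp_sub_left (fun x => x ^ (-γ)), sub_self]
      exact (i0 γ h1 h2).2
  have j1 := i1 β hβ hβ'
  have j2 := i2 (3/4) (by norm_num) le_rfl
  have hIntbl : IntervalIntegrable (fun σ : ℝ => (L/2) ^ (-(3/4:ℝ)) * (σ - ρ) ^ (-β) + (L/2) ^ (-β) * (t - σ) ^ (-(3/4:ℝ)))
    volume ρ t := (j1.1.const_mul _).add (j2.1.const_mul _)
  calc ∫⁻ σ in Ioo ρ t, ENNReal.ofReal ((t - σ) ^ (-(3/4:ℝ)) * (σ - ρ) ^ (-β))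
      ≤ ∫⁻ σ in Ioo ρ t, ENNReal.ofReal ((L/2) ^ (-(3/4:ℝ)) * (σ - ρ) ^ (-β) + (L/2) ^ (-β) * (t - σ) ^ (-(3/4:ℝ))) := by
        refine setLIntegral_mono' measurableSet_Ioo fun σ hσ => ENNReal.ofReal_le_ofReal ?_
        have hx : 0 < t - σ := by linarith [hσ.2]
        have hy : 0 < σ - ρ := by linarith [hσ.1]
        have px := Real.rpow_pos_of_pos hx (-(3/4:ℝ))
        have py := Real.rpow_pos_of_pos hy (-β)
        have p1 : 0 < (L/2) ^ (-(3/4:ℝ)) := by positivity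
        have p2 : 0 < (L/2) ^ (-β) := by positivity
        rcases le_total (L/2) (t - σ) with h | h
        · have := Real.rpow_le_rpow_of_nonpos (by positivity : 0 < L/2) h (show -(3/4:ℝ) ≤ 0 by norm_num)
          nlinarith [mul_pos p2 px]
        · have h' : L/2 ≤ σ - ρ := by rw [hLd] at h ⊢; linarith
          have := Real.rpow_le_rpow_of_nonpos (by positivity : 0 < L/2) h' (show -β ≤ 0 by linarith)
          nlinarith [mul_pos p1 py]
    _ = ENNReal.ofReal (∫ σ in ρ..t, ((L/2) ^ (-(3/4:ℝ)) * (σ - ρ) ^ (-β) + (L/2) ^ (-β) * (t - σ) ^ (-(3/4:ℝ)))) := by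
        rw [intervalIntegral.integral_of_le hρ.le, ← restrict_Ioo_eq_restrict_Ioc,
          ofReal_integral_eq_lintegral_ofReal]
        · rw [intervalIntegrable_iff_integrableOn_Ioo_of_le hρ.le] at hIntbl
          exact hIntbl
        · filter_upwards [ae_restrict_mem measurableSet_Ioo] with σ hσ
          have hx : 0 < t - σ := by linarith [hσ.2]
          have hy : 0 < σ - ρ := by linarith [hσ.1]
          simp only [Pi.zero_apply]
          positivity
    _ ≤ _ := by
        apply ENNReal.ofReal_le_ofReal
        rw [intervalIntegral.integral_add (j1.1.const_mul _) (j2.1.const_mul _),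
          intervalIntegral.integral_const_mul, intervalIntegral.integral_const_mul]
        have hh : ∀ γ : ℝ, 0 ≤ γ → γ ≤ 1 → (L/2) ^ (-γ) ≤ 2 * L ^ (-γ) := by
          intro γ h0 h1
          rw [Real.div_rpow hL.le (by norm_num), div_eq_mul_inv, ← Real.rpow_neg (by norm_num), neg_neg, mul_comm]
          gcongr
          calc (2:ℝ) ^ γ ≤ 2 ^ (1:ℝ) := Real.rpow_le_rpow_of_exponent_le (by norm_num) h1
            _ = 2 := by simp
        have e1 : L ^ (-(3/4:ℝ)) * L ^ (1 - β) = L ^ (1/4 - β) := by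
          rw [← Real.rpow_add hL]; congr 1; ring
        have e2 : L ^ (-β) * L ^ (1 - (3/4:ℝ)) = L ^ (1/4 - β) := by
          rw [← Real.rpow_add hL]; congr 1; ring
        calc _ ≤ (2 * L ^ (-(3/4:ℝ))) * (4 * L ^ (1 - β)) + (2 * L ^ (-β)) * (4 * L ^ (1 - (3/4:ℝ))) := by
              have q1 := hh (3/4) (by norm_num) (by norm_num)
              have q2 := hh β hβ (by linarith)
              have : 0 ≤ ∫ σ in ρ..t, (σ - ρ) ^ (-β) := intervalIntegral.integral_nonneg hρ.le fun σ hσ =>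
                Real.rpow_nonneg (by linarith [hσ.1]) _
              have : 0 ≤ ∫ σ in ρ..t, (t - σ) ^ (-(3/4:ℝ)) := intervalIntegral.integral_nonneg hρ.le fun σ hσ =>
                Real.rpow_nonneg (by linarith [hσ.2]) _
              gcongr
              · exact j1.2
              · exact j2.2
          _ = 8 * (L ^ (-(3/4:ℝ)) * L ^ (1 - β)) + 8 * (L ^ (-β) * L ^ (1 - (3/4:ℝ))) := by ring
          _ = 16 * L ^ (1/4 - β) := by rw [e1, e2]; ring

end NLS
end

noncomputable section
open MeasureTheory Real Filter Topology Set
open scoped ENNReal NNReal FourierTransform SchwartzMap ContDiff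
set_option linter.unusedVariables false

namespace NLS

lemma holder_step {n : ℝ → ℝ≥0∞} (hn : Measurable n) {T : ℝ} {ρ t b : ℝ} (hρ0 : 0 ≤ ρ) (hρ : ρ < t) (htT : t ≤ T)
    (hb : 0 ≤ b) (hb' : b ≤ 1/2) :
    ∫⁻ σ in Ioo ρ t, ENNReal.ofReal ((t - σ) ^ (-(1/2:ℝ))) * n σ * ENNReal.ofReal ((σ - ρ) ^ (-b)) ≤
      (16 * (∫⁻ σ in Ioo 0 T, n σ ^ (3:ℝ)) ^ (1/3:ℝ)) * ENNReal.ofReal ((t - ρ) ^ (1/6 - b)) := by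
  have hL : 0 < t - ρ := by linarith
  have h1 := ENNReal.lintegral_mul_norm_pow_le (μ := volume.restrict (Ioo ρ t)) (f := fun σ => n σ ^ (3:ℝ))
    (g := fun σ => ENNReal.ofReal ((t - σ) ^ (-(3/4:ℝ)) * (σ - ρ) ^ (-(3 * b / 2))))
    (hn.pow_const _).aemeasurable (by fun_prop) (p := 1/3) (q := 2/3) (by norm_num) (by norm_num) (by norm_num)
  have h2 := beta_bound (β := 3 * b / 2) hρ (by linarith) (by linarith)
  calc _ = ∫⁻ σ in Ioo ρ t, (n σ ^ (3:ℝ)) ^ (1/3:ℝ) *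
        (ENNReal.ofReal ((t - σ) ^ (-(3/4:ℝ)) * (σ - ρ) ^ (-(3 * b / 2)))) ^ (2/3:ℝ) := by
        refine setLIntegral_congr_fun measurableSet_Ioo fun σ hσ => ?_
        have hx : 0 < t - σ := by linarith [hσ.2]
        have hy : 0 < σ - ρ := by linarith [hσ.1]
        rw [← ENNReal.rpow_mul, ENNReal.ofReal_rpow_of_pos (by positivity), Real.mul_rpow (by positivity) (by positivity),
          ← Real.rpow_mul hx.le, ← Real.rpow_mul hy.le, ENNReal.ofReal_mul (by positivity)]
        norm_num
        rw [show 3 * b / 2 * (2/3) = b by ring]; ring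
    _ ≤ _ := h1
    _ ≤ (∫⁻ σ in Ioo 0 T, n σ ^ (3:ℝ)) ^ (1/3:ℝ) * (ENNReal.ofReal (16 * (t - ρ) ^ (1/4 - 3 * b / 2))) ^ (2/3:ℝ) := by
        refine mul_le_mul' (ENNReal.rpow_le_rpow (lintegral_mono_set (Ioo_subset_Ioo hρ0 htT)) (by norm_num)) (ENNReal.rpow_le_rpow h2 (by norm_num))
    _ ≤ (∫⁻ σ in Ioo 0 T, n σ ^ (3:ℝ)) ^ (1/3:ℝ) * (16 * ENNReal.ofReal ((t - ρ) ^ (1/6 - b))) := by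
        gcongr
        rw [ENNReal.ofReal_rpow_of_pos (by positivity), Real.mul_rpow (by norm_num) (by positivity),
          ← Real.rpow_mul hL.le, ENNReal.ofReal_mul (by positivity)]
        rw [show (1/4 - 3*b/2) * (2/3) = 1/6 - b by ring]
        gcongr
        rw [show (16:ℝ≥0∞) = ENNReal.ofReal 16 by norm_num]
        apply ENNReal.ofReal_le_ofReal
        calc (16:ℝ) ^ (2/3:ℝ) ≤ 16 ^ (1:ℝ) := Real.rpow_le_rpow_of_exponent_le (by norm_num) (by norm_num)
          _ = 16 := by simp
    _ = _ := by ring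

def HB (M N : ℝ → ℝ≥0∞) (T b : ℝ) : Prop := ∃ A B : ℝ≥0∞, A < ⊤ ∧ B < ⊤ ∧ ∀ t, 0 < t → t ≤ T →
  M t ≤ A * ENNReal.ofReal (t ^ (-(1/2:ℝ))) + B * ∫⁻ σ in Ioo 0 t, ENNReal.ofReal ((t - σ) ^ (-b)) * N σ

lemma HB_step {M N n : ℝ → ℝ≥0∞} (hN : Measurable N) (hn : Measurable n) {T b : ℝ} {C : ℝ≥0∞} (hC : C < ⊤)
    (hb : 1/6 ≤ b) (hb' : b ≤ 1/2)
    (hNn : ∀ t, 0 < t → t ≤ T → N t ≤ C * n t * M t) (h3 : ∫⁻ t in Ioo 0 T, n t ^ (3:ℝ) < ⊤)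
    (H1 : HB M N T (1/2)) (H2 : HB M N T b) : HB M N T (b - 1/6) := by
  obtain ⟨A1, B1, hA1, hB1, H1⟩ := H1
  obtain ⟨A, B, hA, hB, H2⟩ := H2
  set K := 16 * (∫⁻ σ in Ioo 0 T, n σ ^ (3:ℝ)) ^ (1/3:ℝ) with hK
  have hKt : K < ⊤ := ENNReal.mul_lt_top (by simp) (ENNReal.rpow_lt_top_of_nonneg (by norm_num) h3.ne)
  refine ⟨A1 + B1 * (C * A * (K * ENNReal.ofReal (T ^ (1/6:ℝ)))), B1 * (C * B * K), ?_, ?_, ?_⟩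
  · exact ENNReal.add_lt_top.2 ⟨hA1, ENNReal.mul_lt_top hB1 (ENNReal.mul_lt_top (ENNReal.mul_lt_top hC hA)
      (ENNReal.mul_lt_top hKt ENNReal.ofReal_lt_top))⟩
  · exact ENNReal.mul_lt_top hB1 (ENNReal.mul_lt_top (ENNReal.mul_lt_top hC hB) hKt)
  intro t ht htT
  have hT : 0 < T := ht.trans_le htT
  let k : ℝ → ℝ≥0∞ := fun σ => ENNReal.ofReal ((t - σ) ^ (-(1/2:ℝ)))
  have hk : Measurable k := by fun_prop
  let G : ℝ → ℝ → ℝ≥0∞ := fun σ ρ =>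
    ({p : ℝ × ℝ | p.2 < p.1}.indicator (fun p => k p.1 * n p.1 * ENNReal.ofReal ((p.1 - p.2) ^ (-b)) * N p.2)) (σ, ρ)
  have hG : Measurable (Function.uncurry G) := by
    refine Measurable.indicator ?_ (measurableSet_lt measurable_snd measurable_fst)
    exact (((hk.comp measurable_fst).mul (hn.comp measurable_fst)).mul (by fun_prop)).mul (hN.comp measurable_snd)
  have hin : ∀ σ ∈ Ioo 0 t, k σ * n σ * ∫⁻ ρ in Ioo 0 σ, ENNReal.ofReal ((σ - ρ) ^ (-b)) * N ρ
      ≤ ∫⁻ ρ in Ioo 0 t, G σ ρ := by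
    intro σ hσ
    rw [← lintegral_const_mul _ (by fun_prop)]
    calc _ = ∫⁻ ρ in Ioo 0 σ, G σ ρ := by
          refine setLIntegral_congr_fun measurableSet_Ioo fun ρ hρ => ?_
          simp only [G]
          rw [indicator_of_mem (show (σ, ρ) ∈ {p : ℝ × ℝ | p.2 < p.1} from hρ.2)]
          ring
      _ ≤ _ := lintegral_mono_set (Ioo_subset_Ioo le_rfl hσ.2.le)
  have hsw : ∫⁻ σ in Ioo 0 t, ∫⁻ ρ in Ioo 0 t, G σ ρ = ∫⁻ ρ in Ioo 0 t, ∫⁻ σ in Ioo 0 t, G σ ρ :=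
    lintegral_lintegral_swap hG.aemeasurable
  have hout : ∀ ρ ∈ Ioo 0 t, ∫⁻ σ in Ioo 0 t, G σ ρ ≤ K * (ENNReal.ofReal ((t - ρ) ^ (-(b - 1/6))) * N ρ) := by
    intro ρ hρ
    calc ∫⁻ σ in Ioo 0 t, G σ ρ = ∫⁻ σ in Ioo 0 t, (Ioi ρ).indicator (fun σ => k σ * n σ * ENNReal.ofReal ((σ - ρ) ^ (-b)) * N ρ) σ := by
          rfl
      _ = ∫⁻ σ in Ioo ρ t, k σ * n σ * ENNReal.ofReal ((σ - ρ) ^ (-b)) * N ρ := by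
          rw [lintegral_indicator measurableSet_Ioi, Measure.restrict_restrict measurableSet_Ioi]
          congr 2
          ext x; simp only [mem_inter_iff, mem_Ioi, mem_Ioo]
          constructor
          · rintro ⟨h1, h2, h3⟩; exact ⟨h1, h3⟩
          · rintro ⟨h1, h2⟩; exact ⟨h1, hρ.1.trans h1, h2⟩
      _ = (∫⁻ σ in Ioo ρ t, k σ * n σ * ENNReal.ofReal ((σ - ρ) ^ (-b))) * N ρ := by
          rw [lintegral_mul_const _ (by fun_prop)]
      _ ≤ (K * ENNReal.ofReal ((t - ρ) ^ (1/6 - b))) * N ρ := by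
          gcongr; exact holder_step hn hρ.1.le hρ.2 htT (by linarith) hb'
      _ = _ := by rw [neg_sub]; ring
  calc M t ≤ _ := H1 t ht htT
    _ ≤ A1 * ENNReal.ofReal (t ^ (-(1/2:ℝ))) + B1 * ∫⁻ σ in Ioo 0 t, (C * A * (k σ * n σ * ENNReal.ofReal ((σ - 0) ^ (-(1/2:ℝ))))
          + C * B * ∫⁻ ρ in Ioo 0 t, G σ ρ) := by
        gcongr _ + _ * ?_
        refine setLIntegral_mono' measurableSet_Ioo fun σ hσ => ?_
        have e1 := hNn σ hσ.1 (hσ.2.le.trans htT)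
        have e2 := H2 σ hσ.1 (hσ.2.le.trans htT)
        calc _ ≤ k σ * (C * n σ * (A * ENNReal.ofReal (σ ^ (-(1/2:ℝ))) + B * ∫⁻ ρ in Ioo 0 σ, ENNReal.ofReal ((σ - ρ) ^ (-b)) * N ρ)) := by
              refine mul_le_mul_right (e1.trans (mul_le_mul_right e2 _)) _
          _ = C * A * (k σ * n σ * ENNReal.ofReal ((σ - 0) ^ (-(1/2:ℝ)))) + C * B * (k σ * n σ * ∫⁻ ρ in Ioo 0 σ, ENNReal.ofReal ((σ - ρ) ^ (-b)) * N ρ) := by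
              rw [sub_zero]; ring
          _ ≤ _ := by gcongr; exact hin σ hσ
    _ = A1 * ENNReal.ofReal (t ^ (-(1/2:ℝ))) + B1 * (C * A * (∫⁻ σ in Ioo 0 t, k σ * n σ * ENNReal.ofReal ((σ - 0) ^ (-(1/2:ℝ))))
          + C * B * ∫⁻ σ in Ioo 0 t, ∫⁻ ρ in Ioo 0 t, G σ ρ) := by
        rw [lintegral_add_left (by fun_prop), lintegral_const_mul _ (by fun_prop),
          lintegral_const_mul _ (Measurable.lintegral_prod_right hG)]
    _ ≤ A1 * ENNReal.ofReal (t ^ (-(1/2:ℝ))) + B1 * (C * A * (K * ENNReal.ofReal ((t - 0) ^ (1/6 - 1/2 : ℝ)))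
          + C * B * (K * ∫⁻ ρ in Ioo 0 t, ENNReal.ofReal ((t - ρ) ^ (-(b - 1/6))) * N ρ)) := by
        gcongr
        · exact holder_step hn le_rfl ht htT (by norm_num) le_rfl
        · rw [hsw, ← lintegral_const_mul _ (by fun_prop)]
          exact setLIntegral_mono' measurableSet_Ioo hout
    _ ≤ A1 * ENNReal.ofReal (t ^ (-(1/2:ℝ))) + B1 * (C * A * (K * (ENNReal.ofReal (T ^ (1/6:ℝ)) * ENNReal.ofReal (t ^ (-(1/2:ℝ)))))
          + C * B * (K * ∫⁻ ρ in Ioo 0 t, ENNReal.ofReal ((t - ρ) ^ (-(b - 1/6))) * N ρ)) := by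
        gcongr
        rw [sub_zero, ← ENNReal.ofReal_mul (by positivity), sub_eq_add_neg, Real.rpow_add ht]
        apply ENNReal.ofReal_le_ofReal
        gcongr
    _ = _ := by ring

lemma HB_final {M N n : ℝ → ℝ≥0∞} (hN : Measurable N) (hn : Measurable n) {T : ℝ} {C : ℝ≥0∞} (hC : C < ⊤)
    (hNn : ∀ t, 0 < t → t ≤ T → N t ≤ C * n t * M t) (h3 : ∫⁻ t in Ioo 0 T, n t ^ (3:ℝ) < ⊤)
    (hNi : ∫⁻ t in Ioo 0 T, N t < ⊤)
    (H1 : HB M N T (1/2)) {δ : ℝ} (hδ : 0 < δ) : ∃ B : ℝ≥0∞, B < ⊤ ∧ ∀ t ∈ Icc δ T, M t ≤ B := by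
  have a1 := HB_step hN hn hC (by norm_num) (by norm_num) hNn h3 H1 H1
  have a2 := HB_step hN hn hC (by norm_num) (by norm_num) hNn h3 H1 a1
  have a3 := HB_step hN hn hC (by norm_num) (by norm_num) hNn h3 H1 a2
  obtain ⟨A, B, hA, hB, H⟩ := a3
  refine ⟨A * ENNReal.ofReal (δ ^ (-(1/2:ℝ))) + B * ∫⁻ t in Ioo 0 T, N t, ?_, fun t ht => ?_⟩
  · exact ENNReal.add_lt_top.2 ⟨ENNReal.mul_lt_top hA ENNReal.ofReal_lt_top, ENNReal.mul_lt_top hB hNi⟩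
  refine (H t (hδ.trans_le ht.1) ht.2).trans ?_
  gcongr ?_ + _ * ?_
  · gcongr _ * ?_
    exact ENNReal.ofReal_le_ofReal (Real.rpow_le_rpow_of_nonpos hδ ht.1 (by norm_num))
  · norm_num
    exact lintegral_mono_set (Ioo_subset_Ioo le_rfl ht.2)

variable {α lam : ℝ} {v : ℝ → ℝ → ℂ}

lemma sg_bound {t : ℝ} (ht : 0 < t) (φ : ℝ → ℂ) (x : ℝ) :
    ‖sg t φ x‖ₑ ≤ ENNReal.ofReal (t ^ (-(1/2:ℝ))) * ∫⁻ y, ‖φ y‖ₑ := by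
  unfold sg
  rw [enorm_mul]
  gcongr
  · rw [← ofReal_norm, norm_sg_const ht]
    apply ENNReal.ofReal_le_ofReal
    rw [show -(1:ℝ)/2 = -(1/2) by norm_num]
    refine Real.rpow_le_rpow_of_nonpos ht ?_ (by norm_num)
    nlinarith [Real.pi_gt_three]
  · refine (enorm_integral_le_lintegral_enorm _).trans (le_of_eq (lintegral_congr fun y => ?_))
    rw [enorm_mul, ← ofReal_norm (phf _ _ _ _), norm_phf]; simp

namespace Raw

def nu (R : Raw α lam v) (t : ℝ) : ℝ≥0∞ := LL (α + 2) (R.f t) ^ (1 / (α + 2))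
def NN (R : Raw α lam v) (t : ℝ) : ℝ≥0∞ := LL (α + 1) (R.f t)

lemma nu_meas (R : Raw α lam v) : Measurable R.nu :=
  (((LL_lsc (α+2)).comp R.f_cont).measurable).pow_const _

lemma NN_meas (R : Raw α lam v) : Measurable R.NN := ((LL_lsc (α+1)).comp R.f_cont).measurable

lemma LL_v (R : Raw α lam v) {t : ℝ} (ht : 0 ≤ t) (p : ℝ) : LL p (R.f t) = ∫⁻ x, ‖v t x‖ₑ ^ p := by
  refine lintegral_congr_ae ?_
  filter_upwards [R.f_ae ht] with x hx
  simp only [hx]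

lemma nu_eq (R : Raw α lam v) {t : ℝ} (ht : 0 ≤ t) :
    eLpNorm (v t) (ENNReal.ofReal (α + 2)) volume = R.nu t := by
  have hα := R.hα
  rw [eLpNorm_eq_lintegral_rpow_enorm_toReal (by simp; linarith) (by simp), ENNReal.toReal_ofReal (by linarith),
    nu, R.LL_v ht]

lemma nu3 (R : Raw α lam v) (T : ℝ) : ∫⁻ t in Ioo 0 T, R.nu t ^ (3:ℝ) < ⊤ := by
  obtain ⟨A, hA, h⟩ := R.dec
  refine weak_strong R.nu_meas (a := α + 1) (by linarith [R.hα]) hA fun c => ?_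
  convert h c using 5
  ext t
  constructor
  · rintro ⟨h1, h2⟩; exact ⟨h1, by rw [R.nu_eq (le_of_lt h1)]; exact h2⟩
  · rintro ⟨h1, h2⟩; exact ⟨h1, by rw [R.nu_eq (le_of_lt h1)] at h2; exact h2⟩

lemma mass (R : Raw α lam v) (T : ℝ) : ∃ C : ℝ≥0∞, C < ⊤ ∧ ∀ t ∈ Icc 0 T, LL 2 (R.f t) ≤ C := by
  obtain ⟨m, hm⟩ := (isCompact_Icc (a := (0:ℝ)) (b := T)).exists_bound_of_continuousOn R.f_cont.continuousOn
  refine ⟨ENNReal.ofReal (m ^ 2), ENNReal.ofReal_lt_top, fun t ht => ?_⟩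
  rw [LL_two]
  exact ENNReal.ofReal_le_ofReal (by have := hm t ht; gcongr)

lemma NN_int (R : Raw α lam v) (T : ℝ) : ∫⁻ t in Ioo 0 T, R.NN t < ⊤ := by
  obtain ⟨C, hC, h⟩ := R.mass T
  have hα := R.hα
  have hα2 := R.hα2
  have key : ∀ t ∈ Ioo 0 T, R.NN t ≤ C ^ (1/α) * (1 + R.nu t ^ (3:ℝ)) := by
    intro t ht
    have h1 := LL_holder (p := 2) (q := α + 1) (r := α + 2) (a := 1/α) (b := (α-1)/α) (by positivity)
      (div_nonneg (by linarith) (by linarith)) (by field_simp; ring) (by norm_num) (by linarith)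
      (by field_simp; nlinarith) (R.f t)
    refine h1.trans ?_
    gcongr
    · exact h t ⟨ht.1.le, ht.2.le⟩
    · have e : LL (α+2) (R.f t) ^ ((α-1)/α) = R.nu t ^ (2 + 2/α) := by
        rw [nu, ← ENNReal.rpow_mul]; congr 1; field_simp; nlinarith
      rw [e]
      rcases le_total (R.nu t) 1 with h1 | h1
      · exact le_add_right (ENNReal.rpow_le_one h1 (by positivity))
      · refine le_add_left (ENNReal.rpow_le_rpow_of_exponent_le h1 ?_)
        have : 2/α ≤ 1 := by rw [div_le_one (by linarith)]; linarith
        linarith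
  calc _ ≤ ∫⁻ t in Ioo 0 T, C ^ (1/α) * (1 + R.nu t ^ (3:ℝ)) := setLIntegral_mono' measurableSet_Ioo key
    _ = C ^ (1/α) * (volume (Ioo 0 T) + ∫⁻ t in Ioo 0 T, R.nu t ^ (3:ℝ)) := by
      rw [lintegral_const_mul _ ((R.nu_meas.pow_const _).const_add _), lintegral_add_left measurable_const]; simp
    _ < ⊤ := ENNReal.mul_lt_top (ENNReal.rpow_lt_top_of_nonneg (by positivity) hC.ne)
      (ENNReal.add_lt_top.2 ⟨by simp, R.nu3 T⟩)

lemma Linfty (R : Raw α lam v) {δ T : ℝ} (hδ : 0 < δ) : ∃ m : ℝ, 0 ≤ m ∧ ∀ t ∈ Icc δ T, ∀ x, ‖v t x‖ ≤ m := by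
  have hα := R.hα
  have hα2 := R.hα2
  obtain ⟨C, hC, h⟩ := R.mass T
  have hM : ∃ B : ℝ≥0∞, B < ⊤ ∧ ∀ t ∈ Icc δ T, (⨆ x, ‖v t x‖ₑ) ≤ B := by
    refine HB_final R.NN_meas R.nu_meas (C := C ^ (2/α))
      (ENNReal.rpow_lt_top_of_nonneg (by positivity) hC.ne) ?_ (R.nu3 T) (R.NN_int T) ?_ hδ
    · intro t ht htT
      have h1 := LL_holder (p := 2) (q := α) (r := α + 2) (a := 2/α) (b := (α-2)/α) (by positivity)
        (div_nonneg (by linarith) (by linarith)) (by field_simp; ring) (by norm_num) (by linarith)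
        (by field_simp; nlinarith) (R.f t)
      have e : LL (α+2) (R.f t) ^ ((α-2)/α) = R.nu t := by
        rw [nu]; congr 1; field_simp; nlinarith
      rw [e] at h1
      calc R.NN t = ∫⁻ x, ‖v t x‖ₑ ^ (α + 1) := R.LL_v ht.le _
        _ ≤ ∫⁻ x, ‖v t x‖ₑ ^ α * (⨆ x, ‖v t x‖ₑ) := by
          refine lintegral_mono fun x => ?_
          rw [ENNReal.rpow_add_of_nonneg _ _ (by linarith) (by norm_num), ENNReal.rpow_one]
          gcongr
          exact le_iSup (fun x => ‖v t x‖ₑ) x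
        _ = LL α (R.f t) * (⨆ x, ‖v t x‖ₑ) := by
          rw [lintegral_mul_const'' _ ((R.meas ht.le).enorm.pow_const _), R.LL_v ht.le]
        _ ≤ _ := by
          gcongr
          refine h1.trans ?_
          gcongr
          exact h t ⟨ht.le, htT⟩
    · refine ⟨∫⁻ y, ‖v 0 y‖ₑ, ENNReal.ofReal lam, (R.v_int le_rfl).2, ENNReal.ofReal_lt_top, fun t ht htT => iSup_le fun x => ?_⟩
      rw [R.duh t ht x]
      refine (enorm_add_le _ _).trans (add_le_add ((sg_bound ht _ x).trans (mul_comm _ _).le) ?_)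
      rw [enorm_mul, enorm_mul, ← ofReal_norm Complex.I, Complex.norm_I, ← ofReal_norm (lam : ℂ),
        Complex.norm_real, Real.norm_of_nonneg R.hl.le, ENNReal.ofReal_one, one_mul]
      gcongr
      rw [intervalIntegral.integral_of_le ht.le, ← restrict_Ioo_eq_restrict_Ioc]
      refine (enorm_integral_le_lintegral_enorm _).trans (setLIntegral_mono' measurableSet_Ioo fun τ hτ => ?_)
      refine (sg_bound (by linarith [hτ.2]) _ x).trans ?_
      gcongr
      rw [NN, R.LL_v hτ.1.le]
      refine le_of_eq (lintegral_congr fun y => ?_)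
      rw [← ofReal_norm, norm_Fn, ← ofReal_norm, ENNReal.ofReal_rpow_of_nonneg (norm_nonneg _) (by linarith)]
      linarith
  obtain ⟨B, hB, H⟩ := hM
  refine ⟨B.toReal, ENNReal.toReal_nonneg, fun t ht x => ?_⟩
  have := (le_iSup (fun x => ‖v t x‖ₑ) x).trans (H t ht)
  rw [← toReal_enorm]
  exact ENNReal.toReal_mono hB.ne this

end Raw

end NLS
end

noncomputable section
open MeasureTheory Real Filter Topology Set
open scoped ENNReal NNReal FourierTransform SchwartzMap ContDiff
set_option linter.unusedVariables false

namespace NLS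

lemma phase_le (c : ℝ) (f : HH) : ‖ph 0 0 c f - f‖ ≤ √(2 * |c|) * ‖f‖ := by
  rw [ph_const_smul]
  have e : Complex.exp (Complex.I * (c : ℂ)) • f - f = (Complex.exp (Complex.I * (c : ℂ)) - 1) • f := by
    rw [sub_smul, one_smul]
  rw [e, norm_smul]
  gcongr
  have h1 : ‖Complex.exp (Complex.I * (c : ℂ)) - 1‖ ≤ |c| := by
    have := Real.norm_exp_I_mul_ofReal_sub_one_le (x := c)
    rwa [Real.norm_eq_abs] at this
  have h2 : ‖Complex.exp (Complex.I * (c : ℂ)) - 1‖ ≤ 2 := by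
    refine (norm_sub_le _ _).trans ?_
    rw [mul_comm, Complex.norm_exp_ofReal_mul_I]; norm_num
  apply Real.le_sqrt_of_sq_le
  nlinarith [norm_nonneg (Complex.exp (Complex.I * (c : ℂ)) - 1), abs_nonneg c]

lemma phase_le' (t h : ℝ) (f : HH) : ‖ph 0 0 (-(4 * π ^ 2 * t * h ^ 2)) f - f‖ ≤ √(8 * π ^ 2 * |t|) * ‖f‖ * |h| := by
  refine (phase_le _ f).trans (le_of_eq ?_)
  have : 2 * |-(4 * π ^ 2 * t * h ^ 2)| = (8 * π ^ 2 * |t|) * |h| ^ 2 := by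
    rw [abs_neg, abs_mul, abs_mul, abs_of_nonneg (by positivity : 0 ≤ 4 * π ^ 2), abs_pow]; ring
  rw [this, Real.sqrt_mul (by positivity), Real.sqrt_sq (abs_nonneg _)]; ring

lemma gal_split (t h : ℝ) (f : HH) :
    gal t h f = ph 0 (2 * π * h) 0 (ph 0 0 (-(4 * π ^ 2 * t * h ^ 2)) (tr (-(4 * π * t * h)) f)) := by
  rw [gal_apply, ph_ph]; simp

lemma gal_diff (t h : ℝ) (f : HH) : ‖gal t h f - ph 0 (2 * π * h) 0 f‖ ≤
    √(8 * π ^ 2 * |t|) * ‖f‖ * |h| + ‖Str (-(4 * π * t * h)) f‖ := by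
  rw [gal_split, ← map_sub, LinearIsometry.norm_map]
  have e : ph 0 0 (-(4 * π ^ 2 * t * h ^ 2)) (tr (-(4 * π * t * h)) f) - f =
    ph 0 0 (-(4 * π ^ 2 * t * h ^ 2)) (tr (-(4 * π * t * h)) f - f) + (ph 0 0 (-(4 * π ^ 2 * t * h ^ 2)) f - f) := by
    rw [map_sub]; abel
  rw [e]
  refine (norm_add_le _ _).trans ?_
  rw [LinearIsometry.norm_map, add_comm, Str_apply]
  gcongr
  exact phase_le' t h f

/-- two-sided smoothness and decay class -/
def Cls (C : ℝ) (f : HH) : Prop := (∀ h, ‖Sph h f‖ ≤ C * |h|) ∧ (∀ h, ‖Str h f‖ ≤ C * |h|)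

lemma Cls.gal {C : ℝ} {f : HH} (H : Cls C f) (t : ℝ) : ∃ C', ∀ h, ‖gal t h f - f‖ ≤ C' * |h| := by
  refine ⟨√(8 * π ^ 2 * |t|) * ‖f‖ + C * (4 * π * |t|) + C * (2 * π), fun h => ?_⟩
  have e : NLS.gal t h f - f = (NLS.gal t h f - ph 0 (2 * π * h) 0 f) + (ph 0 (2 * π * h) 0 f - f) := by abel
  rw [e]
  refine (norm_add_le _ _).trans ((add_le_add (gal_diff t h f) (H.1 _)).trans ?_)
  have := H.2 (-(4 * π * t * h))
  rw [abs_neg, abs_mul, abs_mul, abs_of_nonneg (by positivity : 0 ≤ 4 * π)] at this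
  rw [abs_mul, abs_of_nonneg (by positivity : 0 ≤ 2 * π)]
  linarith

lemma gal_neg_UU (t h : ℝ) (f : HH) : ‖ph 0 (2 * π * h) 0 (UU t f) - UU t f‖ = ‖gal (-t) h f - f‖ := by
  have h1 := UUneg_gal (-t) h f
  rw [neg_neg] at h1
  rw [← h1, ← map_sub, LinearIsometry.norm_map]

lemma Cls.DX_UU {C : ℝ} {f : HH} (H : Cls C f) (t : ℝ) : DX (UU t f) := by
  obtain ⟨C', h'⟩ := H.gal (-t)
  have : ∀ k, ‖ph 0 k 0 (UU t f) - UU t f‖ ≤ (C' / (2 * π)) * |k| := by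
    intro k
    have h1 := h' (k / (2 * π))
    rw [← gal_neg_UU, mul_div_cancel₀ _ (by positivity : (2 * π) ≠ 0), abs_div,
      abs_of_nonneg (by positivity : 0 ≤ 2 * π)] at h1
    rw [div_mul_eq_mul_div]; rwa [mul_div_assoc'] at h1
  exact (DX_of_S this).1

lemma schw_DX (g : 𝓢(ℝ, ℂ)) : DX ((g.memLp 2 (μ := volume)).toLp g) := by
  have h1 : MemLp (fun x : ℝ => (x : ℂ) * g x) 2 := by
    have hm : AEStronglyMeasurable (fun x : ℝ => (x : ℂ) * g x) volume :=
      (Complex.continuous_ofReal.mul g.continuous).aestronglyMeasurable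
    rw [memLp_two_iff_integrable_sq_norm hm]
    have h2 := g.integrable_pow_mul (volume : Measure ℝ) 2
    obtain ⟨C, hC⟩ := g.decay 0 0
    have h3 := h2.bdd_mul (c := C) (f := fun x => ‖g x‖) g.continuous.norm.aestronglyMeasurable
      (Eventually.of_forall fun x => by
        have := hC.2 x
        simpa using this)
    refine h3.congr (Eventually.of_forall fun x => ?_)
    simp only [norm_mul, Complex.norm_real]; ring
  refine h1.ae_eq ?_
  filter_upwards [MemLp.coeFn_toLp (g.memLp 2 (μ := volume))] with x hx
  rw [hx]

lemma schw_FT (g : 𝓢(ℝ, ℂ)) : DX (FT ((g.memLp 2 (μ := volume)).toLp g)) := by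
  have h1 := FT_toLp g.integrable (g.memLp 2 (μ := volume))
  have h2 := schw_DX (𝓕 g)
  refine MemLp.ae_eq ?_ h2
  filter_upwards [h1, MemLp.coeFn_toLp ((𝓕 g).memLp 2 (μ := volume))] with x hx hx2
  rw [hx, hx2, SchwartzMap.fourier_coe]

lemma schw_Cls (g : 𝓢(ℝ, ℂ)) : ∃ C, Cls C ((g.memLp 2 (μ := volume)).toLp g) := by
  set f := (g.memLp 2 (μ := volume)).toLp g with hf
  refine ⟨‖XX f‖ + 2 * π * ‖XX (FT f)‖, fun h => ?_, fun h => ?_⟩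
  · refine (S_le (schw_DX g) h).trans ?_
    rw [mul_comm]; gcongr
    have : 0 ≤ 2 * π * ‖XX (FT f)‖ := by positivity
    linarith
  · rw [Str_apply, ← FT.norm_map, map_sub, FT_tr]
    refine (S_le (schw_FT g) _).trans ?_
    rw [abs_mul, abs_of_nonneg (by positivity : 0 ≤ 2 * π)]
    have := norm_nonneg (XX f)
    nlinarith [abs_nonneg h, mul_nonneg this (abs_nonneg h)]

lemma inner_ext {a b : HH} (H : ∀ χ C, Cls C χ → inner ℂ χ a = inner ℂ χ b) : a = b := by
  have key : ∀ χ : HH, inner ℂ χ (a - b) = 0 := by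
    intro χ
    apply DenseRange.induction_on (p := fun χ => inner ℂ χ (a - b) = 0)
      (SchwartzMap.denseRange_toLpCLM (p := 2) (μ := volume) ENNReal.ofNat_ne_top) χ
    · exact isClosed_eq (by fun_prop) continuous_const
    · intro g
      obtain ⟨C, hC⟩ := schw_Cls g
      have := H _ C hC
      rw [inner_sub_right]
      exact sub_eq_zero.2 this
  exact sub_eq_zero.1 (inner_self_eq_zero.1 (key (a - b)))

lemma L1_le {g : HH} (h : DX g) : ∫ x, ‖g x‖ ≤ 4 * (‖g‖ + ‖XX g‖) := by
  obtain ⟨i1, e1⟩ := XX_normsq h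
  have i0 := HH_integrable_sq g
  have e0 := HH_normsq g
  set S := ‖g‖ + ‖XX g‖ with hS
  rcases (show 0 ≤ S by positivity).eq_or_lt with h0 | h0
  · have hg : ‖g‖ = 0 := by have := norm_nonneg g; have := norm_nonneg (XX g); linarith
    rw [norm_eq_zero] at hg
    have : (fun x => ‖g x‖) =ᵐ[volume] fun _ => 0 := by
      rw [hg]; filter_upwards [Lp.coeFn_zero ℂ 2 (volume : Measure ℝ)] with x hx; rw [hx]; simp
    rw [integral_congr_ae this, ← h0]; simp
  · have hp : ∀ x, ‖g x‖ ≤ S * (1 + x ^ 2)⁻¹ + (4 * S)⁻¹ * (‖g x‖ ^ 2 + x ^ 2 * ‖g x‖ ^ 2) := by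
      intro x
      have hq : 0 < 1 + x ^ 2 := by positivity
      have : S * (1 + x ^ 2)⁻¹ + (4 * S)⁻¹ * (‖g x‖ ^ 2 + x ^ 2 * ‖g x‖ ^ 2) - ‖g x‖
        = (4 * S * (1 + x ^ 2))⁻¹ * (2 * S - (1 + x ^ 2) * ‖g x‖) ^ 2 := by field_simp; ring
      have h2 : 0 ≤ (4 * S * (1 + x ^ 2))⁻¹ * (2 * S - (1 + x ^ 2) * ‖g x‖) ^ 2 := by positivity
      linarith
    calc ∫ x, ‖g x‖ ≤ ∫ x, (S * (1 + x ^ 2)⁻¹ + (4 * S)⁻¹ * (‖g x‖ ^ 2 + x ^ 2 * ‖g x‖ ^ 2)) :=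
          integral_mono (DX_integrable h).norm ((integrable_inv_one_add_sq.const_mul _).add ((i0.add i1).const_mul _)) hp
      _ = S * π + (4 * S)⁻¹ * (‖g‖ ^ 2 + ‖XX g‖ ^ 2) := by
          have i2 : Integrable (fun x => ‖g x‖ ^ 2 + x ^ 2 * ‖g x‖ ^ 2) := i0.add i1
          rw [integral_add (integrable_inv_one_add_sq.const_mul _) (i2.const_mul _), integral_const_mul,
            integral_const_mul, integral_univ_inv_one_add_sq, integral_add i0 i1, e0, e1]
      _ ≤ S * π + (4 * S)⁻¹ * S ^ 2 := by
          gcongr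
          rw [hS]; nlinarith [norm_nonneg g, norm_nonneg (XX g)]
      _ = S * (π + 1/4) := by field_simp
      _ ≤ 4 * S := by nlinarith [Real.pi_lt_d2]

end NLS
end

noncomputable section
open MeasureTheory Real Filter Topology Set
open scoped ENNReal NNReal FourierTransform SchwartzMap ContDiff
set_option linter.unusedVariables false

namespace NLS

variable {α lam : ℝ} {v : ℝ → ℝ → ℂ}

namespace Raw

lemma one_le (R : Raw α lam v) : 1 ≤ α := by linarith [R.hα]

lemma F_le (R : Raw α lam v) {m : ℝ} {z : ℂ} (hz : ‖z‖ ≤ m) : ‖Fn α z‖ ≤ m ^ α * ‖z‖ := by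
  have hα := R.hα
  rw [← Fm_eq hz]
  exact norm_Fm_le (by linarith) ((norm_nonneg _).trans hz) _

lemma F_int (R : Raw α lam v) {t : ℝ} (ht : 0 < t) : Integrable (fun y => Fn α (v t y)) := by
  obtain ⟨m, hm, h⟩ := R.Linfty (T := t) ht
  refine ((R.v_int ht.le).norm.const_mul (m ^ α)).mono'
    ((continuous_Fn (by linarith [R.hα])).comp_aestronglyMeasurable (R.meas ht.le))
    (Eventually.of_forall fun x => R.F_le (h t ⟨le_rfl, le_rfl⟩ x))

lemma F_mem (R : Raw α lam v) {t : ℝ} (ht : 0 < t) : MemLp (fun y => Fn α (v t y)) 2 := by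
  obtain ⟨m, hm, h⟩ := R.Linfty (T := t) ht
  refine (R.mem ht.le).of_le_mul (c := m ^ α)
    ((continuous_Fn (by linarith [R.hα])).comp_aestronglyMeasurable (R.meas ht.le))
    (Eventually.of_forall fun x => R.F_le (h t ⟨le_rfl, le_rfl⟩ x))

open Classical in
def GG (R : Raw α lam v) (t : ℝ) : HH := if h : 0 < t then (R.F_mem h).toLp _ else 0

lemma GG_eq (R : Raw α lam v) {t m : ℝ} (ht : 0 < t) (hm : 0 ≤ m) (h : ∀ᵐ x, ‖R.f t x‖ ≤ m) :
    R.GG t = FH α m R.one_le hm (R.f t) := by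
  rw [GG, dif_pos ht]
  apply Lp.ext
  filter_upwards [MemLp.coeFn_toLp (R.F_mem ht), FH_ae R.one_le hm (R.f t), R.f_ae ht.le, h] with x h1 h2 h3 h4
  rw [h1, h2, Fm_eq h4, h3]

lemma f_bdd (R : Raw α lam v) {δ T : ℝ} (hδ : 0 < δ) :
    ∃ m, 0 ≤ m ∧ ∀ t ∈ Icc δ T, ∀ᵐ x, ‖R.f t x‖ ≤ m := by
  obtain ⟨m, hm, h⟩ := R.Linfty (T := T) hδ
  refine ⟨m, hm, fun t ht => ?_⟩
  filter_upwards [R.f_ae (hδ.le.trans ht.1)] with x hx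
  rw [hx]; exact h t ht x

lemma nhds_Icc {t : ℝ} (ht : 0 < t) : Icc (t/2) (2*t) ∈ 𝓝 t := Icc_mem_nhds (by linarith) (by linarith)

lemma GG_cont (R : Raw α lam v) {t : ℝ} (ht : 0 < t) : ContinuousAt R.GG t := by
  have hα := R.one_le
  obtain ⟨m, hm, h⟩ := R.f_bdd (T := 2 * t) (half_pos ht)
  have h1 : (fun s => FH α m R.one_le hm (R.f s)) =ᶠ[𝓝 t] R.GG := by
    filter_upwards [nhds_Icc ht] with s hs
    exact (R.GG_eq (lt_of_lt_of_le (half_pos ht) hs.1) hm (h s hs)).symm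
  refine ContinuousAt.congr ?_ h1
  have : LipschitzWith (Real.toNNReal ((α + 1) * m ^ α)) (FH α m R.one_le hm) := by
    apply LipschitzWith.of_dist_le_mul
    intro f g
    rw [dist_eq_norm, dist_eq_norm, Real.coe_toNNReal _ (by positivity)]
    exact FH_lip _ _ _ _
  exact (this.continuous.comp R.f_cont).continuousAt

/-- continuity of the nonlinear term in L1 -/
lemma F_L1 (R : Raw α lam v) {t : ℝ} (ht : 0 < t) :
    Tendsto (fun s => ∫ y, ‖Fn α (v s y) - Fn α (v t y)‖) (𝓝 t) (𝓝 0) := by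
  have hα := R.one_le
  obtain ⟨m, hm, h⟩ := R.Linfty (T := 2 * t) (half_pos ht)
  have h0 : Tendsto (fun s => (α + 1) * m ^ α * (4 * (‖R.f s - R.f t‖ + ‖XX (R.f s) - XX (R.f t)‖))) (𝓝 t) (𝓝 0) := by
    have h1 := tendsto_iff_norm_sub_tendsto_zero.1 (R.f_cont.tendsto t)
    have h2 := tendsto_iff_norm_sub_tendsto_zero.1 (R.xf_cont.tendsto t)
    simpa using (((h1.add h2).const_mul 4).const_mul ((α + 1) * m ^ α))
  refine squeeze_zero' (Eventually.of_forall fun s => integral_nonneg fun y => norm_nonneg _) ?_ h0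
  filter_upwards [nhds_Icc ht] with s hs
  have hs0 : 0 < s := lt_of_lt_of_le (half_pos ht) hs.1
  obtain ⟨d1, d2⟩ := XX_sub (R.f_DX s) (R.f_DX t)
  have h3 := L1_le d1
  rw [d2] at h3
  have h4 : ∫ y, ‖Fn α (v s y) - Fn α (v t y)‖ ≤ ∫ y, (α + 1) * m ^ α * ‖(R.f s - R.f t : HH) y‖ := by
    refine integral_mono_ae ((R.F_int hs0).sub (R.F_int ht)).norm ((DX_integrable d1).norm.const_mul _) ?_
    filter_upwards [Lp.coeFn_sub (R.f s) (R.f t), R.f_ae hs0.le, R.f_ae ht.le] with x e1 e2 e3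
    simp only [e1, Pi.sub_apply, e2, e3]
    exact Fn_lip R.one_le (h s hs x) (h t ⟨by linarith, by linarith⟩ x)
  rw [integral_const_mul] at h4
  refine h4.trans ?_
  gcongr

lemma sg_tau_cont (R : Raw α lam v) {t s : ℝ} (hs : 0 < s) (hst : s < t) (x : ℝ) :
    ContinuousAt (fun τ => sg (t - τ) (fun y => Fn α (v τ y)) x) s := by
  unfold sg
  apply ContinuousAt.mul
  · have h1 : ContinuousAt (fun z : ℂ => z ^ (-(1:ℂ)/2)) (((4 * π * (t - s) : ℝ) : ℂ) * Complex.I) := by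
      apply continuousAt_cpow_const
      right
      simp [Complex.mul_im]
      exact sub_ne_zero.2 hst.ne'
    exact ContinuousAt.comp (f := fun τ : ℝ => ((4 * π * (t - τ) : ℝ) : ℂ) * Complex.I) h1 (by fun_prop)
  · have hF := R.F_int hs
    set J1 : ℝ → ℂ := fun τ => ∫ y, phf (1 / (4 * (t - τ))) 0 0 (x - y) * Fn α (v s y) with hJ1
    have h1 : ContinuousAt J1 s := by
      have hd : ContinuousAt (fun τ => 1 / (4 * (t - τ))) s :=
        ContinuousAt.div continuousAt_const (by fun_prop) (by linarith : 4 * (t - s) ≠ 0)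
      apply tendsto_integral_filter_of_dominated_convergence (fun y => ‖Fn α (v s y)‖)
      · exact Eventually.of_forall fun τ =>
          ((cont_phf _ 0 0).comp (by fun_prop : Continuous fun y => x - y)).aestronglyMeasurable.mul hF.1
      · exact Eventually.of_forall fun τ => Eventually.of_forall fun y => by rw [norm_mul, norm_phf, one_mul]
      · exact hF.norm
      · refine Eventually.of_forall fun y => Tendsto.mul_const _ ?_
        have : Continuous fun a : ℝ => phf a 0 0 (x - y) := by unfold phf; fun_prop
        exact (this.tendsto _).comp hd
    have h2 : Tendsto (fun τ => (∫ y, phf (1 / (4 * (t - τ))) 0 0 (x - y) * Fn α (v τ y)) - J1 τ) (𝓝 s) (𝓝 0) := by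
      apply squeeze_zero_norm' _ (R.F_L1 hs)
      filter_upwards [Ioi_mem_nhds hs] with τ hτ
      have hk : ∀ {φ : ℝ → ℂ}, Integrable φ → Integrable fun y => phf (1 / (4 * (t - τ))) 0 0 (x - y) * φ y := by
        intro φ hφ
        exact hφ.bdd_mul (c := 1)
          ((cont_phf _ 0 0).comp (by fun_prop : Continuous fun y => x - y)).aestronglyMeasurable
          (Eventually.of_forall fun y => (norm_phf _ _ _ _).le)
      rw [hJ1, ← integral_sub (hk (R.F_int hτ)) (hk hF)]
      refine (norm_integral_le_integral_norm _).trans (le_of_eq (integral_congr_ae (Eventually.of_forall fun y => ?_)))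
      simp only
      rw [← mul_sub, norm_mul, norm_phf, one_mul]
    have h3 := h2.add h1
    simp only [sub_add_cancel, zero_add] at h3
    exact h3

lemma K_fin (R : Raw α lam v) {t : ℝ} (ht : 0 < t) :
    ∫⁻ τ in Ioo 0 t, ENNReal.ofReal ((t - τ) ^ (-(1/2:ℝ))) * R.NN τ < ⊤ := by
  have hα := R.hα
  have hsub : Ioo 0 t ⊆ Ioc 0 (t/2) ∪ Ioo (t/2) t := by
    intro x hx
    rcases le_or_gt x (t/2) with h | h
    · exact Or.inl ⟨hx.1, h⟩
    · exact Or.inr ⟨h, hx.2⟩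
  refine (lintegral_mono_set hsub).trans_lt ?_
  refine (lintegral_union_le _ _ _).trans_lt (ENNReal.add_lt_top.2 ⟨?_, ?_⟩)
  · have hss : Ioc 0 (t/2) ⊆ Ioo 0 t := fun x hx => ⟨hx.1, by linarith [hx.2]⟩
    calc _ ≤ ∫⁻ τ in Ioc 0 (t/2), ENNReal.ofReal ((t/2) ^ (-(1/2:ℝ))) * R.NN τ := by
          refine setLIntegral_mono' measurableSet_Ioc fun τ hτ => ?_
          gcongr ?_ * _
          exact ENNReal.ofReal_le_ofReal
            (Real.rpow_le_rpow_of_nonpos (by linarith) (by linarith [hτ.2]) (by norm_num))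
      _ = ENNReal.ofReal ((t/2) ^ (-(1/2:ℝ))) * ∫⁻ τ in Ioc 0 (t/2), R.NN τ := lintegral_const_mul _ R.NN_meas
      _ < ⊤ := ENNReal.mul_lt_top ENNReal.ofReal_lt_top
          ((lintegral_mono_set hss).trans_lt (R.NN_int t))
  · obtain ⟨m, hm, h⟩ := R.Linfty (T := t) (half_pos ht)
    obtain ⟨C, hC, hM⟩ := R.mass t
    have hN : ∀ τ ∈ Ioo (t/2) t, R.NN τ ≤ ENNReal.ofReal m ^ (α - 1) * C := by
      intro τ hτ
      have h0 : 0 ≤ τ := by linarith [hτ.1]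
      calc R.NN τ = ∫⁻ x, ‖v τ x‖ₑ ^ (α + 1) := R.LL_v h0 _
        _ ≤ ∫⁻ x, ENNReal.ofReal m ^ (α - 1) * ‖v τ x‖ₑ ^ (2:ℝ) := by
            refine lintegral_mono fun x => ?_
            rw [show α + 1 = (α - 1) + 2 by ring, ENNReal.rpow_add_of_nonneg _ _ (by linarith) (by norm_num)]
            gcongr ?_ * _
            refine ENNReal.rpow_le_rpow ?_ (by linarith)
            rw [← ofReal_norm]
            exact ENNReal.ofReal_le_ofReal (h τ ⟨hτ.1.le, hτ.2.le⟩ x)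
        _ = ENNReal.ofReal m ^ (α - 1) * LL 2 (R.f τ) := by
            rw [lintegral_const_mul' _ _ (ENNReal.rpow_ne_top_of_nonneg (by linarith) ENNReal.ofReal_ne_top), R.LL_v h0]
        _ ≤ _ := by gcongr; exact hM τ ⟨h0, hτ.2.le⟩
    have hBt : ENNReal.ofReal m ^ (α - 1) * C < ⊤ :=
      ENNReal.mul_lt_top (ENNReal.rpow_lt_top_of_nonneg (by linarith) ENNReal.ofReal_ne_top) hC
    set B := ENNReal.ofReal m ^ (α - 1) * C with hB
    have hb := beta_bound (ρ := t/2) (t := t) (β := 0) (by linarith) le_rfl (by norm_num)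
    calc _ ≤ ∫⁻ τ in Ioo (t/2) t, (ENNReal.ofReal (t ^ (1/4:ℝ)) * B) *
            ENNReal.ofReal ((t - τ) ^ (-(3/4:ℝ)) * (τ - t/2) ^ (-(0:ℝ))) := by
          refine setLIntegral_mono' measurableSet_Ioo fun τ hτ => ?_
          have hp : 0 < t - τ := by linarith [hτ.2]
          have : (t - τ) ^ (-(1/2:ℝ)) ≤ t ^ (1/4:ℝ) * ((t - τ) ^ (-(3/4:ℝ)) * (τ - t/2) ^ (-(0:ℝ))) := by
            rw [neg_zero, Real.rpow_zero, mul_one, show -(1/2:ℝ) = 1/4 + -(3/4) by norm_num, Real.rpow_add hp]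
            gcongr
            linarith [hτ.1]
          calc _ ≤ ENNReal.ofReal (t ^ (1/4:ℝ) * ((t - τ) ^ (-(3/4:ℝ)) * (τ - t/2) ^ (-(0:ℝ)))) * B := by
                gcongr; exact hN τ hτ
            _ = _ := by rw [ENNReal.ofReal_mul (by positivity)]; ring
      _ = (ENNReal.ofReal (t ^ (1/4:ℝ)) * B) * ∫⁻ τ in Ioo (t/2) t, 
            ENNReal.ofReal ((t - τ) ^ (-(3/4:ℝ)) * (τ - t/2) ^ (-(0:ℝ))) :=
          lintegral_const_mul' _ _ (ENNReal.mul_lt_top ENNReal.ofReal_lt_top hBt).ne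
      _ < ⊤ := ENNReal.mul_lt_top (ENNReal.mul_lt_top ENNReal.ofReal_lt_top hBt)
          (hb.trans_lt ENNReal.ofReal_lt_top)

end Raw
end NLS
end

noncomputable section
open MeasureTheory Real Filter Topology Set
open scoped ENNReal NNReal FourierTransform SchwartzMap ContDiff
set_option linter.unusedVariables false

namespace NLS

variable {α lam : ℝ} {v : ℝ → ℝ → ℂ}

namespace Raw

/-- cut-off Duhamel integrand -/
def ww (R : Raw α lam v) (t x τ : ℝ) : ℂ :=
  (Ioo 0 t).indicator (fun τ => sg (t - τ) (fun y => Fn α (v τ y)) x) τ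

lemma ww_meas (R : Raw α lam v) (t : ℝ) : StronglyMeasurable (Function.uncurry (R.ww t)) := by
  apply stronglyMeasurable_uncurry_of_continuous_of_stronglyMeasurable
  · intro τ
    by_cases hτ : τ ∈ Ioo 0 t
    · simp only [ww, indicator_of_mem hτ]; exact sg_continuous _ _
    · simp only [ww, indicator_of_notMem hτ]; exact continuous_const
  · intro x
    have hc : ContinuousOn (fun τ => sg (t - τ) (fun y => Fn α (v τ y)) x) (Ioo 0 t) :=
      fun τ hτ => (R.sg_tau_cont hτ.1 hτ.2 x).continuousWithinAt
    classical
    have h1 := hc.measurable_piecewise (g := (0 : ℝ → ℂ)) continuousOn_const measurableSet_Ioo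
    rw [Set.piecewise_eq_indicator] at h1
    exact h1.stronglyMeasurable

lemma ww_int (R : Raw α lam v) {t : ℝ} (ht : 0 < t) {ψ : HH} (hψ : Integrable ψ) :
    Integrable (fun z : ℝ × ℝ => R.ww t z.1 z.2 * (starRingEnd ℂ) (ψ z.1)) (volume.prod volume) := by
  have hα := R.hα
  refine ⟨(R.ww_meas t).aestronglyMeasurable.mul
    ((Complex.continuous_conj.comp_aestronglyMeasurable hψ.1).comp_fst), ?_⟩
  set K : ℝ → ℝ≥0∞ := (Ioo 0 t).indicator fun τ => ENNReal.ofReal ((t - τ) ^ (-(1/2:ℝ))) * R.NN τ with hK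
  have hb : ∀ x τ, ‖R.ww t x τ‖ₑ ≤ K τ := by
    intro x τ
    by_cases hτ : τ ∈ Ioo 0 t
    · simp only [ww, hK, indicator_of_mem hτ]
      refine (sg_bound (by linarith [hτ.2]) _ x).trans (le_of_eq ?_)
      congr 1
      rw [NN, R.LL_v hτ.1.le]
      refine lintegral_congr fun y => ?_
      rw [← ofReal_norm, norm_Fn (by linarith), ← ENNReal.ofReal_rpow_of_nonneg (norm_nonneg _) (by linarith), ofReal_norm]
    · simp [ww, hK, indicator_of_notMem hτ]
  have hKm : Measurable K := by
    refine Measurable.indicator (Measurable.mul ?_ R.NN_meas) measurableSet_Ioo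
    fun_prop
  calc ∫⁻ z, ‖R.ww t z.1 z.2 * (starRingEnd ℂ) (ψ z.1)‖ₑ ∂(volume.prod volume)
      ≤ ∫⁻ z : ℝ × ℝ, ‖ψ z.1‖ₑ * K z.2 ∂(volume.prod volume) := by
        refine lintegral_mono fun z => ?_
        rw [enorm_mul, mul_comm, RCLike.enorm_conj]
        gcongr
        exact hb _ _
    _ = (∫⁻ x, ‖ψ x‖ₑ) * ∫⁻ τ, K τ := lintegral_prod_mul hψ.1.enorm hKm.aemeasurable
    _ < ⊤ := by
        refine ENNReal.mul_lt_top hψ.2 ?_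
        rw [hK, lintegral_indicator measurableSet_Ioo]
        exact R.K_fin ht

lemma GG_sg (R : Raw α lam v) {t τ : ℝ} (h : τ ∈ Ioo 0 t) :
    UU (t - τ) (R.GG τ) =ᵐ[volume] fun x => R.ww t x τ := by
  rw [GG, dif_pos h.1]
  have := sg_ae (t := t - τ) (by linarith [h.2]) (R.F_int h.1) (R.F_mem h.1)
  filter_upwards [this] with x hx
  rw [hx, ww, indicator_of_mem h]

lemma weak_ww (R : Raw α lam v) {t τ : ℝ} (ψ : HH) :
    (∫ x, R.ww t x τ * (starRingEnd ℂ) (ψ x)) =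
      (Ioo 0 t).indicator (fun τ => inner ℂ ψ (UU (t - τ) (R.GG τ))) τ := by
  by_cases hτ : τ ∈ Ioo 0 t
  · rw [indicator_of_mem hτ, L2.inner_def]
    apply integral_congr_ae
    filter_upwards [R.GG_sg hτ] with x hx
    rw [RCLike.inner_apply, hx]
  · rw [indicator_of_notMem hτ]
    simp [ww, indicator_of_notMem hτ]

lemma weak_duh (R : Raw α lam v) {t : ℝ} (ht : 0 < t) {ψ : HH} (hψ : Integrable ψ) :
    IntegrableOn (fun τ => inner ℂ ψ (UU (t - τ) (R.GG τ))) (Ioo 0 t) ∧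
    inner ℂ ψ (R.f t) = inner ℂ ψ (UU t (R.f 0)) +
      Complex.I * (lam : ℂ) * ∫ τ in Ioo 0 t, inner ℂ ψ (UU (t - τ) (R.GG τ)) := by
  have hI := R.ww_int ht hψ
  constructor
  · have h1 := hI.integral_prod_right
    simp only [R.weak_ww] at h1
    exact (integrable_indicator_iff measurableSet_Ioo).1 h1
  · have e0 : UU t (R.f 0) =ᵐ[volume] sg t (v 0) := by
      have h0 : R.f 0 = (R.mem le_rfl).toLp (v 0) :=
        Lp.ext ((R.f_ae le_rfl).trans (MemLp.coeFn_toLp _).symm)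
      rw [h0]
      exact sg_ae ht.ne' (R.v_int le_rfl) (R.mem le_rfl)
    have e1 : ∀ x, v t x = sg t (v 0) x + Complex.I * (lam : ℂ) * ∫ τ, R.ww t x τ := by
      intro x
      rw [R.duh t ht x, intervalIntegral.integral_of_le ht.le, integral_Ioc_eq_integral_Ioo]
      congr 2
      exact (integral_indicator measurableSet_Ioo).symm
    have i1 : Integrable (fun x => inner ℂ (ψ x) (UU t (R.f 0) x)) := L2.integrable_inner ψ _
    have i2 := hI.integral_prod_left
    simp only at i2
    rw [L2.inner_def, L2.inner_def]
    have e2 : (fun x => inner ℂ (ψ x) (R.f t x)) =ᵐ[volume] fun x => inner ℂ (ψ x) (UU t (R.f 0) x) +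
        Complex.I * (lam : ℂ) * ∫ τ, R.ww t x τ * (starRingEnd ℂ) (ψ x) := by
      filter_upwards [R.f_ae ht.le, e0] with x h1 h2
      rw [RCLike.inner_apply, RCLike.inner_apply, h1, h2, e1 x, integral_mul_const]; ring
    rw [integral_congr_ae e2, integral_add i1 (i2.const_mul _), integral_const_mul,
      integral_integral_swap hI]
    simp only [R.weak_ww]
    rw [integral_indicator measurableSet_Ioo]

/-- profile -/
def pf (R : Raw α lam v) (t : ℝ) : HH := UU (-t) (R.f t)

lemma UU_pf (R : Raw α lam v) (t : ℝ) : UU t (R.pf t) = R.f t := UU_neg' _ _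

def gg (R : Raw α lam v) (t : ℝ) : HH := UU (-t) (R.GG t)

lemma gg_cont (R : Raw α lam v) {t : ℝ} (ht : 0 < t) : ContinuousAt R.gg t :=
  UU_tendsto (continuous_neg.tendsto t) (R.GG_cont ht)

lemma weak_pf (R : Raw α lam v) {t : ℝ} (ht : 0 < t) {χ : HH} {C : ℝ} (hχ : Cls C χ) :
    IntegrableOn (fun τ => inner ℂ χ (R.gg τ)) (Ioo 0 t) ∧
    inner ℂ χ (R.pf t) = inner ℂ χ (R.f 0) +
      Complex.I * (lam : ℂ) * ∫ τ in Ioo 0 t, inner ℂ χ (R.gg τ) := by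
  have h := R.weak_duh ht (DX_integrable (hχ.DX_UU t))
  have e1 : ∀ g : HH, inner ℂ (UU t χ) g = inner ℂ χ (UU (-t) g) := by
    intro g
    rw [← (UU t).inner_map_map χ, UU_neg']
  have e2 : ∀ τ, inner ℂ (UU t χ) (UU (t - τ) (R.GG τ)) = inner ℂ χ (R.gg τ) := by
    intro τ
    rw [e1, UU_UU, gg]; congr 3; ring
  simp only [e2] at h
  refine ⟨h.1, ?_⟩
  rw [e1, e1, UU_neg] at h
  exact h.2

lemma pf_sub (R : Raw α lam v) {s t : ℝ} (hs : 0 < s) (hst : s ≤ t) :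
    R.pf t - R.pf s = (Complex.I * (lam : ℂ)) • ∫ τ in s..t, R.gg τ := by
  have hgi : IntervalIntegrable R.gg volume s t := by
    apply ContinuousOn.intervalIntegrable
    rw [uIcc_of_le hst]
    exact fun τ hτ => (R.gg_cont (lt_of_lt_of_le hs hτ.1)).continuousWithinAt
  apply inner_ext
  intro χ C hχ
  obtain ⟨i1, h1⟩ := R.weak_pf hs hχ
  obtain ⟨i2, h2⟩ := R.weak_pf (hs.trans_le hst) hχ
  rw [inner_sub_right, h1, h2, inner_smul_right]
  have e : inner ℂ χ (∫ τ in s..t, R.gg τ) = ∫ τ in s..t, inner ℂ χ (R.gg τ) :=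
    ((innerSL ℂ χ).intervalIntegral_comp_comm hgi).symm
  have j1 : IntervalIntegrable (fun τ => inner ℂ χ (R.gg τ)) volume 0 s :=
    (intervalIntegrable_iff_integrableOn_Ioo_of_le hs.le).2 i1
  have j2 : IntervalIntegrable (fun τ => inner ℂ χ (R.gg τ)) volume 0 t :=
    (intervalIntegrable_iff_integrableOn_Ioo_of_le (hs.le.trans hst)).2 i2
  rw [e, ← intervalIntegral.integral_interval_sub_left j2 j1, intervalIntegral.integral_of_le hs.le,
    intervalIntegral.integral_of_le (hs.le.trans hst), integral_Ioc_eq_integral_Ioo, integral_Ioc_eq_integral_Ioo]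
  ring

lemma pf_der (R : Raw α lam v) {t : ℝ} (ht : 0 < t) :
    HasDerivAt R.pf ((Complex.I * (lam : ℂ)) • R.gg t) t := by
  have hc : ∀ τ, t/2 ≤ τ → ContinuousAt R.gg τ := fun τ hτ => R.gg_cont (by linarith)
  have hgi : ∀ b, t/2 ≤ b → IntervalIntegrable R.gg volume (t/2) b := by
    intro b hb
    apply ContinuousOn.intervalIntegrable
    rw [uIcc_of_le hb]
    exact fun τ hτ => (hc τ hτ.1).continuousWithinAt
  have hd : HasDerivAt (fun b => ∫ τ in (t/2)..b, R.gg τ) (R.gg t) t := by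
    refine intervalIntegral.integral_hasDerivAt_right (hgi t (by linarith)) ?_ (R.gg_cont ht)
    have : ContinuousOn R.gg (Ioi 0) := fun τ hτ => (R.gg_cont hτ).continuousWithinAt
    exact this.stronglyMeasurableAtFilter isOpen_Ioi _ ht
  have h2 := (hd.const_smul (Complex.I * (lam : ℂ))).const_add (R.pf (t/2))
  refine h2.congr_of_eventuallyEq ?_
  filter_upwards [Ioi_mem_nhds (by linarith : t/2 < t)] with b hb
  have := R.pf_sub (half_pos ht) (le_of_lt hb)
  simp only [Pi.smul_apply]
  rw [← this]; abel

lemma flow (R : Raw α lam v) : Flow α lam R.pf where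
  hα := R.one_le
  hl := R.hl
  bdd := by
    intro δ T hδ
    simp only [R.UU_pf]
    exact R.f_bdd hδ
  der := by
    intro t ht m hm h
    rw [R.UU_pf] at h ⊢
    rw [← R.GG_eq ht hm h]
    exact R.pf_der ht

end Raw
end NLS
end

noncomputable section
open MeasureTheory Real Filter Topology Set
open scoped ENNReal NNReal FourierTransform SchwartzMap ContDiff
set_option linter.unusedVariables false

namespace NLS

variable {α lam : ℝ} {v : ℝ → ℝ → ℂ}

lemma UU_gal (t a h : ℝ) (g : HH) : UU t (gal a h g) = gal (t + a) h (UU t g) := by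
  have h1 : gal a h g = UU a (ph 0 (2 * π * h) 0 (UU (-a) g)) := by rw [UU_ph, UU_neg']
  rw [h1, UU_UU, UU_ph, UU_UU]
  congr 2; ring

def Sgal (a h : ℝ) : HH →L[ℂ] HH := (gal a h).toContinuousLinearMap - ContinuousLinearMap.id ℂ HH
lemma Sgal_apply (a h : ℝ) (f : HH) : Sgal a h f = gal a h f - f := rfl

lemma good_gal (a h : ℝ) : Good (Sgal a h) := by
  intro α m hα hm t u
  have e : ∀ w : HH, ‖Sgal a h (UU (-t) w)‖ = ‖gal (t + a) h w - w‖ := by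
    intro w
    have : gal a h (UU (-t) w) = UU (-t) (gal (t + a) h w) := by rw [UU_gal]; congr 2; ring
    rw [Sgal_apply, this, ← map_sub, LinearIsometry.norm_map]
  rw [e, e, ← FH_gal]
  exact FH_lip _ _ _ _

namespace Raw

lemma gal_DX (R : Raw α lam v) (t h : ℝ) :
    ‖gal (-t) h (R.pf t) - R.pf t‖ ≤ (2 * π * ‖XX (R.f t)‖) * |h| := by
  rw [← gal_neg_UU, R.UU_pf]
  refine (S_le (R.f_DX t) _).trans (le_of_eq ?_)
  rw [abs_mul, abs_of_nonneg (by positivity : 0 ≤ 2 * π)]; ring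

lemma cls2 (R : Raw α lam v) : ∃ C, Cls C (R.pf 2) := by
  obtain ⟨L, B, hL, hB, hev⟩ := R.flow.evol_const (s := 1) (T := 2) one_pos one_le_two
  set g := R.pf 2 with hg
  have hA : ∀ h, ‖gal (-1) h g - g‖ ≤ (B * (2 * π * ‖XX (R.f 1)‖)) * |h| := by
    intro h
    have h1 := (hev _ (good_gal (-1) h)).1 2 ⟨one_le_two, le_rfl⟩
    rw [Sgal_apply, Sgal_apply] at h1
    refine h1.trans ?_
    rw [mul_assoc]
    gcongr
    exact R.gal_DX 1 h
  have hB2 := R.gal_DX 2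
  rw [← hg] at hB2
  set C1 := B * (2 * π * ‖XX (R.f 1)‖) with hC1
  set C2 := 2 * π * ‖XX (R.f 2)‖ with hC2
  set C3 := C1 + C2 + √(8 * π ^ 2 * |-1|) * ‖g‖ + √(8 * π ^ 2 * |-2|) * ‖g‖ with hC3
  have htr : ∀ h, ‖Str (4 * π * h) g‖ ≤ C3 * |h| := by
    intro h
    have h1 := gal_split (-1) h g
    have h2 := gal_split (-2) h g
    have p1 := phase_le' (-1) h (tr (4 * π * h) g)
    have p2 := phase_le' (-2) h (tr (8 * π * h) g)
    rw [LinearIsometry.norm_map] at p1 p2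
    rw [show -(4 * π * (-1) * h) = 4 * π * h by ring] at h1
    rw [show -(4 * π * (-2) * h) = 8 * π * h by ring] at h2
    set a := tr (4 * π * h) g with ha
    set b := tr (8 * π * h) g with hb
    set a' := ph 0 0 (-(4 * π ^ 2 * (-1) * h ^ 2)) a
    set b' := ph 0 0 (-(4 * π ^ 2 * (-2) * h ^ 2)) b
    have h3 : ‖b' - a'‖ ≤ (C1 + C2) * |h| := by
      rw [← LinearIsometry.norm_map (ph 0 (2 * π * h) 0), map_sub, ← h1, ← h2]
      have e : gal (-2) h g - gal (-1) h g = (gal (-2) h g - g) - (gal (-1) h g - g) := by abel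
      rw [e]
      refine (norm_sub_le _ _).trans ?_
      have := hA h
      have := hB2 h
      linarith
    have h4 : Str (4 * π * h) a = b - a := by
      rw [Str_apply, ha, tr_tr, hb]; congr 3; ring
    have h5 : ‖Str (4 * π * h) g‖ = ‖b - a‖ := by
      rw [← h4, ha, Str_apply, Str_apply, ← map_sub, LinearIsometry.norm_map]
    rw [h5]
    have e : b - a = (b' - a') - (b' - b) + (a' - a) := by abel
    rw [e]
    refine (norm_add_le _ _).trans ((add_le_add_left (norm_sub_le _ _) _).trans ?_)
    rw [hC3]; linarith
  refine ⟨|C3 / (4 * π)| + |(√(8 * π ^ 2 * |-1|) * ‖g‖ + C3 + C1) / (2 * π)|, fun k => ?_, fun k => ?_⟩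
  · have h1 := gal_diff (-1) (k / (2 * π)) g
    have h2 := hA (k / (2 * π))
    have h3 := htr (k / (2 * π))
    rw [show -(4 * π * (-1) * (k / (2 * π))) = 4 * π * (k / (2 * π)) by ring] at h1
    rw [mul_div_cancel₀ _ (by positivity : (2 * π) ≠ 0)] at h1
    rw [Sph_apply]
    have e : ph 0 k 0 g - g = (gal (-1) (k / (2 * π)) g - g) - (gal (-1) (k / (2 * π)) g - ph 0 k 0 g) := by abel
    rw [e]
    refine (norm_sub_le _ _).trans ?_
    have h4 : |k / (2 * π)| = |k| / (2 * π) := by rw [abs_div, abs_of_nonneg (by positivity : 0 ≤ 2 * π)]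
    rw [h4] at h1 h2 h3
    calc _ ≤ (√(8 * π ^ 2 * |-1|) * ‖g‖ + C3 + C1) * (|k| / (2 * π)) := by linarith
      _ = ((√(8 * π ^ 2 * |-1|) * ‖g‖ + C3 + C1) / (2 * π)) * |k| := by ring
      _ ≤ _ := by
        gcongr
        exact (le_abs_self _).trans (le_add_of_nonneg_left (abs_nonneg _))
  · have h3 := htr (k / (4 * π))
    rw [mul_div_cancel₀ _ (by positivity : (4 * π) ≠ 0), abs_div, abs_of_nonneg (by positivity : 0 ≤ 4 * π)] at h3
    calc _ ≤ _ := h3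
      _ = (C3 / (4 * π)) * |k| := by ring
      _ ≤ _ := by
        gcongr
        exact (le_abs_self _).trans (le_add_of_nonneg_right (abs_nonneg _))

lemma nu_small (R : Raw α lam v) : ∃ K : ℝ, 0 < K ∧ ∀ T, ∃ t, T ≤ t ∧ 0 < t ∧
    R.nu t ≤ ENNReal.ofReal (K * t ^ (-(1 / (α + 1)))) := by
  obtain ⟨A, hA, h⟩ := R.dec
  have hα := R.hα
  set p := 1 / (α + 1) with hp
  have hp0 : 0 < p := by positivity
  refine ⟨(A.toReal + 1) * 2 ^ p, by positivity, ?_⟩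
  set K := (A.toReal + 1) * 2 ^ p with hK
  intro T0
  by_contra hcon
  push Not at hcon
  set T := max T0 1 with hT
  have hT1 : 1 ≤ T := le_max_right _ _
  have hT0 : 0 < T := by linarith
  set c : ℝ≥0 := Real.toNNReal (K * (2 * T) ^ (-p)) with hc
  have h1 := h c
  have hsub : Icc T (2 * T) ⊆ {t ∈ Ioi (0:ℝ) | (c : ℝ≥0∞) ≤ eLpNorm (v t) (ENNReal.ofReal (α + 2)) volume} := by
    intro t ht
    have ht0 : 0 < t := by linarith [ht.1]
    refine ⟨ht0, ?_⟩
    rw [R.nu_eq ht0.le]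
    refine le_trans ?_ (hcon t ((le_max_left _ _).trans ht.1) ht0).le
    apply ENNReal.ofReal_le_ofReal
    have : (2 * T) ^ (-p) ≤ t ^ (-p) := Real.rpow_le_rpow_of_nonpos ht0 ht.2 (by linarith)
    gcongr
  have h2 : ENNReal.ofReal (K * (2 * T) ^ (-p)) * ENNReal.ofReal T ^ p ≤ A := by
    refine le_trans ?_ h1
    gcongr
    · exact le_rfl
    · refine le_trans (le_of_eq ?_) (measure_mono hsub)
      rw [Real.volume_Icc]; congr 1; ring
  rw [ENNReal.ofReal_rpow_of_pos hT0, ← ENNReal.ofReal_mul (by positivity)] at h2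
  have h3 : K * (2 * T) ^ (-p) * T ^ p = A.toReal + 1 := by
    rw [hK, Real.mul_rpow (by norm_num) hT0.le, Real.rpow_neg (by norm_num), Real.rpow_neg hT0.le]
    field_simp
  rw [h3] at h2
  have h4 := ENNReal.toReal_mono hA.ne h2
  rw [ENNReal.toReal_ofReal (by positivity)] at h4
  linarith

lemma EE_small (R : Raw α lam v) : ∃ C, ∀ T, ∃ t, T ≤ t ∧ EE α R.pf t ≤ C := by
  obtain ⟨K, hK, h⟩ := R.nu_small
  have hα := R.hα
  have hα2 := R.hα2
  refine ⟨(4 * π) ^ (α / 2) * K ^ (α + 2), fun T => ?_⟩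
  obtain ⟨t, h1, ht, h2⟩ := h T
  refine ⟨t, h1, ?_⟩
  have hs := E_scale (r := α) ht (R.pf t)
  rw [R.UU_pf] at hs
  have h3 : ∫ x, ‖R.f t x‖ ^ (α + 2) ≤ (K * t ^ (-(1 / (α + 1)))) ^ (α + 2) := by
    have hm : AEStronglyMeasurable (fun x => ‖R.f t x‖ ^ (α + 2)) volume :=
      ((Lp.aestronglyMeasurable (R.f t)).norm.aemeasurable.pow_const _).aestronglyMeasurable
    rw [integral_eq_lintegral_of_nonneg_ae (Eventually.of_forall fun x => by positivity) hm]
    refine ENNReal.toReal_le_of_le_ofReal (by positivity) ?_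
    have h4 : ∫⁻ x, ENNReal.ofReal (‖R.f t x‖ ^ (α + 2)) = LL (α + 2) (R.f t) := by
      refine lintegral_congr fun x => ?_
      rw [← ENNReal.ofReal_rpow_of_nonneg (norm_nonneg _) (by linarith), ofReal_norm]
    have h5 : LL (α + 2) (R.f t) = R.nu t ^ (α + 2) := by
      rw [nu, ← ENNReal.rpow_mul, one_div_mul_cancel (by linarith), ENNReal.rpow_one]
    rw [h4, h5, ← ENNReal.ofReal_rpow_of_pos (by positivity)]
    exact ENNReal.rpow_le_rpow h2 (by linarith)
  rw [hs] at h3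
  change _ * EE α R.pf t ≤ _ at h3
  have e1 : (K * t ^ (-(1 / (α + 1)))) ^ (α + 2) = K ^ (α + 2) * t ^ (-α / 2) := by
    rw [Real.mul_rpow hK.le (by positivity), ← Real.rpow_mul ht.le]
    congr 2; field_simp; nlinarith
  have e2 : (4 * π * t) ^ (-α / 2) = ((4 * π) ^ (α / 2))⁻¹ * t ^ (-α / 2) := by
    rw [Real.mul_rpow (by positivity) ht.le, neg_div, Real.rpow_neg (x := 4 * π) (by positivity)]
  rw [e1, e2] at h3
  have hp1 : 0 < (4 * π) ^ (α / 2) := by positivity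
  have hp2 : 0 < t ^ (-α / 2) := by positivity
  have h6 : ((4 * π) ^ (α / 2))⁻¹ * EE α R.pf t ≤ K ^ (α + 2) := by
    refine le_of_mul_le_mul_right ?_ hp2
    linarith
  rwa [inv_mul_le_iff₀ hp1] at h6

theorem scat (R : Raw α lam v) : ∃ φp : HH, ∃ D γ t1 : ℝ, 0 < γ ∧ 0 < t1 ∧ ∀ t, t1 ≤ t →
    ‖R.pf t - φp‖ ≤ D * t ^ (-γ) ∧ Cls (D * t ^ (-γ)) (R.pf t - φp) ∧ Cls D (R.pf t) := by
  obtain ⟨C0, hC0⟩ := R.cls2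
  obtain ⟨C, hC⟩ := R.EE_small
  obtain ⟨φp, D, γ, t1, h1, h2, h⟩ := R.flow.core R.hα2 two_pos hC0.1 hC0.2 hC
  refine ⟨φp, D, γ, t1, h1, h2, fun t ht => ?_⟩
  obtain ⟨a, b, c, d, e⟩ := h t ht
  exact ⟨a, ⟨b, c⟩, ⟨d, e⟩⟩

end Raw
end NLS
end

noncomputable section
open MeasureTheory Real Filter Topology Set
open scoped ENNReal NNReal FourierTransform SchwartzMap ContDiff
set_option linter.unusedVariables false

namespace NLS

variable {α lam : ℝ} {v : ℝ → ℝ → ℂ}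

/-- identification of the line with the one-dimensional Euclidean space -/
def ee : ℝ ≃ₗᵢ[ℝ] Rd 1 := (OrthonormalBasis.singleton (Fin 1) ℝ).repr

lemma ee_mp : MeasurePreserving ee := ee.measurePreserving
lemma ee_mps : MeasurePreserving ee.symm := ee.symm.measurePreserving
lemma ee_me : MeasurableEmbedding ee := ee.toHomeomorph.measurableEmbedding

lemma ee_eLpNorm {E : Type*} [NormedAddCommGroup E] (g : Rd 1 → E) (p : ℝ≥0∞) :
    eLpNorm g p volume = eLpNorm (fun x : ℝ => g (ee x)) p volume := by
  have h := ee_me.eLpNorm_map_measure (g := g) (p := p) (μ := volume)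
  rw [ee_mp.map_eq] at h
  exact h

lemma ee_LpN (p : ℝ) (F : Rd 1 → ℂ) : LpN 1 p F = eLpNorm (fun x : ℝ => F (ee x)) (ENNReal.ofReal p) volume :=
  ee_eLpNorm _ _

lemma ee_weightN (F : Rd 1 → ℂ) : weightN 1 F = eLpNorm (fun x : ℝ => (x : ℂ) * F (ee x)) 2 volume := by
  rw [weightN, ee_eLpNorm]
  refine eLpNorm_congr_norm_ae (Eventually.of_forall fun x => ?_)
  rw [norm_mul, norm_mul, norm_norm, norm_norm, ee.norm_map, Complex.norm_real]

lemma ee_gradLpN (F : Rd 1 → ℂ) : gradLpN 1 2 F = eLpNorm (fun x : ℝ => fderiv ℝ (fun y => F (ee y)) x) 2 volume := by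
  rw [gradLpN, ee_eLpNorm, ENNReal.ofReal_ofNat]
  refine eLpNorm_congr_norm_ae (Eventually.of_forall fun x => ?_)
  have h := ee.toContinuousLinearEquiv.comp_right_fderiv (f := F) (x := x)
  have h2 : fderiv ℝ (fun y => F (ee y)) x = (fderiv ℝ F (ee x)).comp (ee.toContinuousLinearEquiv : ℝ →L[ℝ] Rd 1) := h
  rw [h2]
  exact (ContinuousLinearMap.opNorm_comp_linearIsometryEquiv _ ee).symm

lemma sgroup_ee {t : ℝ} (ht : t ≠ 0) (φ : Rd 1 → ℂ) (x : ℝ) :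
    sgroup 1 t φ (ee x) = sg t (fun y => φ (ee y)) x := by
  rw [sgroup, if_neg ht]
  simp only [sg]
  congr 1
  · norm_num
  · rw [← ee_mp.integral_comp ee_me]
    refine integral_congr_ae (Eventually.of_forall fun y => ?_)
    simp only
    rw [← map_sub, ee.norm_map, phf]
    congr 2
    rw [Real.norm_eq_abs, sq_abs]
    push_cast
    ring

lemma fderiv_fatou {g : ℝ → ℂ} {G : HH} (hg : g =ᵐ[volume] G) {C : ℝ} (h : ∀ h, ‖Str h G‖ ≤ C * |h|) :
    eLpNorm (fun x => fderiv ℝ g x) 2 volume ≤ ENNReal.ofReal C := by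
  have hC : 0 ≤ C := by
    have := (norm_nonneg _).trans (h 1)
    simpa using this
  set δ : ℕ → ℝ := fun n => 1 / ((n : ℝ) + 1) with hδ
  have hδ0 : ∀ n, 0 < δ n := fun n => by positivity
  have hδt : Tendsto δ atTop (𝓝 0) := tendsto_one_div_add_atTop_nhds_zero_nat
  set q : ℕ → ℝ → ℂ := fun n x => (δ n)⁻¹ • (g (x + δ n) - g x) with hq
  have hqae : ∀ n, q n =ᵐ[volume] ((((δ n)⁻¹ : ℝ) : ℂ) • Str (δ n) G : HH) := by
    intro n
    filter_upwards [hg, ae_shift (δ n) hg, Lp.coeFn_smul (((δ n)⁻¹ : ℝ) : ℂ) (Str (δ n) G),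
      Lp.coeFn_sub (tr (δ n) G) G, tr_ae (δ n) G] with x h1 h2 h3 h4 h5
    rw [Str_apply] at h3
    rw [Str_apply, h3, Pi.smul_apply, h4, Pi.sub_apply, h5, hq]
    simp only [h1, h2]
    rfl
  have hpt : ∀ x, ‖fderiv ℝ g x‖ₑ ^ (2:ℝ) ≤ liminf (fun n => ‖q n x‖ₑ ^ (2:ℝ)) atTop := by
    intro x
    by_cases hd : DifferentiableAt ℝ g x
    · have h1 := hd.hasDerivAt.tendsto_slope_zero
      have h2 : Tendsto δ atTop (𝓝[≠] 0) :=
        tendsto_nhdsWithin_iff.2 ⟨hδt, Eventually.of_forall fun n => (hδ0 n).ne'⟩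
      have h3 := h1.comp h2
      have h4 : Tendsto (fun n => ‖q n x‖ₑ ^ (2:ℝ)) atTop (𝓝 (‖deriv g x‖ₑ ^ (2:ℝ))) :=
        (ENNReal.continuous_rpow_const.tendsto _).comp ((continuous_enorm.tendsto _).comp h3)
      rw [h4.liminf_eq, ← ofReal_norm, ← ofReal_norm, norm_deriv_eq_norm_fderiv]
    · rw [fderiv_zero_of_not_differentiableAt hd, ← ofReal_norm, norm_zero, ENNReal.ofReal_zero,
        ENNReal.zero_rpow_of_pos two_pos]
      exact zero_le
  have hqn : ∀ n, ∫⁻ x, ‖q n x‖ₑ ^ (2:ℝ) ≤ ENNReal.ofReal (C ^ 2) := by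
    intro n
    have e : ∫⁻ x, ‖q n x‖ₑ ^ (2:ℝ) = LL 2 ((((δ n)⁻¹ : ℝ) : ℂ) • Str (δ n) G : HH) := by
      refine lintegral_congr_ae ?_
      filter_upwards [hqae n] with x hx
      rw [hx]
    rw [e, LL_two]
    apply ENNReal.ofReal_le_ofReal
    have h1 := h (δ n)
    rw [abs_of_pos (hδ0 n)] at h1
    have : ‖((((δ n)⁻¹ : ℝ) : ℂ) • Str (δ n) G : HH)‖ ≤ C := by
      rw [norm_smul, Complex.norm_real, norm_inv, Real.norm_eq_abs, abs_of_pos (hδ0 n), inv_mul_le_iff₀ (hδ0 n), mul_comm]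
      exact h1
    gcongr
  have hI : ∫⁻ x, ‖fderiv ℝ g x‖ₑ ^ (2:ℝ) ≤ ENNReal.ofReal (C ^ 2) := by
    refine (lintegral_mono hpt).trans ((lintegral_liminf_le' fun n => ?_).trans ?_)
    · exact ((Lp.aestronglyMeasurable _).congr (hqae n).symm).enorm.pow_const _
    · exact (liminf_le_liminf (Eventually.of_forall hqn)).trans (by simp)
  rw [eLpNorm_eq_lintegral_rpow_enorm_toReal (by norm_num) (by norm_num), ENNReal.toReal_ofNat]
  calc _ ≤ ENNReal.ofReal (C ^ 2) ^ (1 / (2:ℝ)) := ENNReal.rpow_le_rpow hI (by norm_num)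
    _ = ENNReal.ofReal C := by
      rw [ENNReal.ofReal_rpow_of_nonneg (by positivity) (by norm_num), ← Real.sqrt_eq_rpow, Real.sqrt_sq hC]

lemma SigmaN_le {F : Rd 1 → ℂ} {G : HH} (hF : (fun x => F (ee x)) =ᵐ[volume] G) {C : ℝ}
    (h1 : ‖G‖ ≤ C) (h2 : Cls C G) : SigmaN 1 F ≤ 3 * ENNReal.ofReal C := by
  have a1 : LpN 1 2 F ≤ ENNReal.ofReal C := by
    rw [ee_LpN, ENNReal.ofReal_ofNat, eLpNorm_congr_ae hF, ← Lp.enorm_def, ← ofReal_norm]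
    exact ENNReal.ofReal_le_ofReal h1
  have a2 : gradLpN 1 2 F ≤ ENNReal.ofReal C := by
    rw [ee_gradLpN]; exact fderiv_fatou hF h2.2
  have a3 : weightN 1 F ≤ ENNReal.ofReal C := by
    obtain ⟨d1, d2⟩ := DX_of_S h2.1
    have e : (fun x : ℝ => (x : ℂ) * F (ee x)) =ᵐ[volume] XX G := by
      filter_upwards [hF, XX_ae d1] with x e1 e2
      rw [e2, e1]
    rw [ee_weightN, eLpNorm_congr_ae e, ← Lp.enorm_def, ← ofReal_norm]
    exact ENNReal.ofReal_le_ofReal d2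
  unfold SigmaN H1N
  calc _ ≤ ENNReal.ofReal C + ENNReal.ofReal C + ENNReal.ofReal C := by gcongr
    _ = _ := by ring

lemma mkRaw (lam α : ℝ) (hlam : 0 < lam)
    (hα : α = (1 + Real.sqrt 17) / 2)
    (u₀ : Rd 1 → ℂ) (hu₀ : MemSigma 1 u₀) (u : ℝ → Rd 1 → ℂ)
    (hu : IsSolution 1 lam α u₀ u (Ici 0)) (hc : SigmaContOn 1 u (Ici 0))
    (hdecay : weakLNorm (2*α*(α+2)/(4 - α*((1:ℝ) - 2))) (Ioi 0)
      (fun t => LpN 1 (α+2) (u t)) < ⊤) : Raw α lam (fun t x => u t (ee x)) := by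
  have h17 : √17 ^ 2 = 17 := Real.sq_sqrt (by norm_num)
  have h17' : 3 < √17 := Real.lt_sqrt_of_sq_lt (by norm_num)
  have hα2 : α ^ 2 = α + 4 := by rw [hα]; nlinarith
  have hα3 : 2 < α := by rw [hα]; linarith
  have le1 : ∀ F, LpN 1 2 F ≤ SigmaN 1 F := fun F => by
    unfold SigmaN H1N; exact le_add_right (le_add_right le_rfl)
  have le2 : ∀ F, weightN 1 F ≤ SigmaN 1 F := fun F => by
    unfold SigmaN; exact le_add_left le_rfl
  have hm : AEStronglyMeasurable (fun x => u 0 (ee x)) volume := by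
    rw [hu.1]; exact hu₀.1.comp_measurePreserving ee_mp
  refine ⟨hα2, hα3, hlam, ⟨hm, ?_⟩, ⟨?_, ?_⟩, ?_, ?_, ?_, ?_⟩
  · have h := (le1 u₀).trans_lt hu₀.2
    rw [ee_LpN, ENNReal.ofReal_ofNat, ← hu.1] at h
    exact h
  · exact Complex.continuous_ofReal.aestronglyMeasurable.mul hm
  · have h := (le2 u₀).trans_lt hu₀.2
    rw [ee_weightN, ← hu.1] at h
    exact h
  · intro t ht x
    have h := hu.2 t ht.le (ee x)
    rw [h, sgroup_ee ht.ne', hu.1]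
    congr 2
    apply intervalIntegral.integral_congr_ae
    have : ∀ᵐ τ : ℝ, τ ≠ t := by simp [ae_iff, measure_singleton]
    filter_upwards [this] with τ hτ _
    rw [sgroup_ee (sub_ne_zero.2 hτ.symm)]
    rfl
  · intro t ht
    refine tendsto_of_tendsto_of_tendsto_of_le_of_le tendsto_const_nhds (hc t ht) (fun _ => zero_le) fun s => ?_
    have := le1 (fun x => u s x - u t x)
    rwa [ee_LpN, ENNReal.ofReal_ofNat] at this
  · intro t ht
    refine tendsto_of_tendsto_of_tendsto_of_le_of_le tendsto_const_nhds (hc t ht) (fun _ => zero_le) fun s => ?_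
    have := le2 (fun x => u s x - u t x)
    rwa [ee_weightN] at this
  · refine ⟨_, hdecay, fun c => ?_⟩
    have h := le_iSup (fun c : ℝ≥0 => (c : ℝ≥0∞) *
      (volume {t ∈ Ioi (0:ℝ) | (c : ℝ≥0∞) ≤ LpN 1 (α+2) (u t)}) ^ (1 / (2*α*(α+2)/(4 - α*((1:ℝ) - 2))))) c
    have e : 2*α*(α+2)/(4 - α*((1:ℝ) - 2)) = α + 1 := by
      rw [div_eq_iff (by linarith)]; nlinarith
    simp only [e, ee_LpN] at h
    unfold weakLNorm
    simp only [e, ee_LpN]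
    exact h

theorem scatters {u : ℝ → Rd 1 → ℂ} (R : Raw α lam (fun t x => u t (ee x))) : ScattersAtPlus 1 u := by
  obtain ⟨φp, D, γ, t1, hγ, ht1, H⟩ := R.scat
  refine ⟨fun y => φp (ee.symm y), ⟨(Lp.aestronglyMeasurable φp).comp_measurePreserving ee_mps, ?_⟩, ?_⟩
  · obtain ⟨-, h2, h3⟩ := H t1 le_rfl
    set C := max ‖φp‖ (D + D * t1 ^ (-γ)) with hC
    have hcls : Cls C φp := by
      have e : φp = R.pf t1 - (R.pf t1 - φp) := by abel
      constructor
      · intro h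
        rw [e, map_sub]
        refine (norm_sub_le _ _).trans ((add_le_add (h3.1 h) (h2.1 h)).trans ?_)
        rw [← add_mul]; gcongr; exact le_max_right _ _
      · intro h
        rw [e, map_sub]
        refine (norm_sub_le _ _).trans ((add_le_add (h3.2 h) (h2.2 h)).trans ?_)
        rw [← add_mul]; gcongr; exact le_max_right _ _
    refine (SigmaN_le (G := φp) ?_ (le_max_left _ _) hcls).trans_lt
      (ENNReal.mul_lt_top (by simp) ENNReal.ofReal_lt_top)
    exact Eventually.of_forall fun x => by simp
  · have hlim : Tendsto (fun t : ℝ => 3 * ENNReal.ofReal (D * t ^ (-γ))) atTop (𝓝 0) := by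
      have h1 := ((tendsto_rpow_neg_atTop hγ).const_mul D)
      have h2 := ENNReal.Tendsto.const_mul (a := 3) (ENNReal.tendsto_ofReal h1) (Or.inr (by simp))
      simpa using h2
    refine tendsto_of_tendsto_of_tendsto_of_le_of_le' tendsto_const_nhds hlim (Eventually.of_forall fun _ => zero_le) ?_
    filter_upwards [eventually_ge_atTop t1] with t ht
    obtain ⟨h1, h2, -⟩ := H t ht
    have ht0 : 0 < t := ht1.trans_le ht
    refine SigmaN_le (G := R.pf t - φp) ?_ h1 h2
    have e1 : R.pf t =ᵐ[volume] sg (-t) (fun x => u t (ee x)) := by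
      have h0 : R.f t = (R.mem ht0.le).toLp (fun x => u t (ee x)) :=
        Lp.ext ((R.f_ae ht0.le).trans (MemLp.coeFn_toLp _).symm)
      rw [Raw.pf, h0]
      exact sg_ae (by linarith) (R.v_int ht0.le) (R.mem ht0.le)
    filter_upwards [e1, Lp.coeFn_sub (R.pf t) φp] with x h3 h4
    rw [h4, Pi.sub_apply, h3, sgroup_ee (by linarith), LinearIsometryEquiv.symm_apply_apply]

end NLS
end

noncomputable section
open MeasureTheory Real Filter Topology Set
open scoped ENNReal NNReal

/-- the one-dimensional case in the proof of Theorem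
`rapidly decaying`: for `d = 1`, `λ > 0`, `α = α(1) = (1+√17)/2`, if the positively
global solution has rapid decay (finite weak `L^a` norm in time with
`a = 2α(α+2)/(4-α(d-2))|_{d=1}`) but does not scatter at `+∞`, then
`‖(x+2it∇)u(t)‖_{L²} ≥ C t^{3/4-1/α}` for all `t ≥ 0` and
`‖u(t)‖_{L^{α+2}} ≥ C t^{-α/(2(α+2))}(log t)^{1/(α+2)}` for all `t ≥ 1`. -/
theorem one_dim_nonscattering_bounds (lam α : ℝ) (hlam : 0 < lam)
    (hα : α = (1 + Real.sqrt 17) / 2)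
    (u₀ : Rd 1 → ℂ) (hu₀ : MemSigma 1 u₀) (u : ℝ → Rd 1 → ℂ)
    (hu : IsSolution 1 lam α u₀ u (Ici 0)) (hc : SigmaContOn 1 u (Ici 0))
    (hdecay : weakLNorm (2*α*(α+2)/(4 - α*((1:ℝ) - 2))) (Ioi 0)
      (fun t => LpN 1 (α+2) (u t)) < ⊤)
    (hns : ¬ ScattersAtPlus 1 u) :
    (∃ C > (0:ℝ), ∀ t : ℝ, 0 ≤ t →
      ENNReal.ofReal (C * t ^ ((3:ℝ)/4 - 1/α)) ≤ PopLpN 1 2 t (u t)) ∧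
    (∃ C > (0:ℝ), ∀ t : ℝ, 1 ≤ t →
      ENNReal.ofReal (C * t ^ (-(α/(2*(α+2)))) * (Real.log t) ^ ((1:ℝ)/(α+2))) ≤
        LpN 1 (α+2) (u t)) := by
  exact absurd (NLS.scatters (NLS.mkRaw lam α hlam hα u₀ hu₀ u hu hc hdecay)) hns
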